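/- arXiv:2008.07400 — 9 statements merged into one kernel-verified Lean document; each statement's English description precedes it below -/
import Mathlib

section
/- Let 0 < L ≤ 1 and σ > 0. Then there exists a constant C > 0 (depending on L and σ) such that for every integer j ≥ 0 the ordered Robin and Neumann eigenvalues of the rectangle [0,1]×[0,L] satisfy 0 < λ_j(σ) − λ_j(0) ≤ C. -/
open Real

theorem ordered_aux (f g : ℕ × ℕ → ℝ) (C : ℝ) (hf0 : ∀ p, 0 ≤ f p)
    (hfin : ∀ x, {p | f p ≤ x}.Finite) (hfg : ∀ p, f p < g p) (hgf : ∀ p, g p ≤ f p + C) (j : ℕ) :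
    sInf {x : ℝ | j + 1 ≤ {p | f p ≤ x}.ncard} < sInf {x : ℝ | j + 1 ≤ {p | g p ≤ x}.ncard} ∧
    sInf {x : ℝ | j + 1 ≤ {p | g p ≤ x}.ncard} ≤
      sInf {x : ℝ | j + 1 ≤ {p | f p ≤ x}.ncard} + C := by
  have hgfin : ∀ x, {p | g p ≤ x}.Finite := fun x =>
    (hfin x).subset (fun p (hp : g p ≤ x) => (hfg p).le.trans hp)
  set Sf := {x : ℝ | j + 1 ≤ {p | f p ≤ x}.ncard} with hSf
  set Sg := {x : ℝ | j + 1 ≤ {p | g p ≤ x}.ncard} with hSg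
  have hSfne : Sf.Nonempty := by
    obtain ⟨s, hs⟩ := Infinite.exists_subset_card_eq (ℕ × ℕ) (j + 1)
    obtain ⟨M, hM⟩ := (s.image f).exists_le
    refine ⟨M, ?_⟩
    show j + 1 ≤ _
    rw [← hs, ← Set.ncard_coe_finset]
    exact Set.ncard_le_ncard (fun p hp => hM _ (Finset.mem_image_of_mem f hp)) (hfin M)
  have hSfb : BddBelow Sf := by
    refine ⟨0, fun x hx => ?_⟩
    have hx' : j + 1 ≤ {p | f p ≤ x}.ncard := hx
    obtain ⟨p, hp⟩ := Set.nonempty_of_ncard_ne_zero (s := {p | f p ≤ x}) (by omega)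
    exact (hf0 p).trans hp
  have hsub : ∀ x ∈ Sg, x ∈ Sf := fun x hx => by
    have hx' : j + 1 ≤ {p | g p ≤ x}.ncard := hx
    exact hx'.trans (Set.ncard_le_ncard (fun p (hp : g p ≤ x) => (hfg p).le.trans hp) (hfin x))
  have hSgb : BddBelow Sg := hSfb.mono hsub
  have hshift : ∀ x ∈ Sf, x + C ∈ Sg := fun x hx => by
    have hx' : j + 1 ≤ {p | f p ≤ x}.ncard := hx
    refine hx'.trans (Set.ncard_le_ncard (fun p (hp : f p ≤ x) => ?_) (hgfin _))
    show g p ≤ x + C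
    linarith [hgf p]
  have hSgne : Sg.Nonempty := hSfne.imp' (· + C) hshift
  constructor
  · set y := sInf Sg with hy
    have hmem : y ∈ Sg := by
      have h1 : ∀ᶠ x in nhdsWithin y (Set.Ioi y), ∀ p ∈ {p | g p ≤ y + 1}, g p ≤ x → g p ≤ y := by
        rw [Filter.eventually_all_finite (hgfin _)]
        intro p _
        by_cases h : g p ≤ y
        · exact Filter.Eventually.of_forall fun _ _ => h
        · push Not at h
          filter_upwards [Ioo_mem_nhdsGT h] with x hx h2
          exact absurd h2 (not_le.2 hx.2)
      obtain ⟨u, hu, hu2⟩ := mem_nhdsGT_iff_exists_Ioo_subset.1 h1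
      have hu' : y < u := hu
      obtain ⟨x, hx, hxu⟩ := exists_lt_of_csInf_lt hSgne
        (show sInf Sg < min u (y + 1) from lt_min hu' (by linarith))
      have hyx : y ≤ x := csInf_le hSgb hx
      rcases hyx.eq_or_lt with h | h
      · rw [h]; exact hx
      · have h3 := hu2 ⟨h, hxu.trans_le (min_le_left _ _)⟩
        have hx' : j + 1 ≤ {p | g p ≤ x}.ncard := hx
        refine hx'.trans (Set.ncard_le_ncard (fun p (hp : g p ≤ x) => ?_) (hgfin _))
        exact h3 p (hp.trans (hxu.le.trans (min_le_right _ _))) hp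
    have hmem' : j + 1 ≤ {p | g p ≤ y}.ncard := hmem
    obtain ⟨q, hq, hq2⟩ := Set.exists_max_image {p | g p ≤ y} f (hgfin y)
      (Set.nonempty_of_ncard_ne_zero (by omega))
    have : f q ∈ Sf := hmem'.trans (Set.ncard_le_ncard hq2 (hfin _))
    exact (csInf_le hSfb this).trans_lt ((hfg q).trans_le hq)
  · rw [← sub_le_iff_le_add]
    refine le_csInf hSfne fun x hx => ?_
    rw [sub_le_iff_le_add]
    exact csInf_le hSgb (hshift x hx)

theorem k_aux (τ : ℝ) (hτ : 0 < τ) (n : ℕ) (k : ℝ)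
    (hk : k ∈ Set.Ioo ((n : ℝ) * π) (((n : ℝ) + 1) * π))
    (he : (k ^ 2 - τ ^ 2) * Real.sin k = 2 * τ * k * Real.cos k) :
    ((n : ℝ) * π) ^ 2 < k ^ 2 ∧ k ^ 2 ≤ ((n : ℝ) * π) ^ 2 + (4 * τ ^ 2 + 3 * π * τ) := by
  obtain ⟨h1, h2⟩ := hk
  have hπ := Real.pi_pos
  have hn : 0 ≤ (n : ℝ) * π := by positivity
  refine ⟨by nlinarith, ?_⟩
  have hk0 : 0 < k := by linarith
  by_cases hc : k ≤ 2 * τ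
  · have : 0 < 3 * π * τ := by positivity
    nlinarith [sq_nonneg ((n : ℝ) * π)]
  push Not at hc
  obtain ⟨d, hd⟩ : ∃ d, k = d + n * π := ⟨k - n * π, by ring⟩
  have hd0 : 0 < d := by linarith
  have hdπ : d < π := by linarith
  have he2 : (k ^ 2 - τ ^ 2) * Real.sin d = 2 * τ * k * Real.cos d := by
    have hs : Real.sin k = (-1) ^ n * Real.sin d := by rw [hd, Real.sin_add_nat_mul_pi]
    have hco : Real.cos k = (-1) ^ n * Real.cos d := by rw [hd, Real.cos_add_nat_mul_pi]
    rw [hs, hco] at he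
    have h3 : ((-1 : ℝ)) ^ n ≠ 0 := pow_ne_zero _ (by norm_num)
    apply mul_left_cancel₀ h3
    linarith
  have hsin : 0 < Real.sin d := Real.sin_pos_of_pos_of_lt_pi hd0 hdπ
  have hq : 3 / 4 * k ^ 2 ≤ k ^ 2 - τ ^ 2 := by nlinarith
  have hcos : 0 < Real.cos d := by
    have : 0 < 2 * τ * k * Real.cos d := by
      rw [← he2]; exact mul_pos (by nlinarith) hsin
    exact pos_of_mul_pos_right this (by positivity)
  have hd2 : d ≤ π / 2 := by
    by_contra h
    push Not at h
    have := Real.cos_nonpos_of_pi_div_two_le_of_le h.le (by linarith)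
    linarith
  have hj : 2 / π * d ≤ Real.sin d := Real.mul_le_sin hd0.le hd2
  have hj2 : 2 * d ≤ π * Real.sin d := by
    have := mul_le_mul_of_nonneg_left hj hπ.le
    have e : π * (2 / π * d) = 2 * d := by field_simp
    linarith
  have hks : 3 / 4 * k * Real.sin d ≤ 2 * τ := by
    have h5 : 3 / 4 * k ^ 2 * Real.sin d ≤ 2 * τ * k := by
      calc _ ≤ (k ^ 2 - τ ^ 2) * Real.sin d := mul_le_mul_of_nonneg_right hq hsin.le
        _ = 2 * τ * k * Real.cos d := he2
        _ ≤ 2 * τ * k * 1 := mul_le_mul_of_nonneg_left (Real.cos_le_one d) (by positivity)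
        _ = _ := by ring
    by_contra h
    push Not at h
    nlinarith
  have h6 : 2 * k * d ≤ 3 * π * τ := by
    have a := mul_le_mul_of_nonneg_left hj2 hk0.le
    have b := mul_le_mul_of_nonneg_left hks hπ.le
    have c : 0 < π * τ := by positivity
    nlinarith
  have h7 : (n : ℝ) * π = k - d := by linarith
  rw [h7]
  nlinarith [sq_nonneg d, sq_nonneg τ]

/-- Let `0 < L ≤ 1`, `σ > 0`. With `k τ n` the unique solution in `(nπ, (n+1)π)` of the
secular equation with parameter `τ > 0` (and `k 0 n = nπ`), the Robin eigenvalues of the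
rectangle `[0,1]×[0,L]` are `Λ_{n,m}(τ) = k_n(τ)² + L⁻²·k_m(τL)²`, and the ordered
eigenvalues are `λ_j(τ) = inf {x : #{(n,m) : Λ_{n,m}(τ) ≤ x} ≥ j+1}`. Then there exists
`C > 0` (depending on `L`, `σ`) with `0 < λ_j(σ) − λ_j(0) ≤ C` for every `j ≥ 0`. -/
theorem rectangle_ordered_RN_gap_bounded (L σ : ℝ) (hL : 0 < L) (hL1 : L ≤ 1) (hσ : 0 < σ)
    (k : ℝ → ℕ → ℝ)
    (hk : ∀ τ : ℝ, 0 < τ → ∀ n : ℕ,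
      k τ n ∈ Set.Ioo ((n : ℝ) * π) (((n : ℝ) + 1) * π) ∧
      ((k τ n) ^ 2 - τ ^ 2) * Real.sin (k τ n) = 2 * τ * (k τ n) * Real.cos (k τ n))
    (hk0 : ∀ n : ℕ, k 0 n = (n : ℝ) * π)
    (Λ : ℝ → ℕ → ℕ → ℝ)
    (hΛ : ∀ τ : ℝ, ∀ n m : ℕ, Λ τ n m = (k τ n) ^ 2 + L⁻¹ ^ 2 * (k (τ * L) m) ^ 2)
    (lam : ℝ → ℕ → ℝ)
    (hlam : ∀ τ : ℝ, ∀ j : ℕ,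
      lam τ j = sInf {x : ℝ | j + 1 ≤ ({p : ℕ × ℕ | Λ τ p.1 p.2 ≤ x}).ncard}) :
    ∃ C : ℝ, 0 < C ∧ ∀ j : ℕ,
      0 < lam σ j - lam 0 j ∧ lam σ j - lam 0 j ≤ C := by
  have hσL : 0 < σ * L := mul_pos hσ hL
  have hLi : 1 ≤ L⁻¹ ^ 2 := one_le_pow₀ ((one_le_inv₀ hL).2 hL1)
  have hLi0 : 0 < L⁻¹ ^ 2 := by linarith
  set C : ℝ := (4 * σ ^ 2 + 3 * π * σ) + L⁻¹ ^ 2 * (4 * (σ * L) ^ 2 + 3 * π * (σ * L)) with hC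
  have hπ := Real.pi_gt_three
  have hΛ0 : ∀ n m : ℕ, Λ 0 n m = ((n : ℝ) * π) ^ 2 + L⁻¹ ^ 2 * ((m : ℝ) * π) ^ 2 := by
    intro n m
    rw [hΛ, zero_mul, hk0, hk0]
  have hsq : ∀ n : ℕ, (n : ℝ) ≤ ((n : ℝ) * π) ^ 2 := by
    intro n
    rcases Nat.eq_zero_or_pos n with h | h
    · simp [h]
    · have h1 : (1 : ℝ) ≤ n := by exact_mod_cast h
      have h2 : (n : ℝ) ≤ n * π := by nlinarith
      nlinarith
  have key := ordered_aux (fun p => Λ 0 p.1 p.2) (fun p => Λ σ p.1 p.2) C ?_ ?_ ?_ ?_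
  · refine ⟨C, by positivity, fun j => ?_⟩
    have := key j
    rw [hlam, hlam]
    exact ⟨sub_pos.2 this.1, by linarith [this.2]⟩
  · intro p
    simp only [hΛ0]
    positivity
  · intro x
    refine ((Set.finite_Iic ⌊x⌋₊).prod (Set.finite_Iic ⌊x⌋₊)).subset ?_
    rintro ⟨n, m⟩ h
    have h' : Λ 0 n m ≤ x := h
    rw [hΛ0] at h'
    have a := hsq n
    have b := hsq m
    have c : ((m : ℝ) * π) ^ 2 ≤ L⁻¹ ^ 2 * ((m : ℝ) * π) ^ 2 :=
      le_mul_of_one_le_left (sq_nonneg _) hLi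
    have d : (0 : ℝ) ≤ n := Nat.cast_nonneg n
    have e : (0 : ℝ) ≤ m := Nat.cast_nonneg m
    exact ⟨Nat.le_floor (by linarith), Nat.le_floor (by linarith)⟩
  · intro p
    have a := (k_aux σ hσ p.1 _ (hk σ hσ p.1).1 (hk σ hσ p.1).2).1
    have b := (k_aux _ hσL p.2 _ (hk _ hσL p.2).1 (hk _ hσL p.2).2).1
    simp only [hΛ0]
    rw [hΛ]
    have := mul_lt_mul_of_pos_left b hLi0
    linarith
  · intro p
    have a := (k_aux σ hσ p.1 _ (hk σ hσ p.1).1 (hk σ hσ p.1).2).2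
    have b := (k_aux _ hσL p.2 _ (hk _ hσL p.2).1 (hk _ hσL p.2).2).2
    simp only [hΛ0]
    rw [hΛ]
    have := mul_le_mul_of_nonneg_left b hLi0.le
    rw [mul_add] at this
    linarith
end

section
/- Fix σ ≥ 0. Let λ_0 ≤ λ_1 ≤ λ_2 ≤ … be the ordered desymmetrized Robin eigenvalues of the unit square, i.e. λ_j := inf{x ∈ ℝ : #{(m,n) ∈ ℕ×ℕ : m ≤ n and k_m(σ)² + k_n(σ)² ≤ x} ≥ j+1}. Then for every y > 0, lim_{N→∞} (1/N)·#{n ∈ {0,1,…,N} : λ_{n+1} − λ_n ≤ y} = 1; that is, the level spacing distribution of the desymmetrized Robin spectrum on the unit square is a delta function at the origin. -/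
open Real

noncomputable def fz (s : ℝ) (hs : 1 < s) : ℕ →*₀ ℝ where
  toFun n := (n : ℝ) ^ (-s)
  map_zero' := by
    simp only [Nat.cast_zero]
    exact Real.zero_rpow (by linarith)
  map_one' := by simp
  map_mul' m n := by
    simp only [Nat.cast_mul]
    exact Real.mul_rpow (Nat.cast_nonneg _) (Nat.cast_nonneg _)

noncomputable def fx (s : ℝ) (hs : 1 < s) : ℕ →*₀ ℝ where
  toFun n := ((ZMod.χ₄ (n : ZMod 4) : ℤ) : ℝ) * (n : ℝ) ^ (-s)
  map_zero' := by
    simp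
  map_one' := by simp
  map_mul' m n := by
    simp only [Nat.cast_mul, map_mul, Int.cast_mul]
    rw [Real.mul_rpow (Nat.cast_nonneg _) (Nat.cast_nonneg _)]
    ring

lemma fx_eq (s : ℝ) (hs : 1 < s) (n : ℕ) :
    fx s hs n = ((ZMod.χ₄ (n : ZMod 4) : ℤ) : ℝ) * (n : ℝ) ^ (-s) := rfl
lemma fz_eq (s : ℝ) (hs : 1 < s) (n : ℕ) : fz s hs n = (n : ℝ) ^ (-s) := rfl

lemma fz_sum (s : ℝ) (hs : 1 < s) : Summable (fun n => ‖fz s hs n‖) := by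
  have := (Real.summable_nat_rpow (p := -s)).2 (by linarith)
  exact this.norm

lemma fx_le (s : ℝ) (hs : 1 < s) (n : ℕ) : ‖fx s hs n‖ ≤ ‖fz s hs n‖ := by
  rw [fx_eq, fz_eq, norm_mul]
  have : ‖((ZMod.χ₄ (n : ZMod 4) : ℤ) : ℝ)‖ ≤ 1 := by
    rcases ZMod.isQuadratic_χ₄ (n : ZMod 4) with h | h | h <;> rw [h] <;> simp
  calc _ ≤ 1 * _ := mul_le_mul_of_nonneg_right this (norm_nonneg _)
    _ = _ := one_mul _

lemma fx_sum (s : ℝ) (hs : 1 < s) : Summable (fun n => ‖fx s hs n‖) :=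
  Summable.of_nonneg_of_le (fun _ => norm_nonneg _) (fx_le s hs) (fz_sum s hs)

lemma fx_partial (s : ℝ) (hs : 1 < s) (N : ℕ) :
    ∑ n ∈ Finset.range (4 * N + 2), fx s hs n ≤ 1 := by
  induction N with
  | zero => simp [Finset.sum_range_succ]
  | succ N ih =>
    have e : 4 * (N + 1) + 2 = 4 * N + 2 + 1 + 1 + 1 + 1 := by ring
    rw [e]
    simp only [Finset.sum_range_succ _ (4 * N + 2 + 1 + 1 + 1), Finset.sum_range_succ _ (4 * N + 2 + 1 + 1),
      Finset.sum_range_succ _ (4 * N + 2 + 1), Finset.sum_range_succ _ (4 * N + 2)]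
    have h1 : fx s hs (4 * N + 2) = 0 := by
      rw [fx_eq, ZMod.χ₄_nat_eq_if_mod_four, if_pos (by omega)]; simp
    have h2 : fx s hs (4 * N + 2 + 1) = - ((4 * N + 2 + 1 : ℕ) : ℝ) ^ (-s) := by
      rw [fx_eq, ZMod.χ₄_nat_three_mod_four (by omega)]; simp
    have h3 : fx s hs (4 * N + 2 + 1 + 1) = 0 := by
      rw [fx_eq, ZMod.χ₄_nat_eq_if_mod_four, if_pos (by omega)]; simp
    have h4 : fx s hs (4 * N + 2 + 1 + 1 + 1) = ((4 * N + 2 + 1 + 1 + 1 : ℕ) : ℝ) ^ (-s) := by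
      rw [fx_eq, ZMod.χ₄_nat_one_mod_four (by omega)]; simp
    have h5 : ((4 * N + 2 + 1 + 1 + 1 : ℕ) : ℝ) ^ (-s) ≤ ((4 * N + 2 + 1 : ℕ) : ℝ) ^ (-s) := by
      apply Real.rpow_le_rpow_of_nonpos
      · positivity
      · exact_mod_cast (by omega)
      · linarith
    rw [h1, h2, h3, h4]
    linarith

lemma fx_tsum (s : ℝ) (hs : 1 < s) : ∑' n, fx s hs n ≤ 1 := by
  have h := (fx_sum s hs).of_norm.hasSum.tendsto_sum_nat
  have h2 : Filter.Tendsto (fun N : ℕ => 4 * N + 2) Filter.atTop Filter.atTop :=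
    Filter.tendsto_atTop_mono (fun n => by show n ≤ _; omega) Filter.tendsto_id
  exact le_of_tendsto' (h.comp h2) (fun N => fx_partial s hs N)

noncomputable def qq (p : ℕ) : ℝ := if p.Prime ∧ p % 4 = 3 then 1 / (p : ℝ) else 0

lemma qq_nonneg (p : ℕ) : 0 ≤ qq p := by
  unfold qq; split_ifs <;> positivity

lemma rpow_bd (s : ℝ) (hs : 1 < s) (p : ℕ) (hp : 2 ≤ p) :
    0 < (p : ℝ) ^ (-s) ∧ (p : ℝ) ^ (-s) ≤ 1 / p := by
  have hp' : (2 : ℝ) ≤ p := by exact_mod_cast hp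
  refine ⟨by positivity, ?_⟩
  rw [one_div, ← Real.rpow_neg_one]
  exact Real.rpow_le_rpow_of_exponent_le (by linarith) (by linarith)

lemma local_bd (s : ℝ) (hs : 1 < s) (p : ℕ) (hp : p.Prime) :
    0 ≤ (1 - fz s hs p)⁻¹ ∧ 0 ≤ (1 - fx s hs p)⁻¹ ∧
    (1 - fz s hs p)⁻¹ ≤ (1 - fx s hs p)⁻¹ * ((if p = 2 then 2 else 1) * Real.exp (4 * qq p)) := by
  have hp2 := hp.two_le
  have hp2' : (2 : ℝ) ≤ p := by exact_mod_cast hp2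
  obtain ⟨h0, h1⟩ := rpow_bd s hs p hp2
  have h2 : (1 : ℝ) / p ≤ 1 / 2 := one_div_le_one_div_of_le (by norm_num) hp2'
  rw [fx_eq, fz_eq]
  unfold qq
  generalize (p : ℝ) ^ (-s) = t at *
  have i1 : 0 ≤ (1 - t)⁻¹ := inv_nonneg.2 (by linarith)
  refine ⟨i1, ?_⟩
  rcases hp.eq_two_or_odd with h | h
  · subst h
    rw [ZMod.χ₄_nat_eq_if_mod_four]
    norm_num
    rw [inv_le_comm₀ (by linarith) (by norm_num)]; norm_num at h2 h1 ⊢; linarith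
  · have hne : p ≠ 2 := by rintro rfl; omega
    rcases (by omega : p % 4 = 1 ∨ p % 4 = 3) with h4 | h4
    · rw [ZMod.χ₄_nat_one_mod_four h4]
      simp only [Int.cast_one, one_mul, hne, if_false, h4]
      norm_num
      linarith
    · rw [ZMod.χ₄_nat_three_mod_four h4, if_neg hne, if_pos ⟨hp, h4⟩]
      simp only [Int.cast_neg, Int.cast_one]
      refine ⟨inv_nonneg.2 (by linarith), ?_⟩
      have e : (4 * (1 / (p : ℝ))) + 1 ≤ Real.exp (4 * (1 / p)) := Real.add_one_le_exp _
      have : (1 - t)⁻¹ ≤ (1 - -1 * t)⁻¹ * (1 + 4 * t) := by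
        rw [inv_mul_eq_div, le_div_iff₀ (by linarith), inv_mul_le_iff₀ (by linarith)]
        nlinarith
      refine this.trans (mul_le_mul_of_nonneg_left (by linarith) (inv_nonneg.2 (by linarith)))

lemma not_summable_qq : ¬ Summable qq := by
  intro hS
  set A := ∑' p, qq p with hA
  have key : ∀ s (hs : 1 < s), ∑' n, fz s hs n ≤ 2 * Real.exp (4 * A) := by
    intro s hs
    have h1 := EulerProduct.eulerProduct_completely_multiplicative (fz_sum s hs)
    have h2 := (EulerProduct.eulerProduct_completely_multiplicative (fx_sum s hs)).mul_const
      (2 * Real.exp (4 * A))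
    have h3 := le_of_tendsto_of_tendsto' h1 h2 (fun n => by
      have hpr : ∀ p ∈ n.primesBelow, p.Prime := fun p hp => Nat.prime_of_mem_primesBelow hp
      calc _ ≤ ∏ p ∈ n.primesBelow, ((1 - fx s hs p)⁻¹ * ((if p = 2 then 2 else 1) * Real.exp (4 * qq p))) :=
            Finset.prod_le_prod (fun p hp => (local_bd s hs p (hpr p hp)).1)
              (fun p hp => (local_bd s hs p (hpr p hp)).2.2)
        _ = (∏ p ∈ n.primesBelow, (1 - fx s hs p)⁻¹) * ((∏ p ∈ n.primesBelow, (if p = 2 then (2:ℝ) else 1))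
              * Real.exp (4 * ∑ p ∈ n.primesBelow, qq p)) := by
            rw [Finset.prod_mul_distrib, Finset.prod_mul_distrib, Finset.mul_sum, Real.exp_sum]
        _ ≤ _ := by
            apply mul_le_mul_of_nonneg_left _ (Finset.prod_nonneg fun p hp => (local_bd s hs p (hpr p hp)).2.1)
            apply mul_le_mul
            · rw [Finset.prod_ite_eq']
              split_ifs <;> norm_num
            · rw [Real.exp_le_exp]
              have := hS.sum_le_tsum n.primesBelow (fun p _ => qq_nonneg p)
              linarith
            · positivity
            · norm_num)
    refine h3.trans ?_
    have := fx_tsum s hs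
    have hpos : 0 < 2 * Real.exp (4 * A) := by positivity
    nlinarith
  apply Real.not_summable_one_div_natCast
  apply summable_of_sum_range_le (c := 2 * Real.exp (4 * A)) (fun n => by positivity)
  intro N
  have hc : Filter.Tendsto (fun s : ℝ => ∑ n ∈ Finset.range N, (n : ℝ) ^ (-s)) (nhdsWithin 1 (Set.Ioi 1))
      (nhds (∑ n ∈ Finset.range N, (n : ℝ) ^ (-(1:ℝ)))) := by
    apply tendsto_finsetSum
    intro n _
    rcases Nat.eq_zero_or_pos n with rfl | hn
    · have : Filter.Tendsto (fun s : ℝ => (0:ℝ)) (nhdsWithin 1 (Set.Ioi 1)) (nhds 0) := tendsto_const_nhds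
      simp only [Nat.cast_zero]
      rw [Real.zero_rpow (by norm_num)]
      apply this.congr'
      filter_upwards [self_mem_nhdsWithin] with s hs
      rw [Real.zero_rpow]
      have : (1:ℝ) < s := hs
      linarith
    · apply Filter.Tendsto.mono_left _ nhdsWithin_le_nhds
      have : Continuous (fun s : ℝ => (n : ℝ) ^ (-s)) := by
        apply Continuous.rpow continuous_const continuous_neg
        intro x; left; positivity
      exact this.tendsto 1
  have : ∑ n ∈ Finset.range N, (n : ℝ) ^ (-(1:ℝ)) ≤ 2 * Real.exp (4 * A) := by
    apply le_of_tendsto hc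
    filter_upwards [self_mem_nhdsWithin] with s hs
    refine le_trans ?_ (key s hs)
    exact (fz_sum s hs).of_norm.sum_le_tsum _ (fun n _ => Real.rpow_nonneg (Nat.cast_nonneg n) _)
  simpa [Real.rpow_neg_one] using this

/-- local density -/
lemma exists_T (ε : ℝ) (hε : 0 < ε) : ∃ T : Finset ℕ, (∀ p ∈ T, p.Prime ∧ p % 4 = 3) ∧
    ∏ p ∈ T, (1 - 1 / (p : ℝ) + 1 / (p : ℝ) ^ 2) ≤ ε := by
  have h := (not_summable_iff_tendsto_nat_atTop_of_nonneg qq_nonneg).1 not_summable_qq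
  obtain ⟨n, hn⟩ := (h.eventually_ge_atTop (-2 * Real.log ε)).exists
  refine ⟨(Finset.range n).filter (fun p => p.Prime ∧ p % 4 = 3), fun p hp => (Finset.mem_filter.1 hp).2, ?_⟩
  have hs : ∑ p ∈ (Finset.range n).filter (fun p => p.Prime ∧ p % 4 = 3), (1 / (p : ℝ)) = ∑ i ∈ Finset.range n, qq i := by
    rw [Finset.sum_filter]; rfl
  calc _ ≤ ∏ p ∈ (Finset.range n).filter (fun p => p.Prime ∧ p % 4 = 3), Real.exp (-(1/2) * (1 / (p : ℝ))) := by
        apply Finset.prod_le_prod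
        · intro p hp
          have : (2 : ℝ) ≤ p := by exact_mod_cast (Finset.mem_filter.1 hp).2.1.two_le
          have h2 : (1 : ℝ) / p ≤ 1 / 2 := one_div_le_one_div_of_le (by norm_num) this
          have : 0 ≤ 1 / (p:ℝ)^2 := by positivity
          linarith
        · intro p hp
          have : (2 : ℝ) ≤ p := by exact_mod_cast (Finset.mem_filter.1 hp).2.1.two_le
          have h2 : (1 : ℝ) / p ≤ 1 / 2 := one_div_le_one_div_of_le (by norm_num) this
          have h0 : 0 < (1 : ℝ) / p := by positivity
          refine le_trans ?_ (Real.add_one_le_exp _)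
          rw [← one_div_pow]
          nlinarith
    _ = Real.exp (-(1/2) * ∑ i ∈ Finset.range n, qq i) := by
        rw [← hs, Finset.mul_sum, Real.exp_sum]
    _ ≤ _ := by
        rw [← Real.le_log_iff_exp_le hε]
        linarith

def PT (T : Finset ℕ) (s : ℕ) : Prop := ∀ p ∈ T, p ∣ s → p ^ 2 ∣ s

lemma two_sq_PT (T : Finset ℕ) (hT : ∀ p ∈ T, p.Prime ∧ p % 4 = 3) (a b : ℕ) : PT T (a ^ 2 + b ^ 2) := by
  intro p hp hd
  have h := Nat.eq_sq_add_sq_iff.1 ⟨a, b, rfl⟩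
  rcases Nat.eq_zero_or_pos (a ^ 2 + b ^ 2) with h0 | h0
  · rw [h0]; exact dvd_zero _
  have hpp := (hT p hp).1
  have he := h p (Nat.mem_primeFactors.2 ⟨hpp, hd, h0.ne'⟩) (hT p hp).2
  haveI : Fact p.Prime := ⟨hpp⟩
  have h1 : 1 ≤ padicValNat p (a ^ 2 + b ^ 2) := one_le_padicValNat_of_dvd h0.ne' hd
  rw [padicValNat_dvd_iff_le h0.ne']
  obtain ⟨c, hc⟩ := he
  omega

open Classical in
lemma count_p (p : ℕ) (hp : p.Prime) :
    (((Finset.range (p ^ 2)).filter (fun s => p ∣ s → p ^ 2 ∣ s)).card : ℝ) ≤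
      (p : ℝ) ^ 2 * (1 - 1 / (p : ℝ) + 1 / (p : ℝ) ^ 2) := by
  have hp0 := hp.pos
  have hsub : (Finset.range (p ^ 2)).filter (fun s => p ∣ s → p ^ 2 ∣ s) ⊆
      (Finset.range (p ^ 2)) \ ((Finset.Ico 1 p).image (fun j => p * j)) := by
    intro s hs
    rw [Finset.mem_filter] at hs
    rw [Finset.mem_sdiff]
    refine ⟨hs.1, fun h => ?_⟩
    obtain ⟨j, hj, rfl⟩ := Finset.mem_image.1 h
    rw [Finset.mem_Ico] at hj
    have := hs.2 (dvd_mul_right _ _)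
    rw [pow_two] at this
    have := Nat.le_of_dvd (by omega) (Nat.dvd_of_mul_dvd_mul_left hp0 this)
    omega
  have h := Finset.card_le_card hsub
  have hsub2 : ((Finset.Ico 1 p).image (fun j => p * j)) ⊆ Finset.range (p ^ 2) := by
    intro s hs
    obtain ⟨j, hj, rfl⟩ := Finset.mem_image.1 hs
    rw [Finset.mem_Ico] at hj
    rw [Finset.mem_range, pow_two]
    exact Nat.mul_lt_mul_of_pos_left hj.2 hp0
  rw [Finset.card_sdiff_of_subset hsub2, Finset.card_image_of_injective _ (fun a b h => Nat.eq_of_mul_eq_mul_left hp0 h),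
    Finset.card_range, Nat.card_Ico] at h
  have h2 : ((Finset.range (p ^ 2)).filter (fun s => p ∣ s → p ^ 2 ∣ s)).card + p ≤ p ^ 2 + 1 := by
    have : p ≤ p ^ 2 := by nlinarith
    omega
  have h3 : (((Finset.range (p ^ 2)).filter (fun s => p ∣ s → p ^ 2 ∣ s)).card : ℝ) + p ≤ p ^ 2 + 1 := by
    exact_mod_cast h2
  have : (p : ℝ) ^ 2 * (1 - 1 / (p : ℝ) + 1 / (p : ℝ) ^ 2) = p ^ 2 - p + 1 := by
    field_simp
  linarith

open Classical in
lemma count_mul (a b : ℕ) (hab : a.Coprime b) (ha : 0 < a) (hb : 0 < b) (A B : ℕ → Prop)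
    (hA : ∀ n, A n → A (n % a)) (hB : ∀ n, B n → B (n % b)) :
    ((Finset.range (a * b)).filter (fun n => A n ∧ B n)).card ≤
      ((Finset.range a).filter A).card * ((Finset.range b).filter B).card := by
  rw [← Finset.card_product]
  apply Finset.card_le_card_of_injOn (fun n => (n % a, n % b))
  · intro n hn
    have hn := (Finset.mem_filter.1 hn)
    simp only [Finset.coe_product, Set.mem_prod, Finset.mem_coe, Finset.mem_filter, Finset.mem_range]
    exact ⟨⟨Nat.mod_lt _ ha, hA _ hn.2.1⟩, ⟨Nat.mod_lt _ hb, hB _ hn.2.2⟩⟩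
  · intro m hm n hn h
    have hm := Finset.mem_range.1 (Finset.mem_filter.1 hm).1
    have hn := Finset.mem_range.1 (Finset.mem_filter.1 hn).1
    simp only [Prod.mk.injEq] at h
    have := (Nat.modEq_and_modEq_iff_modEq_mul hab).1 h
    exact Nat.ModEq.eq_of_lt_of_lt this hm hn

lemma dvd_mod_aux (p q n : ℕ) (hpq : p ^ 2 ∣ q) (h : p ∣ n → p ^ 2 ∣ n) : p ∣ n % q → p ^ 2 ∣ n % q := by
  intro h1
  have hpp : p ∣ q := (dvd_pow_self p two_ne_zero).trans hpq
  rw [Nat.dvd_mod_iff hpp] at h1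
  rw [Nat.dvd_mod_iff hpq]
  exact h h1

open Classical in
lemma count_T (T : Finset ℕ) (hT : ∀ p ∈ T, p.Prime) :
    (((Finset.range (∏ p ∈ T, p ^ 2)).filter (PT T)).card : ℝ) ≤
      ((∏ p ∈ T, p ^ 2 : ℕ) : ℝ) * ∏ p ∈ T, (1 - 1 / (p : ℝ) + 1 / (p : ℝ) ^ 2) := by
  induction T using Finset.induction_on with
  | empty =>
    simp only [Finset.prod_empty, Nat.cast_one, mul_one]
    exact_mod_cast (Finset.card_filter_le _ _).trans (by simp)
  | insert p T hpT ih =>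
    have hp := hT p (Finset.mem_insert_self _ _)
    have hT' : ∀ q ∈ T, q.Prime := fun q hq => hT q (Finset.mem_insert_of_mem hq)
    have ih := ih hT'
    rw [Finset.prod_insert hpT, Finset.prod_insert hpT]
    have hco : (p ^ 2).Coprime (∏ p ∈ T, p ^ 2) := by
      apply Nat.Coprime.prod_right
      intro q hq
      apply Nat.Coprime.pow
      rw [Nat.coprime_primes hp (hT' q hq)]
      rintro rfl; exact hpT hq
    have := count_mul (p ^ 2) (∏ p ∈ T, p ^ 2) hco (pow_pos hp.pos 2)
      (Finset.prod_pos fun q hq => pow_pos (hT' q hq).pos 2)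
      (fun s => p ∣ s → p ^ 2 ∣ s) (PT T)
      (fun n h => dvd_mod_aux p _ n dvd_rfl h)
      (fun n h q hq => dvd_mod_aux q _ n (Finset.dvd_prod_of_mem _ hq) (h q hq))
    have e : PT (insert p T) = fun n => (p ∣ n → p ^ 2 ∣ n) ∧ PT T n := by
      funext n
      simp [PT]
    have c := count_p p hp
    calc _ ≤ _ * _ := by
          rw [← Nat.cast_mul, Nat.cast_le]
          convert this using 5 with n
          rw [e]
      _ ≤ _ := mul_le_mul c ih (by positivity) (le_trans (by positivity) c)
      _ = _ := by push_cast; ring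

open Classical in
/-- Sums of two squares have density zero. -/
lemma two_sq_density (ε : ℝ) (hε : 0 < ε) : ∃ C : ℝ, ∀ X : ℕ,
    (((Finset.range X).filter (fun s => ∃ a b : ℕ, s = a ^ 2 + b ^ 2)).card : ℝ) ≤ ε * X + C := by
  obtain ⟨T, hT, hprod⟩ := exists_T ε hε
  set Q := ∏ p ∈ T, p ^ 2 with hQ
  have hQ0 : 0 < Q := Finset.prod_pos fun q hq => pow_pos (hT q hq).1.pos 2
  have hc := count_T T (fun p hp => (hT p hp).1)
  rw [← hQ] at hc
  refine ⟨ε * Q, fun X => ?_⟩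
  have h1 : ((Finset.range X).filter (fun s => ∃ a b : ℕ, s = a ^ 2 + b ^ 2)).card ≤
      (X / Q + 1) * ((Finset.range Q).filter (PT T)).card := by
    rw [← Finset.card_range (X / Q + 1), ← Finset.card_product]
    apply Finset.card_le_card_of_injOn (fun n => (n / Q, n % Q))
    · intro n hn
      have hn := (Finset.mem_filter.1 hn)
      simp only [Finset.coe_product, Set.mem_prod, Finset.mem_coe, Finset.mem_filter, Finset.mem_range]
      refine ⟨?_, Nat.mod_lt _ hQ0, ?_⟩
      · exact Nat.lt_succ_of_le (Nat.div_le_div_right (Finset.mem_range.1 hn.1).le)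
      · obtain ⟨a, b, rfl⟩ := hn.2
        intro q hq
        exact dvd_mod_aux q _ _ (Finset.dvd_prod_of_mem _ hq) (two_sq_PT T hT a b q hq)
    · intro m _ n _ h
      simp only [Prod.mk.injEq] at h
      rw [← Nat.div_add_mod m Q, ← Nat.div_add_mod n Q, h.1, h.2]
  have hQr : (0 : ℝ) < Q := by exact_mod_cast hQ0
  calc _ ≤ (((X / Q : ℕ) : ℝ) + 1) * (((Finset.range Q).filter (PT T)).card : ℝ) := by exact_mod_cast h1
    _ ≤ ((X : ℝ) / Q + 1) * (Q * ε) := by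
        apply mul_le_mul
        · have := Nat.cast_div_le (α := ℝ) (m := X) (n := Q)
          linarith
        · exact hc.trans (mul_le_mul_of_nonneg_left hprod hQr.le)
        · positivity
        · positivity
    _ = _ := by field_simp

lemma k_asymp (σ : ℝ) (hσ : 0 < σ) (k : ℕ → ℝ)
    (hk : ∀ n : ℕ,
      k n ∈ Set.Ioo ((n : ℝ) * π) (((n : ℝ) + 1) * π) ∧
      ((k n) ^ 2 - σ ^ 2) * Real.sin (k n) = 2 * σ * (k n) * Real.cos (k n)) :
    Filter.Tendsto (fun n : ℕ => k n ^ 2 - ((n : ℝ) * π) ^ 2) Filter.atTop (nhds (4 * σ)) := by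
  set d : ℕ → ℝ := fun n => k n - n * π with hd
  have hd0 : ∀ n, 0 < d n := fun n => by have := (hk n).1.1; simp only [hd]; linarith
  have hd1 : ∀ n, d n < π := fun n => by have := (hk n).1.2; simp only [hd]; linarith
  have hsec : ∀ n, ((k n) ^ 2 - σ ^ 2) * Real.sin (d n) = 2 * σ * (k n) * Real.cos (d n) := by
    intro n
    simp only [hd]
    rw [Real.sin_sub_nat_mul_pi, Real.cos_sub_nat_mul_pi]
    have := (hk n).2
    linear_combination (-1) ^ n * this
  have hktop : Filter.Tendsto k Filter.atTop Filter.atTop := by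
    apply Filter.tendsto_atTop_mono (fun n => (hk n).1.1.le)
    exact Filter.Tendsto.atTop_mul_const Real.pi_pos tendsto_natCast_atTop_atTop
  have hinv : Filter.Tendsto (fun n => (k n)⁻¹) Filter.atTop (nhds 0) := hktop.inv_tendsto_atTop
  have hden : Filter.Tendsto (fun n => 1 - σ ^ 2 * (k n)⁻¹ ^ 2) Filter.atTop (nhds 1) := by
    have := ((hinv.pow 2).const_mul (σ ^ 2)).const_sub 1
    simpa using this
  have hev : ∀ᶠ n in Filter.atTop, 0 < k n ∧ 0 < 1 - σ ^ 2 * (k n)⁻¹ ^ 2 :=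
    (hktop.eventually_gt_atTop 0).and (hden.eventually_const_lt (by norm_num))
  have hsec2 : ∀ n, 0 < k n → (1 - σ ^ 2 * (k n)⁻¹ ^ 2) * Real.sin (d n) = 2 * σ * (k n)⁻¹ * Real.cos (d n) := by
    intro n hn
    have := hsec n
    field_simp
    linarith
  -- bound for d
  have hdle : ∀ᶠ n in Filter.atTop, d n ≤ (π / 2) * (2 * σ * (k n)⁻¹ / (1 - σ ^ 2 * (k n)⁻¹ ^ 2)) := by
    filter_upwards [hev] with n ⟨h1, h2⟩
    have hs := Real.sin_pos_of_pos_of_lt_pi (hd0 n) (hd1 n)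
    have h3 := hsec2 n h1
    have hc : 0 < Real.cos (d n) := by
      have : 0 < 2 * σ * (k n)⁻¹ * Real.cos (d n) := by rw [← h3]; positivity
      exact pos_of_mul_pos_right this (by positivity)
    have hlt : d n ≤ π / 2 := by
      by_contra h
      push Not at h
      have := Real.cos_neg_of_pi_div_two_lt_of_lt h (by linarith [hd1 n, Real.pi_pos])
      linarith
    have h4 := Real.mul_le_sin (hd0 n).le hlt
    have h5 : Real.sin (d n) ≤ 2 * σ * (k n)⁻¹ / (1 - σ ^ 2 * (k n)⁻¹ ^ 2) := by
      rw [le_div_iff₀ h2, mul_comm, h3]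
      have : 0 < 2 * σ * (k n)⁻¹ := by positivity
      nlinarith [Real.cos_le_one (d n)]
    have h6 : d n = (π / 2) * (2 / π * d n) := by field_simp
    rw [h6]
    exact mul_le_mul_of_nonneg_left (h4.trans h5) (by positivity)
  have hd_lim : Filter.Tendsto d Filter.atTop (nhds 0) := by
    have hup : Filter.Tendsto (fun n => (π / 2) * (2 * σ * (k n)⁻¹ / (1 - σ ^ 2 * (k n)⁻¹ ^ 2))) Filter.atTop (nhds 0) := by
      have := (((hinv.const_mul (2 * σ)).div hden one_ne_zero).const_mul (π / 2))
      simpa using this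
    exact tendsto_of_tendsto_of_tendsto_of_le_of_le' tendsto_const_nhds hup
      (Filter.Eventually.of_forall fun n => (hd0 n).le) hdle
  have hsinc : Filter.Tendsto (fun n => Real.sinc (d n)) Filter.atTop (nhds 1) := by
    have := (Real.continuous_sinc.tendsto 0).comp hd_lim
    rwa [Real.sinc_zero] at this
  have hcos : Filter.Tendsto (fun n => Real.cos (d n)) Filter.atTop (nhds 1) := by
    have := (Real.continuous_cos.tendsto 0).comp hd_lim
    rwa [Real.cos_zero] at this
  have hkd : Filter.Tendsto (fun n => k n * d n) Filter.atTop (nhds (2 * σ)) := by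
    have h1 : Filter.Tendsto (fun n => 2 * σ * Real.cos (d n) / ((1 - σ ^ 2 * (k n)⁻¹ ^ 2) * Real.sinc (d n)))
        Filter.atTop (nhds (2 * σ)) := by
      have := (hcos.const_mul (2 * σ)).div (hden.mul hsinc) (by norm_num)
      rw [mul_one, mul_one, div_one] at this
      exact this
    apply h1.congr'
    filter_upwards [hev, hsinc.eventually_const_lt (by norm_num : (0:ℝ) < 1)] with n ⟨h1, h2⟩ h3
    have h4 := hsec2 n h1
    have h5 : Real.sin (d n) = d n * Real.sinc (d n) := by
      rw [Real.sinc_of_ne_zero (hd0 n).ne']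
      have := (hd0 n).ne'
      field_simp
    rw [div_eq_iff (by positivity)]
    rw [h5] at h4
    have h6 : 2 * σ * Real.cos (d n) = k n * (2 * σ * (k n)⁻¹ * Real.cos (d n)) := by
      field_simp
    rw [h6, ← h4]; ring
  have := (hkd.const_mul 2).sub (hd_lim.pow 2)
  have e : 2 * (2 * σ) - 0 ^ 2 = 4 * σ := by ring
  rw [e] at this
  refine this.congr (fun n => ?_)
  simp only [hd]
  ring

section spectrum
variable (k : ℕ → ℝ)

def spec (x : ℝ) : Set (ℕ × ℕ) := {p : ℕ × ℕ | p.1 ≤ p.2 ∧ (k p.1) ^ 2 + (k p.2) ^ 2 ≤ x}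

variable {k}

lemma sq_lo (hlo : ∀ n : ℕ, (n : ℝ) * π ≤ k n) (n : ℕ) : (n : ℝ) ^ 2 * 9 ≤ k n ^ 2 := by
  have h := hlo n
  have h3 := Real.pi_gt_three
  have : (n : ℝ) * 3 ≤ k n := by
    refine le_trans ?_ h
    exact mul_le_mul_of_nonneg_left h3.le (Nat.cast_nonneg n)
  have h0 : (0 : ℝ) ≤ n := Nat.cast_nonneg n
  nlinarith

lemma spec_le (hlo : ∀ n : ℕ, (n : ℝ) * π ≤ k n) {p : ℕ × ℕ} {x : ℝ} (h : k p.1 ^ 2 + k p.2 ^ 2 ≤ x) :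
    ((p.1 : ℝ) ^ 2 + (p.2 : ℝ) ^ 2) * 9 ≤ x := by
  have h1 := sq_lo hlo p.1
  have h2 := sq_lo hlo p.2
  linarith

lemma spec_fin (hlo : ∀ n : ℕ, (n : ℝ) * π ≤ k n) (x : ℝ) : (spec k x).Finite := by
  apply Set.Finite.subset ((Finset.range (⌈x⌉₊ + 1)) ×ˢ (Finset.range (⌈x⌉₊ + 1))).finite_toSet
  intro p hp
  have h := spec_le hlo hp.2
  have hx := Nat.le_ceil x
  have aux : ∀ m : ℕ, (m : ℝ) ^ 2 ≤ x → m < ⌈x⌉₊ + 1 := by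
    intro m hm
    have : (m : ℝ) ≤ (m : ℝ) ^ 2 := by
      exact_mod_cast Nat.le_self_pow two_ne_zero m
    have : m ≤ ⌈x⌉₊ := by exact_mod_cast (by linarith : (m : ℝ) ≤ ⌈x⌉₊)
    omega
  have e1 : 0 ≤ (p.1 : ℝ) ^ 2 := by positivity
  have e2 : 0 ≤ (p.2 : ℝ) ^ 2 := by positivity
  simp only [Finset.coe_product, Set.mem_prod, Finset.mem_coe, Finset.mem_range]
  exact ⟨aux _ (by linarith), aux _ (by linarith)⟩

/-- The `j`-th level is attained, and is the least element. -/
lemma lam_least (hlo : ∀ n : ℕ, (n : ℝ) * π ≤ k n) (j : ℕ)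
    (hne : ∃ x, j + 1 ≤ (spec k x).ncard) :
    ∃ p : ℕ × ℕ, p.1 ≤ p.2 ∧ IsLeast {x : ℝ | j + 1 ≤ (spec k x).ncard} (k p.1 ^ 2 + k p.2 ^ 2) := by
  have step : ∀ x, j + 1 ≤ (spec k x).ncard → ∃ p ∈ spec k x,
      j + 1 ≤ (spec k (k p.1 ^ 2 + k p.2 ^ 2)).ncard := by
    intro x hx
    have hn : (spec k x).Nonempty := by
      rw [← Set.ncard_pos (spec_fin hlo x)]; omega
    obtain ⟨p, hp, hmax⟩ := Set.exists_max_image (spec k x) (fun p => k p.1 ^ 2 + k p.2 ^ 2) (spec_fin hlo x) hn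
    refine ⟨p, hp, hx.trans (Set.ncard_le_ncard ?_ (spec_fin hlo _))⟩
    intro q hq
    exact ⟨hq.1, hmax q hq⟩
  obtain ⟨x, hx⟩ := hne
  obtain ⟨p0, hp0, hp0'⟩ := step x hx
  obtain ⟨p, hp, hmin⟩ := Set.exists_min_image
    {p | p ∈ spec k x ∧ j + 1 ≤ (spec k (k p.1 ^ 2 + k p.2 ^ 2)).ncard} (fun p => k p.1 ^ 2 + k p.2 ^ 2)
    ((spec_fin hlo x).subset (fun p hp => hp.1)) ⟨p0, hp0, hp0'⟩
  refine ⟨p, hp.1.1, hp.2, fun z hz => ?_⟩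
  obtain ⟨q, hq, hq'⟩ := step z hz
  refine le_trans ?_ hq.2
  by_cases hqx : q ∈ spec k x
  · exact hmin q ⟨hqx, hq'⟩
  · have : ¬ (k q.1 ^ 2 + k q.2 ^ 2 ≤ x) := fun h => hqx ⟨hq.1, h⟩
    exact hp.1.2.trans (not_le.1 this).le

lemma tri_card (L : ℕ) : (L + 1) ^ 2 ≤ 2 * (((Finset.range (L + 1)) ×ˢ (Finset.range (L + 1))).filter
    (fun p : ℕ × ℕ => p.1 ≤ p.2)).card := by
  set S := (Finset.range (L + 1)) ×ˢ (Finset.range (L + 1)) with hS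
  have h1 : S.card = (L + 1) ^ 2 := by simp [hS, pow_two]
  have h2 := Finset.card_filter_add_card_filter_not (s := S) (fun p : ℕ × ℕ => p.1 ≤ p.2)
  have h3 : (S.filter (fun p : ℕ × ℕ => ¬ p.1 ≤ p.2)).card ≤ (S.filter (fun p : ℕ × ℕ => p.1 ≤ p.2)).card := by
    apply Finset.card_le_card_of_injOn Prod.swap
    · intro p hp
      simp only [hS, Finset.coe_filter, Finset.mem_product, Finset.mem_range, Set.mem_ofPred_eq, Prod.fst_swap, Prod.snd_swap] at hp ⊢
      omega
    · exact Prod.swap_injective.injOn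
  omega

lemma spec_ge (hlo : ∀ n : ℕ, (n : ℝ) * π ≤ k n) (hhi : ∀ n : ℕ, k n ≤ ((n : ℝ) + 1) * π) (j : ℕ) :
    j + 1 ≤ (spec k (256 * ((j : ℝ) + 1))).ncard := by
  set L := Nat.sqrt (2 * (j + 1)) with hL
  have hL1 : 2 * (j + 1) < (L + 1) ^ 2 := by rw [pow_two]; exact Nat.lt_succ_sqrt _
  have hL2 : L ^ 2 ≤ 2 * (j + 1) := Nat.sqrt_le' _
  have hL0 : 1 ≤ L := by rw [hL, Nat.le_sqrt']; omega
  have h1 := tri_card L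
  have h2 : ((((Finset.range (L + 1)) ×ˢ (Finset.range (L + 1))).filter
    (fun p : ℕ × ℕ => p.1 ≤ p.2) : Finset (ℕ × ℕ)) : Set (ℕ × ℕ)) ⊆ spec k (256 * ((j : ℝ) + 1)) := by
    intro p hp
    simp only [Finset.coe_filter, Finset.mem_product, Finset.mem_range, Set.mem_ofPred_eq] at hp
    refine ⟨hp.2, ?_⟩
    have aux : ∀ m : ℕ, m < L + 1 → k m ^ 2 ≤ 128 * ((j : ℝ) + 1) := by
      intro m hm
      have a1 : k m ≤ (2 * L : ℝ) * 4 := by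
        refine (hhi m).trans ?_
        have : (m : ℝ) + 1 ≤ 2 * L := by exact_mod_cast (by omega : m + 1 ≤ 2 * L)
        exact mul_le_mul this Real.pi_le_four Real.pi_pos.le (by positivity)
      have a2 : 0 ≤ k m := le_trans (by positivity) (hlo m)
      have a3 : (L : ℝ) ^ 2 ≤ 2 * (j + 1) := by exact_mod_cast hL2
      nlinarith
    have := aux _ hp.1.1
    have := aux _ hp.1.2
    linarith
  have h3 := Set.ncard_le_ncard h2 (spec_fin hlo _)
  rw [Set.ncard_coe_finset] at h3
  omega

open Classical in
lemma bad_bound (hlo : ∀ n : ℕ, (n : ℝ) * π ≤ k n) (hhi : ∀ n : ℕ, k n ≤ ((n : ℝ) + 1) * π)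
    (c : ℝ) (hlim : Filter.Tendsto (fun n : ℕ => k n ^ 2 - ((n : ℝ) * π) ^ 2) Filter.atTop (nhds c))
    (lam : ℕ → ℝ) (hlam : ∀ j : ℕ, lam j = sInf {x : ℝ | j + 1 ≤ (spec k x).ncard})
    (y : ℝ) (hy : 0 < y) (ε : ℝ) (hε : 0 < ε) : ∃ C : ℝ, ∀ N : ℕ,
      (((Finset.range (N + 1)).filter (fun n => ¬ (lam (n + 1) - lam n ≤ y))).card : ℝ)
        ≤ ε * N + C * (Real.sqrt N + 1) := by
  have hl : ∀ j, ∃ p : ℕ × ℕ, p.1 ≤ p.2 ∧ lam j = k p.1 ^ 2 + k p.2 ^ 2 ∧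
      IsLeast {x : ℝ | j + 1 ≤ (spec k x).ncard} (lam j) := by
    intro j
    obtain ⟨p, hp, hp'⟩ := lam_least hlo j ⟨_, spec_ge hlo hhi j⟩
    have : lam j = k p.1 ^ 2 + k p.2 ^ 2 := by rw [hlam, hp'.csInf_eq]
    exact ⟨p, hp, this, this ▸ hp'⟩
  choose P hP1 hP2 hP3 using hl
  have hmono : Monotone lam := by
    apply monotone_nat_of_le_succ
    intro j
    apply (hP3 j).2
    have := (hP3 (j + 1)).1
    simp only [Set.mem_ofPred_eq] at this ⊢
    omega
  have hup : ∀ j, lam j ≤ 256 * ((j : ℝ) + 1) := fun j => (hP3 j).2 (spec_ge hlo hhi j)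
  have hsep : ∀ m n : ℕ, m < n → ¬ (lam (n + 1) - lam n ≤ y) → y < lam (n + 1) - lam (m + 1) := by
    intro m n hmn h
    have := hmono (by omega : m + 1 ≤ n)
    linarith
  -- threshold
  obtain ⟨M, hM⟩ := Filter.eventually_atTop.1 (Metric.tendsto_nhds.1 hlim (y / 4) (by positivity))
  obtain ⟨C0, hC0⟩ := two_sq_density (ε / 64) (by positivity)
  have hC0' : 0 ≤ C0 := by simpa using hC0 0
  refine ⟨M * 33 + 3 * ε + C0, fun N => ?_⟩
  set Bad := (Finset.range (N + 1)).filter (fun n => ¬ (lam (n + 1) - lam n ≤ y)) with hBad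
  have hsize : ∀ n ∈ Bad, (((P (n + 1)).1 : ℝ) ^ 2 + ((P (n + 1)).2 : ℝ) ^ 2) ≤ 32 * (N + 2) := by
    intro n hn
    have hn' : (n : ℝ) ≤ N := by
      have := Finset.mem_range.1 (Finset.mem_filter.1 hn).1
      exact_mod_cast (by omega : n ≤ N)
    have h1 := hup (n + 1)
    rw [hP2] at h1
    have h2 := spec_le hlo h1
    push_cast at h2
    nlinarith
  -- exceptional pairs
  have hB1 : (Bad.filter (fun n => (P (n + 1)).1 < M)).card ≤ M * (Nat.sqrt (32 * (N + 2)) + 1) := by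
    have : M * (Nat.sqrt (32 * (N + 2)) + 1) = ((Finset.range M) ×ˢ (Finset.range (Nat.sqrt (32 * (N + 2)) + 1))).card := by
      simp
    rw [this]
    apply Finset.card_le_card_of_injOn (fun n => P (n + 1))
    · intro n hn
      have hn := Finset.mem_filter.1 hn
      simp only [Finset.coe_product, Set.mem_prod, Finset.mem_coe, Finset.mem_range]
      refine ⟨hn.2, ?_⟩
      have h1 := hsize n hn.1
      have h2 : (P (n + 1)).1 ^ 2 + (P (n + 1)).2 ^ 2 ≤ 32 * (N + 2) := by exact_mod_cast h1
      have : (P (n + 1)).2 ≤ Nat.sqrt (32 * (N + 2)) := by rw [Nat.le_sqrt']; omega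
      omega
    · intro m hm n hn h
      have hm := (Finset.mem_filter.1 (Finset.mem_filter.1 hm).1).2
      have hn := (Finset.mem_filter.1 (Finset.mem_filter.1 hn).1).2
      have e : lam (m + 1) = lam (n + 1) := by
        rw [hP2, hP2]
        simp only at h
        rw [h]
      rcases lt_trichotomy m n with hh | hh | hh
      · have := hsep m n hh hn; linarith
      · exact hh
      · have := hsep n m hh hm; linarith
  have hB2 : (Bad.filter (fun n => ¬ (P (n + 1)).1 < M)).card ≤
      ((Finset.range (32 * (N + 2) + 1)).filter (fun s => ∃ a b : ℕ, s = a ^ 2 + b ^ 2)).card := by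
    apply Finset.card_le_card_of_injOn (fun n => (P (n + 1)).1 ^ 2 + (P (n + 1)).2 ^ 2)
    · intro n hn
      have hn := Finset.mem_filter.1 hn
      simp only [Finset.coe_filter, Set.mem_ofPred_eq, Finset.mem_range]
      have h1 := hsize n hn.1
      have h2 : (P (n + 1)).1 ^ 2 + (P (n + 1)).2 ^ 2 ≤ 32 * (N + 2) := by exact_mod_cast h1
      exact ⟨by omega, _, _, rfl⟩
    · have clos : ∀ n, ¬ (P (n + 1)).1 < M →
          |lam (n + 1) - (((P (n + 1)).1 ^ 2 + (P (n + 1)).2 ^ 2 : ℕ) : ℝ) * π ^ 2 - 2 * c| < y / 2 := by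
        intro n hn
        have h1 := hM (P (n + 1)).1 (by omega)
        have h2 := hM (P (n + 1)).2 (by have := hP1 (n + 1); omega)
        rw [Real.dist_eq, abs_lt] at h1 h2
        rw [hP2, abs_lt]
        push_cast
        constructor <;> nlinarith [h1.1, h1.2, h2.1, h2.2]
      intro m hm n hn h
      have cm := clos m (Finset.mem_filter.1 hm).2
      have cn := clos n (Finset.mem_filter.1 hn).2
      have hm := (Finset.mem_filter.1 (Finset.mem_filter.1 hm).1).2
      have hn := (Finset.mem_filter.1 (Finset.mem_filter.1 hn).1).2
      simp only at h
      rw [h, abs_lt] at cm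
      rw [abs_lt] at cn
      rcases lt_trichotomy m n with hh | hh | hh
      · have := hsep m n hh hn; linarith
      · exact hh
      · have := hsep n m hh hm; linarith
  have hsplit := Finset.card_filter_add_card_filter_not (s := Bad) (fun n => (P (n + 1)).1 < M)
  have hsq : (Nat.sqrt (32 * (N + 2)) : ℝ) + 1 ≤ 33 * (Real.sqrt N + 1) := by
    have h1 : (Nat.sqrt (32 * (N + 2)) : ℝ) ^ 2 ≤ 32 * (N + 2) := by
      exact_mod_cast Nat.sqrt_le' (32 * (N + 2))
    have h2 := Real.sq_sqrt (Nat.cast_nonneg (α := ℝ) N)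
    have h3 := Real.sqrt_nonneg (N : ℝ)
    have h4 : (Nat.sqrt (32 * (N + 2)) : ℝ) ≤ 32 * (Real.sqrt N + 1) := by
      refine (sq_le_sq₀ (by positivity) (by positivity)).1 ?_
      nlinarith
    linarith
  have hd := hC0 (32 * (N + 2) + 1)
  have hr1 : ((Bad.filter (fun n => (P (n + 1)).1 < M)).card : ℝ) ≤ M * (33 * (Real.sqrt N + 1)) := by
    calc _ ≤ (M : ℝ) * ((Nat.sqrt (32 * (N + 2)) : ℝ) + 1) := by exact_mod_cast hB1
      _ ≤ _ := mul_le_mul_of_nonneg_left hsq (Nat.cast_nonneg M)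
  have hr2 : ((Bad.filter (fun n => ¬ (P (n + 1)).1 < M)).card : ℝ) ≤ ε * N + 3 * ε + C0 := by
    have : ((Bad.filter (fun n => ¬ (P (n + 1)).1 < M)).card : ℝ) ≤ _ := (Nat.cast_le.2 hB2).trans hd
    refine this.trans ?_
    push_cast
    have : 0 ≤ (N : ℝ) := Nat.cast_nonneg N
    nlinarith
  have hs : (Bad.card : ℝ) = ((Bad.filter (fun n => (P (n + 1)).1 < M)).card : ℝ) + ((Bad.filter (fun n => ¬ (P (n + 1)).1 < M)).card : ℝ) := by
    exact_mod_cast hsplit.symm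
  have h3 := Real.sqrt_nonneg (N : ℝ)
  have : 0 ≤ (3 * ε + C0) * Real.sqrt N := by positivity
  rw [hs]
  nlinarith

lemma spacing_main (hlo : ∀ n : ℕ, (n : ℝ) * π ≤ k n) (hhi : ∀ n : ℕ, k n ≤ ((n : ℝ) + 1) * π)
    (c : ℝ) (hlim : Filter.Tendsto (fun n : ℕ => k n ^ 2 - ((n : ℝ) * π) ^ 2) Filter.atTop (nhds c))
    (lam : ℕ → ℝ) (hlam : ∀ j : ℕ, lam j = sInf {x : ℝ | j + 1 ≤ (spec k x).ncard})
    (y : ℝ) (hy : 0 < y) :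
      Filter.Tendsto
        (fun N : ℕ =>
          (((Finset.range (N + 1)).filter (fun n => lam (n + 1) - lam n ≤ y)).card : ℝ) / N)
        Filter.atTop (nhds 1) := by
  classical
  set b : ℕ → ℝ := fun N => (((Finset.range (N + 1)).filter (fun n => ¬ (lam (n + 1) - lam n ≤ y))).card : ℝ) with hb
  have hinv : Filter.Tendsto (fun N : ℕ => ((N : ℝ))⁻¹) Filter.atTop (nhds 0) :=
    tendsto_inv_atTop_nhds_zero_nat
  have hsq : Filter.Tendsto (fun N : ℕ => (Real.sqrt N)⁻¹) Filter.atTop (nhds 0) :=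
    (Real.tendsto_sqrt_atTop.comp tendsto_natCast_atTop_atTop).inv_tendsto_atTop
  have hb0 : Filter.Tendsto (fun N : ℕ => b N / N) Filter.atTop (nhds 0) := by
    rw [Metric.tendsto_nhds]
    intro ε hε
    obtain ⟨C, hC⟩ := bad_bound hlo hhi c hlim lam hlam y hy (ε / 2) (by positivity)
    have h1 : Filter.Tendsto (fun N : ℕ => ε / 2 + C * ((Real.sqrt N)⁻¹ + (N : ℝ)⁻¹)) Filter.atTop (nhds (ε / 2)) := by
      simpa using ((hsq.add hinv).const_mul C).const_add (ε / 2)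
    filter_upwards [h1.eventually_lt_const (by linarith : ε / 2 < ε), Filter.eventually_gt_atTop 0] with N hN hN0
    have hN0' : (0 : ℝ) < N := by exact_mod_cast hN0
    have hbn : 0 ≤ b N := Nat.cast_nonneg _
    rw [Real.dist_eq, sub_zero, abs_of_nonneg (by positivity)]
    refine lt_of_le_of_lt ?_ hN
    rw [div_le_iff₀ hN0']
    refine (hC N).trans (le_of_eq ?_)
    have e : (Real.sqrt N)⁻¹ * N = Real.sqrt N := by
      have := Real.mul_self_sqrt hN0'.le
      have h0 : 0 < Real.sqrt N := Real.sqrt_pos.2 hN0'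
      field_simp
      nlinarith
    have e2 : (N : ℝ)⁻¹ * N = 1 := inv_mul_cancel₀ hN0'.ne'
    linear_combination (-C) * e - C * e2
  have h2 : Filter.Tendsto (fun N : ℕ => 1 + (N : ℝ)⁻¹ - b N / N) Filter.atTop (nhds 1) := by
    simpa using (hinv.const_add 1).sub hb0
  apply h2.congr'
  filter_upwards [Filter.eventually_gt_atTop 0] with N hN0
  have hN0' : (0 : ℝ) < N := by exact_mod_cast hN0
  have hs := Finset.card_filter_add_card_filter_not (s := Finset.range (N + 1)) (fun n => lam (n + 1) - lam n ≤ y)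
  rw [Finset.card_range] at hs
  have hs' : (((Finset.range (N + 1)).filter (fun n => lam (n + 1) - lam n ≤ y)).card : ℝ) = N + 1 - b N := by
    rw [eq_sub_iff_add_eq]
    simp only [hb]
    exact_mod_cast hs
  rw [hs']
  field_simp

end spectrum


/-- Fix `σ ≥ 0`, and let `k n = k_n(σ)` be the unique solution in `(nπ, (n+1)π)` of the
secular equation if `σ > 0`, with `k n = nπ` if `σ = 0`. Let
`λ_j = inf {x : #{(m,n) : m ≤ n, k_m(σ)² + k_n(σ)² ≤ x} ≥ j+1}` be the ordered
desymmetrized Robin eigenvalues of the unit square. Then for every `y > 0`,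
`(1/N)·#{n ∈ {0,…,N} : λ_{n+1} − λ_n ≤ y} → 1` as `N → ∞`: the level spacing
distribution is a delta function at the origin. -/
theorem square_desymmetrized_level_spacing_delta (σ : ℝ) (hσ : 0 ≤ σ)
    (k : ℕ → ℝ)
    (hkpos : 0 < σ → ∀ n : ℕ,
      k n ∈ Set.Ioo ((n : ℝ) * π) (((n : ℝ) + 1) * π) ∧
      ((k n) ^ 2 - σ ^ 2) * Real.sin (k n) = 2 * σ * (k n) * Real.cos (k n))
    (hk0 : σ = 0 → ∀ n : ℕ, k n = (n : ℝ) * π)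
    (lam : ℕ → ℝ)
    (hlam : ∀ j : ℕ, lam j = sInf {x : ℝ |
      j + 1 ≤ ({p : ℕ × ℕ | p.1 ≤ p.2 ∧ (k p.1) ^ 2 + (k p.2) ^ 2 ≤ x}).ncard}) :
    ∀ y : ℝ, 0 < y →
      Filter.Tendsto
        (fun N : ℕ =>
          (((Finset.range (N + 1)).filter (fun n => lam (n + 1) - lam n ≤ y)).card : ℝ) / N)
        Filter.atTop (nhds 1) := by
  intro y hy
  rcases hσ.eq_or_lt with h | h
  · have hk := hk0 h.symm
    refine spacing_main (k := k) (fun n => (hk n).ge) (fun n => ?_) 0 ?_ lam hlam y hy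
    · rw [hk n]; nlinarith [Real.pi_pos]
    · simp only [hk, sub_self]
      exact tendsto_const_nhds
  · have hk := hkpos h
    exact spacing_main (k := k) (fun n => (hk n).1.1.le) (fun n => (hk n).1.2.le) (4 * σ)
      (k_asymp σ h k hk) lam hlam y hy
end

section
/- Fix σ > 0 and set δ = 1/990. Then there exists C > 0 such that for every integer n ≥ 1 the ordered Robin and Neumann eigenvalues of the unit disk satisfy |λ_n^σ − λ_n^0| ≤ C·n^{1/3 − δ}. -/
open Real MeasureTheory

/-- The Bessel function of integer order `n`: `J_n(x) = (1/π)∫₀^π cos(x sin t − n t) dt`. -/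
noncomputable def besselJ (n : ℕ) (x : ℝ) : ℝ :=
  (1 / π) * ∫ t in (0:ℝ)..π, Real.cos (x * Real.sin t - n * t)

/-- The derivative `J_n′` of the Bessel function. -/
noncomputable def besselJ' (n : ℕ) (x : ℝ) : ℝ := deriv (besselJ n) x

/-- `φ_{n,σ}(x) = x·J_n′(x) + σ·J_n(x)`, whose positive zeros squared are the Robin
eigenvalues of the unit disk in the angular sector `n`. -/
noncomputable def phiRobin (σ : ℝ) (n : ℕ) (x : ℝ) : ℝ :=
  x * besselJ' n x + σ * besselJ n x

/-- The Robin eigenvalue counting function of the unit disk. -/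
noncomputable def diskRobinCount (σ x : ℝ) : ℕ :=
  ({q : ℤ × ℝ | 0 < q.2 ∧ q.2 ≤ Real.sqrt x ∧ phiRobin σ q.1.natAbs q.2 = 0}).ncard

/-- The Neumann eigenvalue counting function of the unit disk (the `+1` accounts for the
zero Neumann eigenvalue). -/
noncomputable def diskNeumannCount (x : ℝ) : ℕ :=
  1 + ({q : ℤ × ℝ | 0 < q.2 ∧ q.2 ≤ Real.sqrt x ∧ besselJ' q.1.natAbs q.2 = 0}).ncard

/-- The `j`-th ordered Robin eigenvalue of the unit disk. -/
noncomputable def diskRobinEig (σ : ℝ) (j : ℕ) : ℝ :=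
  sInf {x : ℝ | 0 ≤ x ∧ j + 1 ≤ diskRobinCount σ x}

/-- The `j`-th ordered Neumann eigenvalue of the unit disk. -/
noncomputable def diskNeumannEig (j : ℕ) : ℝ :=
  sInf {x : ℝ | 0 ≤ x ∧ j + 1 ≤ diskNeumannCount x}



theorem bj_deriv (n : ℕ) (x : ℝ) : HasDerivAt (besselJ n)
    ((1 / π) * ∫ t in (0:ℝ)..π, -(Real.sin t * Real.sin (x * Real.sin t - n * t))) x := by
  unfold besselJ
  apply HasDerivAt.const_mul
  refine (intervalIntegral.hasDerivAt_integral_of_dominated_loc_of_deriv_le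
    (F := fun x t => Real.cos (x * Real.sin t - n * t))
    (F' := fun x t => -(Real.sin t * Real.sin (x * Real.sin t - n * t)))
    (bound := fun _ => 1) (s := Set.univ) Filter.univ_mem ?_ ?_ ?_ ?_ ?_ ?_).2
  · exact Filter.Eventually.of_forall fun z => (by fun_prop : Continuous fun t : ℝ => Real.cos (z * Real.sin t - n * t)).aestronglyMeasurable
  · exact (by fun_prop : Continuous fun t : ℝ => Real.cos (x * Real.sin t - n * t)).intervalIntegrable _ _
  · exact (by fun_prop : Continuous fun t : ℝ => -(Real.sin t * Real.sin (x * Real.sin t - n * t))).aestronglyMeasurable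
  · refine Filter.Eventually.of_forall fun t _ z _ => ?_
    rw [Real.norm_eq_abs, abs_neg, abs_mul]
    have h1 := Real.abs_sin_le_one t
    have h2 := Real.abs_sin_le_one (z * Real.sin t - n * t)
    nlinarith [abs_nonneg (Real.sin t), abs_nonneg (Real.sin (z * Real.sin t - n * t))]
  · simp
  · refine Filter.Eventually.of_forall fun t _ z _ => ?_
    have h := (((hasDerivAt_id z).mul_const (Real.sin t)).sub_const (n * t : ℝ)).cos
    refine h.congr_deriv ?_
    simp only [id]; ring

theorem bj_int (n : ℕ) (x : ℝ) :
    ∫ t in (0:ℝ)..π, (x * Real.cos t - n) * Real.cos (x * Real.sin t - n * t) = 0 := by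
  have h : ∀ t ∈ Set.uIcc (0:ℝ) π, HasDerivAt (fun t => Real.sin (x * Real.sin t - n * t))
      ((x * Real.cos t - n) * Real.cos (x * Real.sin t - n * t)) t := by
    intro t _
    have h := (((Real.hasDerivAt_sin t).const_mul x).sub ((hasDerivAt_id t).const_mul (n:ℝ))).sin
    refine h.congr_deriv ?_
    simp only [Pi.sub_apply, id]; ring
  rw [intervalIntegral.integral_eq_sub_of_hasDerivAt h]
  · simp [Real.sin_nat_mul_pi]
  · exact (by fun_prop : Continuous _).intervalIntegrable _ _

theorem bj_R1 (n : ℕ) (x : ℝ) :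
    x * besselJ' n x = n * besselJ n x - x * besselJ (n+1) x := by
  have h0 := bj_int n x
  unfold besselJ'
  rw [(bj_deriv n x).deriv]
  unfold besselJ
  have e : ∫ t in (0:ℝ)..π, (x * Real.cos t - n) * Real.cos (x * Real.sin t - n * t) =
     x * (∫ t in (0:ℝ)..π, -(Real.sin t * Real.sin (x * Real.sin t - n * t)))
     - n * (∫ t in (0:ℝ)..π, Real.cos (x * Real.sin t - n * t))
     + x * (∫ t in (0:ℝ)..π, Real.cos (x * Real.sin t - (n+1:ℕ) * t)) := by
    rw [← intervalIntegral.integral_const_mul, ← intervalIntegral.integral_const_mul,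
      ← intervalIntegral.integral_const_mul, ← intervalIntegral.integral_sub,
      ← intervalIntegral.integral_add]
    · congr 1; funext t
      have : x * Real.sin t - (n+1:ℕ) * t = (x * Real.sin t - n * t) - t := by push_cast; ring
      rw [this, Real.cos_sub (x * Real.sin t - n * t) t]; ring
    all_goals exact (by fun_prop : Continuous _).intervalIntegrable _ _
  rw [e] at h0
  linear_combination (1/π) * h0

theorem bj_R2 (n : ℕ) (x : ℝ) :
    x * besselJ' (n+1) x = x * besselJ n x - (n+1) * besselJ (n+1) x := by
  have h0 := bj_int (n+1) x
  unfold besselJ'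
  rw [(bj_deriv (n+1) x).deriv]
  unfold besselJ
  have e : ∫ t in (0:ℝ)..π, (x * Real.cos t - (n+1:ℕ)) * Real.cos (x * Real.sin t - (n+1:ℕ) * t) =
     (n+1:ℕ) * (-∫ t in (0:ℝ)..π, Real.cos (x * Real.sin t - (n+1:ℕ) * t))
     - x * (∫ t in (0:ℝ)..π, -(Real.sin t * Real.sin (x * Real.sin t - (n+1:ℕ) * t)))
     + x * (∫ t in (0:ℝ)..π, Real.cos (x * Real.sin t - n * t)) := by
    rw [← intervalIntegral.integral_neg, ← intervalIntegral.integral_const_mul, ← intervalIntegral.integral_const_mul,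
      ← intervalIntegral.integral_const_mul, ← intervalIntegral.integral_sub,
      ← intervalIntegral.integral_add]
    · congr 1; funext t
      have : x * Real.sin t - n * t = (x * Real.sin t - (n+1:ℕ) * t) + t := by push_cast; ring
      rw [this, Real.cos_add (x * Real.sin t - (n+1:ℕ) * t) t]; ring
    all_goals exact (by fun_prop : Continuous _).intervalIntegrable _ _
  rw [e] at h0
  push_cast at h0 ⊢
  linear_combination (-1/π) * h0

theorem bj_hd (n : ℕ) (x : ℝ) : HasDerivAt (besselJ n) (besselJ' n x) x := by
  unfold besselJ'
  exact (bj_deriv n x).differentiableAt.hasDerivAt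

theorem bj_cont (n : ℕ) : Continuous (besselJ n) :=
  continuous_iff_continuousAt.2 fun x => (bj_hd n x).continuousAt

theorem bj_zero_zero : besselJ 0 0 = 1 := by
  unfold besselJ; simp

theorem bj_succ_zero (n : ℕ) : besselJ (n+1) 0 = 0 := by
  have := bj_R1 (n+1) 0
  simp at this
  rcases this with h | h
  · exfalso; have : (0:ℝ) ≤ n := by positivity
    linarith
  · exact h

/-- three-term recurrence -/
theorem bj_rec (n : ℕ) (x : ℝ) :
    2 * (n+1) * besselJ (n+1) x = x * besselJ n x + x * besselJ (n+2) x := by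
  have h1 := bj_R1 (n+1) x
  have h2 := bj_R2 n x
  push_cast at h1
  linear_combination h2 - h1

noncomputable def pp (n : ℕ) (x : ℝ) : ℝ := x * besselJ' n x

theorem pp_eq (n : ℕ) : pp n = fun x => n * besselJ n x - x * besselJ (n+1) x := by
  funext x; exact bj_R1 n x

theorem pp_cont (n : ℕ) : Continuous (pp n) := by
  rw [pp_eq]
  have := bj_cont n
  have := bj_cont (n+1)
  fun_prop

theorem pp_hd (n : ℕ) (x : ℝ) (hx : 0 < x) :
    HasDerivAt (pp n) ((n^2 - x^2)/x * besselJ n x) x := by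
  rw [pp_eq]
  have h := ((bj_hd n x).const_mul (n:ℝ)).sub ((hasDerivAt_id x).mul (bj_hd (n+1) x))
  refine h.congr_deriv ?_
  have h1 := bj_R1 n x
  have h2 := bj_R2 n x
  have : n * besselJ' n x = n * ((n * besselJ n x - x * besselJ (n+1) x)/x) := by
    rw [← h1]; field_simp
  simp only [id]
  rw [this, h2]
  field_simp
  ring

/-- nondegeneracy -/
theorem bj_nd0 (x : ℝ) (hx : 0 < x) (h0 : besselJ 0 x = 0) (h1 : besselJ 1 x = 0) : False := by
  let E : ℝ → ℝ := fun t => t^2 * ((besselJ 0 t)^2 + (besselJ 1 t)^2)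
  have hd : ∀ t, HasDerivAt E (2 * t * (besselJ 0 t)^2) t := by
    intro t
    have h := ((hasDerivAt_id t).pow 2).mul (((bj_hd 0 t).pow 2).add ((bj_hd 1 t).pow 2))
    refine h.congr_deriv ?_
    have e1 := bj_R1 0 t
    have e2 := bj_R2 0 t
    simp only [id, zero_add, Nat.cast_zero] at *
    simp
    linear_combination (2 * t * besselJ 0 t) * e1 + 2 * t * besselJ 1 t * e2
  have mono : MonotoneOn E (Set.Ici 0) := by
    apply monotoneOn_of_deriv_nonneg (convex_Ici 0)
    · exact fun t _ => (hd t).continuousAt.continuousWithinAt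
    · exact fun t _ => (hd t).differentiableAt.differentiableWithinAt
    · intro t ht
      rw [(hd t).deriv]
      simp at ht
      positivity
  have Ex : E x = 0 := by simp [E, h0, h1]
  have z : ∀ t ∈ Set.Ioo 0 x, besselJ 0 t = 0 := by
    intro t ht
    have : E t ≤ E x := mono (le_of_lt ht.1) hx.le ht.2.le
    rw [Ex] at this
    have ht2 : 0 < t^2 := pow_pos ht.1 2
    have h5 : (besselJ 0 t)^2 + (besselJ 1 t)^2 ≤ 0 := by
      by_contra hc; push Not at hc
      have := mul_pos ht2 hc
      simp only [E] at *
      linarith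
    have : (besselJ 0 t)^2 = 0 := by nlinarith [sq_nonneg (besselJ 1 t), sq_nonneg (besselJ 0 t)]
    exact pow_eq_zero_iff (two_ne_zero) |>.1 this
  have : besselJ 0 0 = 0 := by
    have hc : Set.EqOn (besselJ 0) (fun _ => 0) (closure (Set.Ioo 0 x)) :=
      Set.EqOn.closure z (bj_cont 0) continuous_const
    rw [closure_Ioo hx.ne] at hc
    exact hc ⟨le_rfl, hx.le⟩
  rw [bj_zero_zero] at this
  exact one_ne_zero this

theorem bj_ndn (n : ℕ) (x : ℝ) (hx : 0 < x) (h0 : besselJ n x = 0) (h1 : besselJ (n+1) x = 0) : False := by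
  induction n with
  | zero => exact bj_nd0 x hx h0 h1
  | succ n ih =>
    refine ih ?_ h0
    have := bj_rec n x
    rw [h0, h1] at this
    simp at this
    rcases this with h | h
    · exact absurd h hx.ne'
    · exact h

theorem bj_nd (n : ℕ) (x : ℝ) (hx : 0 < x) (h0 : besselJ n x = 0) : pp n x ≠ 0 := by
  intro h
  rw [pp_eq] at h
  simp only [h0] at h
  simp at h
  rcases h with h | h
  · exact hx.ne' h
  · exact bj_ndn n x hx h0 h

structure Sys (n : ℝ) (y p : ℝ → ℝ) : Prop where
  hn : 0 ≤ n
  cy : Continuous y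
  cp : Continuous p
  dy : ∀ t, 0 < t → HasDerivAt y (p t / t) t
  dp : ∀ t, 0 < t → HasDerivAt p ((n^2 - t^2)/t * y t) t
  nd : ∀ t, 0 < t → y t = 0 → p t ≠ 0
  p0 : p 0 = 0
  y0 : 0 < n → y 0 = 0
  y00 : n = 0 → y 0 ≠ 0

theorem bj_sys (n : ℕ) : Sys n (besselJ n) (pp n) where
  hn := by positivity
  cy := bj_cont n
  cp := pp_cont n
  dy := fun t ht => (bj_hd n t).congr_deriv (by unfold pp; field_simp)
  dp := fun t ht => pp_hd n t ht
  nd := fun t ht h => bj_nd n t ht h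
  p0 := by simp [pp]
  y0 := fun h => by
    cases n with
    | zero => simp at h
    | succ n => exact bj_succ_zero n
  y00 := fun h => by
    have : n = 0 := by exact_mod_cast h
    subst this
    rw [bj_zero_zero]; exact one_ne_zero

theorem Sys.neg {n : ℝ} {y p : ℝ → ℝ} (h : Sys n y p) : Sys n (fun t => - y t) (fun t => - p t) where
  hn := h.hn
  cy := h.cy.neg
  cp := h.cp.neg
  dy := fun t ht => (h.dy t ht).neg.congr_deriv (by ring)
  dp := fun t ht => (h.dp t ht).neg.congr_deriv (by ring)
  nd := fun t ht hy => by
    have := h.nd t ht (by simpa using hy)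
    simpa using this
  p0 := by simp [h.p0]
  y0 := fun hh => by simp [h.y0 hh]
  y00 := fun hh => by simpa using h.y00 hh


theorem Sys.ne_of_le {n : ℝ} {y p : ℝ → ℝ} (h : Sys n y p) (hn : 0 < n) {t : ℝ} (ht : 0 < t)
    (htn : t ≤ n) : p t ≠ 0 := by
  intro hp
  have hd : ∀ τ, 0 < τ → HasDerivAt (fun τ => p τ * y τ) (((n^2 - τ^2)/τ) * (y τ)^2 + (p τ)^2/τ) τ := by
    intro τ hτ
    refine ((h.dp τ hτ).mul (h.dy τ hτ)).congr_deriv ?_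
    ring
  have cont : Continuous (fun τ => p τ * y τ) := h.cp.mul h.cy
  have mono : MonotoneOn (fun τ => p τ * y τ) (Set.Icc 0 t) := by
    apply monotoneOn_of_deriv_nonneg (convex_Icc 0 t) cont.continuousOn
    · intro τ hτ
      rw [interior_Icc] at hτ
      exact (hd τ hτ.1).differentiableAt.differentiableWithinAt
    · intro τ hτ
      rw [interior_Icc] at hτ
      rw [(hd τ hτ.1).deriv]
      have h1 := hτ.1
      have : 0 ≤ n^2 - τ^2 := by nlinarith [hτ.2]
      positivity
  have z : ∀ τ ∈ Set.Icc 0 t, p τ * y τ = 0 := by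
    intro τ hτ
    have h1 := mono ⟨le_rfl, ht.le⟩ hτ hτ.1
    have h2 := mono hτ ⟨ht.le, le_rfl⟩ hτ.2
    simp only [h.p0, hp, zero_mul] at h1 h2
    linarith
  have hd2 : ∀ τ, 0 < τ → HasDerivAt (fun τ => (y τ)^2) (2 * (p τ * y τ)/τ) τ := by
    intro τ hτ
    refine ((h.dy τ hτ).pow 2).congr_deriv ?_
    simp; ring
  obtain ⟨c, hc, e⟩ := exists_hasDerivAt_eq_slope (fun τ => (y τ)^2) (fun τ => 2 * (p τ * y τ)/τ) ht
    (h.cy.pow 2).continuousOn (fun τ hτ => hd2 τ hτ.1)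
  rw [z c ⟨hc.1.le, hc.2.le⟩, h.y0 hn] at e
  have : (y t)^2 = 0 := by
    have e2 : (y t)^2 / t = 0 := by
      have : (y t)^2 / t = ((y t)^2 - 0^2) / (t - 0) := by simp
      rw [this, ← e]; simp
    rcases div_eq_zero_iff.1 e2 with e3 | e3
    · exact e3
    · linarith
  exact h.nd t ht (pow_eq_zero_iff (two_ne_zero) |>.1 this) hp

theorem Sys.u_hd {n : ℝ} {y p : ℝ → ℝ} (h : Sys n y p) {t : ℝ} (ht : 0 < t) (hy : y t ≠ 0) :
    HasDerivAt (fun t => p t / y t) (-((t^2 - n^2)/t) - (p t / y t)^2/t) t := by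
  refine ((h.dp t ht).div (h.dy t ht) hy).congr_deriv ?_
  field_simp
  ring

theorem Sys.u_anti {n : ℝ} {y p : ℝ → ℝ} (h : Sys n y p) {a b : ℝ} (ha : 0 ≤ a) (han : n ≤ a)
    (hy : ∀ τ ∈ Set.Icc a b, y τ ≠ 0) : StrictAntiOn (fun t => p t / y t) (Set.Icc a b) := by
  apply strictAntiOn_of_deriv_neg (convex_Icc a b)
  · exact h.cp.continuousOn.div h.cy.continuousOn hy
  · intro t ht
    rw [interior_Icc] at ht
    have ht0 : 0 < t := lt_of_le_of_lt ha ht.1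
    rw [(h.u_hd ht0 (hy t ⟨ht.1.le, ht.2.le⟩)).deriv]
    have : 0 < t^2 - n^2 := by nlinarith [h.hn, ht.1]
    have h1 : 0 < (t^2 - n^2)/t := by positivity
    have h2 : 0 ≤ (p t / y t)^2/t := by positivity
    linarith

theorem Sys.u_quant {n : ℝ} {y p : ℝ → ℝ} (h : Sys n y p) {a b : ℝ} (ha : 0 < a) (hab : a ≤ b)
    (hy : ∀ τ ∈ Set.Icc a b, y τ ≠ 0) :
    p b / y b ≤ p a / y a - (a^2 - n^2)/a * (b - a) := by
  have : AntitoneOn (fun t => p t / y t + (a^2 - n^2)/a * t) (Set.Icc a b) := by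
    apply antitoneOn_of_deriv_nonpos (convex_Icc a b)
    · exact (h.cp.continuousOn.div h.cy.continuousOn hy).add (by fun_prop)
    · intro t ht
      rw [interior_Icc] at ht
      have ht0 : 0 < t := lt_trans ha ht.1
      exact ((h.u_hd ht0 (hy t ⟨ht.1.le, ht.2.le⟩)).add
        ((hasDerivAt_id t).const_mul ((a^2 - n^2)/a))).differentiableAt.differentiableWithinAt
    · intro t ht
      rw [interior_Icc] at ht
      have ht0 : 0 < t := lt_trans ha ht.1
      have e := ((h.u_hd ht0 (hy t ⟨ht.1.le, ht.2.le⟩)).add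
        ((hasDerivAt_id t).const_mul ((a^2 - n^2)/a))).deriv
      have e' : deriv (fun t => p t / y t + (a^2 - n^2)/a * t) t = _ := e
      rw [e']
      have h2 : 0 ≤ (p t / y t)^2/t := by positivity
      have h3 : (a^2 - n^2)/a ≤ (t^2 - n^2)/t := by
        rw [div_le_div_iff₀ ha ht0]
        have h4 : 0 < t - a := by linarith [ht.1]
        have h5 : 0 < a * t := by positivity
        nlinarith [mul_nonneg h4.le h5.le, mul_nonneg h4.le (sq_nonneg n)]
      linarith
  have := this ⟨le_rfl, hab⟩ ⟨hab, le_rfl⟩ hab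
  simp only at this
  linarith

theorem Sys.next_pos {n : ℝ} {y p : ℝ → ℝ} (h : Sys n y p) {t0 s α β : ℝ} (ht0 : 0 ≤ t0)
    (hn : n ≤ t0) (hs : t0 < s) (hy : 0 < y t0) (hp : p t0 = α * y t0) (hβ : β < α)
    (hL : (∀ τ ∈ Set.Icc t0 s, y τ ≠ 0) → p s / y s ≤ β) :
    ∃ s', t0 < s' ∧ s' ≤ s ∧ p s' = β * y s' ∧ ∀ τ ∈ Set.Icc t0 s', y τ ≠ 0 := by
  have hg : Continuous (fun τ => p τ - β * y τ) := h.cp.sub (continuous_const.mul h.cy)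
  have hg0 : 0 < p t0 - β * y t0 := by rw [hp]; nlinarith
  by_cases hz : ∀ τ ∈ Set.Icc t0 s, y τ ≠ 0
  · have h1 := hL hz
    have hys : 0 < y s := by
      by_contra hc; push Not at hc
      obtain ⟨c, hc, e⟩ := intermediate_value_Icc' hs.le h.cy.continuousOn ⟨hc, hy.le⟩
      exact hz c hc e
    have h2 : p s - β * y s ≤ 0 := by
      rw [div_le_iff₀ hys] at h1; linarith
    obtain ⟨c, hc, e⟩ := intermediate_value_Icc' hs.le hg.continuousOn ⟨h2, hg0.le⟩
    simp only at e
    refine ⟨c, lt_of_le_of_ne hc.1 ?_, hc.2, by linarith, fun τ hτ => hz τ ⟨hτ.1, hτ.2.trans hc.2⟩⟩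
    rintro rfl; linarith
  · push Not at hz
    have hcomp : IsCompact (Set.Icc t0 s ∩ {τ | y τ = 0}) :=
      isCompact_Icc.inter_right (isClosed_eq h.cy continuous_const)
    obtain ⟨c, ⟨hc1, hc2⟩, hc3⟩ := hcomp.exists_isLeast (by obtain ⟨τ, h1, h2⟩ := hz; exact ⟨τ, h1, h2⟩)
    simp only [Set.mem_ofPred_eq] at hc2
    have hpre : ∀ τ ∈ Set.Icc t0 c, τ < c → 0 < y τ := by
      intro τ hτ hlt
      by_contra hneg; push Not at hneg
      obtain ⟨d, hd, e⟩ := intermediate_value_Icc' hτ.1 h.cy.continuousOn ⟨hneg, hy.le⟩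
      have := hc3 ⟨⟨hd.1, by linarith [hd.2, hτ.2, hc1.2]⟩, e⟩
      linarith [hd.2]
    have htc : t0 < c := lt_of_le_of_ne hc1.1 (by rintro rfl; linarith)
    have anti : AntitoneOn p (Set.Icc t0 c) := by
      apply antitoneOn_of_deriv_nonpos (convex_Icc t0 c) h.cp.continuousOn
      · intro t ht
        rw [interior_Icc] at ht
        exact (h.dp t (by linarith [ht.1])).differentiableAt.differentiableWithinAt
      · intro t ht
        rw [interior_Icc] at ht
        have ht0' : 0 < t := by linarith [ht.1]
        rw [(h.dp t ht0').deriv]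
        have h1 := hpre t ⟨ht.1.le, ht.2.le⟩ ht.2
        have h2 : (n^2 - t^2)/t ≤ 0 := by
          apply div_nonpos_of_nonpos_of_nonneg _ ht0'.le
          nlinarith [h.hn, ht.1]
        nlinarith
    have hpc : p c < 0 := by
      by_contra hneg; push Not at hneg
      have mono : MonotoneOn y (Set.Icc t0 c) := by
        apply monotoneOn_of_deriv_nonneg (convex_Icc t0 c) h.cy.continuousOn
        · intro t ht
          rw [interior_Icc] at ht
          exact (h.dy t (by linarith [ht.1])).differentiableAt.differentiableWithinAt
        · intro t ht
          rw [interior_Icc] at ht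
          have ht0' : 0 < t := by linarith [ht.1]
          rw [(h.dy t ht0').deriv]
          have := anti ⟨ht.1.le, ht.2.le⟩ ⟨htc.le, le_rfl⟩ ht.2.le
          exact div_nonneg (by linarith) ht0'.le
      have := mono ⟨le_rfl, htc.le⟩ ⟨htc.le, le_rfl⟩ htc.le
      linarith
    obtain ⟨d, hd, e⟩ := intermediate_value_Icc' htc.le hg.continuousOn
      (show (0:ℝ) ∈ _ from ⟨by simp only [hc2]; linarith, hg0.le⟩)
    simp only at e
    have hdc : d < c := lt_of_le_of_ne hd.2 (by rintro rfl; rw [hc2] at e; linarith)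
    refine ⟨d, lt_of_le_of_ne hd.1 ?_, hd.2.trans hc1.2, by linarith, fun τ hτ => ?_⟩
    · rintro rfl; linarith
    · exact (hpre τ ⟨hτ.1, hτ.2.trans hd.2⟩ (by linarith [hτ.2])).ne'

theorem Sys.next {n : ℝ} {y p : ℝ → ℝ} (h : Sys n y p) {t0 s α β : ℝ} (ht0 : 0 ≤ t0)
    (hn : n ≤ t0) (hs : t0 < s) (hy : y t0 ≠ 0) (hp : p t0 = α * y t0) (hβ : β < α)
    (hL : (∀ τ ∈ Set.Icc t0 s, y τ ≠ 0) → p s / y s ≤ β) :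
    ∃ s', t0 < s' ∧ s' ≤ s ∧ p s' = β * y s' ∧ ∀ τ ∈ Set.Icc t0 s', y τ ≠ 0 := by
  rcases lt_or_gt_of_ne hy with hy | hy
  · obtain ⟨s', h1, h2, h3, h4⟩ := h.neg.next_pos (t0 := t0) (s := s) (α := α) (β := β) ht0 hn hs (by linarith) (by rw [hp]; ring) hβ
      (by intro hz
          have := hL (fun τ hτ => by simpa using hz τ hτ)
          rwa [neg_div_neg_eq])
    exact ⟨s', h1, h2, by linarith, fun τ hτ => by simpa using h4 τ hτ⟩
  · exact h.next_pos ht0 hn hs hy hp hβ hL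

theorem Sys.next_q {n : ℝ} {y p : ℝ → ℝ} (h : Sys n y p) {t0 s α β : ℝ} (ht0 : 0 < t0)
    (hn : n ≤ t0) (hs : t0 < s) (hy : y t0 ≠ 0) (hp : p t0 = α * y t0) (hβ : β < α)
    (hq : α - β ≤ (t0^2 - n^2)/t0 * (s - t0)) :
    ∃ s', t0 < s' ∧ s' ≤ s ∧ p s' = β * y s' ∧ ∀ τ ∈ Set.Icc t0 s', y τ ≠ 0 := by
  apply h.next ht0.le hn hs hy hp hβ
  intro hz
  have := h.u_quant ht0 hs.le hz
  have e : p t0 / y t0 = α := by rw [hp]; field_simp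
  linarith

theorem Sys.prev {n : ℝ} {y p : ℝ → ℝ} (h : Sys n y p) {s σ : ℝ} (hs : 0 < s) (hσ : 0 < σ)
    (hp : p s = -σ * y s) (hy : 0 < y s) :
    ∃ t, 0 ≤ t ∧ t < s ∧ p t = 0 ∧ ∀ τ ∈ Set.Icc t s, y τ ≠ 0 := by
  have hps : p s < 0 := by rw [hp]; nlinarith
  by_cases hz : ∀ τ ∈ Set.Icc 0 s, y τ ≠ 0
  · exact ⟨0, le_rfl, hs, h.p0, hz⟩
  · push Not at hz
    have hcomp : IsCompact (Set.Icc 0 s ∩ {τ | y τ = 0}) :=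
      isCompact_Icc.inter_right (isClosed_eq h.cy continuous_const)
    obtain ⟨c, ⟨hc1, hc2⟩, hc3⟩ := hcomp.exists_isGreatest (by obtain ⟨τ, h1, h2⟩ := hz; exact ⟨τ, h1, h2⟩)
    simp only [Set.mem_ofPred_eq] at hc2
    have hcs : c < s := lt_of_le_of_ne hc1.2 (by rintro rfl; linarith)
    have hpos : ∃ d, c < d ∧ d < s ∧ 0 < p d := by
      by_contra hno; push Not at hno
      have anti : AntitoneOn y (Set.Icc c s) := by
        apply antitoneOn_of_deriv_nonpos (convex_Icc c s) h.cy.continuousOn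
        · intro t ht
          rw [interior_Icc] at ht
          exact (h.dy t (by linarith [ht.1, hc1.1])).differentiableAt.differentiableWithinAt
        · intro t ht
          rw [interior_Icc] at ht
          have ht0' : 0 < t := by linarith [ht.1, hc1.1]
          rw [(h.dy t ht0').deriv]
          exact div_nonpos_of_nonpos_of_nonneg (hno t ht.1 ht.2) ht0'.le
      have := anti ⟨le_rfl, hcs.le⟩ ⟨hcs.le, le_rfl⟩ hcs.le
      linarith
    obtain ⟨d, hd1, hd2, hd3⟩ := hpos
    obtain ⟨t, ht, e⟩ := intermediate_value_Icc' hd2.le h.cp.continuousOn ⟨hps.le, hd3.le⟩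
    refine ⟨t, by linarith [hc1.1, ht.1], lt_of_le_of_ne ht.2 (by rintro rfl; linarith), e, ?_⟩
    intro τ hτ h0
    have := hc3 ⟨⟨by linarith [hc1.1, ht.1, hτ.1], hτ.2⟩, h0⟩
    linarith [ht.1, hτ.1]

theorem Sys.prev' {n : ℝ} {y p : ℝ → ℝ} (h : Sys n y p) {s σ : ℝ} (hs : 0 < s) (hσ : 0 < σ)
    (hp : p s = -σ * y s) :
    ∃ t, 0 ≤ t ∧ t < s ∧ p t = 0 ∧ ∀ τ ∈ Set.Icc t s, y τ ≠ 0 := by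
  have hy : y s ≠ 0 := fun h0 => h.nd s hs h0 (by rw [hp, h0]; simp)
  rcases lt_or_gt_of_ne hy with hy | hy
  · obtain ⟨t, h1, h2, h3, h4⟩ := h.neg.prev hs hσ (by rw [hp]; ring) (by linarith)
    exact ⟨t, h1, h2, by linarith, fun τ hτ => by simpa using h4 τ hτ⟩
  · exact h.prev hs hσ hp hy

theorem Sys.osc_pos {n : ℝ} {y p : ℝ → ℝ} (h : Sys n y p) {a : ℝ} (ha : 8 ≤ a) (hn : n ≤ a/2)
    (hp : ∀ t ∈ Set.Ioo a (a+8), 0 < p t) : False := by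
  have hp' : ∀ t ∈ Set.Icc a (a+8), 0 ≤ p t := by
    intro t ht
    rw [← closure_Ioo (by linarith : a ≠ a+8)] at ht
    have hcl : IsClosed {t | 0 ≤ p t} := isClosed_le continuous_const h.cp
    exact closure_minimal (fun t ht => (hp t ht).le) hcl ht
  have mono : MonotoneOn y (Set.Icc a (a+8)) := by
    apply monotoneOn_of_deriv_nonneg (convex_Icc _ _) h.cy.continuousOn
    · intro t ht
      rw [interior_Icc] at ht
      exact (h.dy t (by linarith [ht.1])).differentiableAt.differentiableWithinAt
    · intro t ht
      rw [interior_Icc] at ht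
      have ht0' : 0 < t := by linarith [ht.1]
      rw [(h.dy t ht0').deriv]
      exact div_nonneg (hp t ht).le ht0'.le
  have mvy : ∀ b, ∃ c, b < c ∧ c < b + 2 ∧ (0 < b → y (b+2) - y b = 2 * (p c / c)) := by
    intro b
    by_cases hb : 0 < b
    · obtain ⟨c, hc, e⟩ := exists_hasDerivAt_eq_slope y (fun τ => p τ / τ) (by linarith : b < b+2)
        h.cy.continuousOn (fun τ hτ => h.dy τ (by linarith [hτ.1]))
      refine ⟨c, hc.1, hc.2, fun _ => ?_⟩
      rw [e]; ring
    · exact ⟨b+1, by linarith, by linarith, fun hh => absurd hh hb⟩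
  have mvp : ∀ b, ∃ c, b < c ∧ c < b + 2 ∧ (0 < b → p (b+2) - p b = 2 * ((n^2 - c^2)/c * y c)) := by
    intro b
    by_cases hb : 0 < b
    · obtain ⟨c, hc, e⟩ := exists_hasDerivAt_eq_slope p (fun τ => (n^2 - τ^2)/τ * y τ) (by linarith : b < b+2)
        h.cp.continuousOn (fun τ hτ => h.dp τ (by linarith [hτ.1]))
      refine ⟨c, hc.1, hc.2, fun _ => ?_⟩
      rw [e]; ring
    · exact ⟨b+1, by linarith, by linarith, fun hh => absurd hh hb⟩
  have q : ∀ c, a ≤ c → (n^2 - c^2)/c ≤ -(3/4) * a := by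
    intro c hc
    have hc0 : 0 < c := by linarith
    rw [div_le_iff₀ hc0]
    have := h.hn
    nlinarith [mul_self_nonneg (c - a)]
  have pq : ∀ c, a ≤ c → c ≤ a + 8 → p c / (2 * a) ≤ p c / c := by
    intro c h1 h2
    exact div_le_div_of_nonneg_left (hp' c ⟨h1, h2⟩) (by linarith) (by linarith)
  by_cases hm : 0 ≤ y (a+4)
  · have ypos : ∀ t ∈ Set.Icc (a+4) (a+8), 0 ≤ y t := fun t ht =>
      hm.trans (mono ⟨by linarith, by linarith⟩ ⟨by linarith [ht.1], ht.2⟩ ht.1)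
    have anti : AntitoneOn p (Set.Icc (a+4) (a+8)) := by
      apply antitoneOn_of_deriv_nonpos (convex_Icc _ _) h.cp.continuousOn
      · intro t ht
        rw [interior_Icc] at ht
        exact (h.dp t (by linarith [ht.1])).differentiableAt.differentiableWithinAt
      · intro t ht
        rw [interior_Icc] at ht
        have ht0' : 0 < t := by linarith [ht.1]
        rw [(h.dp t ht0').deriv]
        have h1 := ypos t ⟨ht.1.le, ht.2.le⟩
        have h2 := q t (by linarith [ht.1])
        nlinarith
    obtain ⟨c, hc1, hc2, e⟩ := mvy (a+4)
    obtain ⟨d, hd1, hd2, e'⟩ := mvp (a+6)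
    have e := e (by linarith)
    have e' := e' (by linarith)
    rw [show a+4+2 = a+6 by ring] at *
    rw [show a+6+2 = a+8 by ring] at *
    have h1 := anti ⟨hc1.le, by linarith⟩ ⟨by linarith, by linarith⟩ hc2.le
    have h2 := pq c (by linarith) (by linarith)
    have h3 : p (a+6) / (2*a) ≤ p c / (2*a) := div_le_div_of_nonneg_right h1 (by linarith)
    have h4 : y (a+6) ≤ y d := mono ⟨by linarith, by linarith⟩ ⟨by linarith, by linarith⟩ hd1.le
    have h5 := q d (by linarith)
    have h6 : p (a+6) / a ≤ y (a+6) := by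
      have : p (a+6) / a = 2 * (p (a+6) / (2*a)) := by field_simp
      linarith
    have h7 : p (a+6) ≤ a * y (a+6) := by
      rw [div_le_iff₀ (by linarith)] at h6; linarith
    have h8 := hp (a+6) ⟨by linarith, by linarith⟩
    have h9 := hp' (a+8) ⟨by linarith, by linarith⟩
    have h10 : (n^2 - d^2)/d * y d ≤ -(3/4) * a * y (a+6) := by
      have : 0 ≤ y d := ypos d ⟨by linarith, by linarith⟩
      nlinarith
    linarith
  · push Not at hm
    have yneg : ∀ t ∈ Set.Icc a (a+4), y t < 0 := fun t ht =>
      lt_of_le_of_lt (mono ⟨by linarith [ht.1], by linarith [ht.2]⟩ ⟨by linarith, by linarith⟩ ht.2) hm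
    have monop : MonotoneOn p (Set.Icc a (a+4)) := by
      apply monotoneOn_of_deriv_nonneg (convex_Icc _ _) h.cp.continuousOn
      · intro t ht
        rw [interior_Icc] at ht
        exact (h.dp t (by linarith [ht.1])).differentiableAt.differentiableWithinAt
      · intro t ht
        rw [interior_Icc] at ht
        have ht0' : 0 < t := by linarith [ht.1]
        rw [(h.dp t ht0').deriv]
        have h1 := yneg t ⟨ht.1.le, ht.2.le⟩
        have h2 := q t (by linarith [ht.1])
        nlinarith
    obtain ⟨c, hc1, hc2, e⟩ := mvy (a+2)
    obtain ⟨d, hd1, hd2, e'⟩ := mvp a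
    have e := e (by linarith)
    have e' := e' (by linarith)
    rw [show a+2+2 = a+4 by ring] at *
    have h1 := monop ⟨by linarith, by linarith⟩ ⟨by linarith, by linarith⟩ hc1.le
    have h2 := pq c (by linarith) (by linarith)
    have h3 : p (a+2) / (2*a) ≤ p c / (2*a) := div_le_div_of_nonneg_right h1 (by linarith)
    have h4 : y d ≤ y (a+2) := mono ⟨by linarith, by linarith⟩ ⟨by linarith, by linarith⟩ hd2.le
    have h5 := q d (by linarith)
    have h6 : p (a+2) / a ≤ - y (a+2) := by
      have : p (a+2) / a = 2 * (p (a+2) / (2*a)) := by field_simp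
      linarith
    have h7 : p (a+2) ≤ a * (- y (a+2)) := by
      rw [div_le_iff₀ (by linarith)] at h6; linarith
    have h8 := hp (a+2) ⟨by linarith, by linarith⟩
    have h9 := hp' a ⟨by linarith, by linarith⟩
    have h10 : (3/4) * a * (-y (a+2)) ≤ (n^2 - d^2)/d * y d := by
      have : y d < 0 := yneg d ⟨by linarith, by linarith⟩
      nlinarith
    linarith

theorem Sys.osc {n : ℝ} {y p : ℝ → ℝ} (h : Sys n y p) {a : ℝ} (ha : 8 ≤ a) (hn : n ≤ a/2) :
    ∃ t ∈ Set.Ioo a (a+8), p t = 0 := by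
  by_contra hno; push Not at hno
  have hsgn : ∀ t ∈ Set.Ioo a (a+8), ∀ s ∈ Set.Ioo a (a+8), 0 < p t → 0 < p s := by
    intro t ht s hs hpt
    by_contra hc; push Not at hc
    have := isPreconnected_Ioo.intermediate_value hs ht h.cp.continuousOn ⟨hc, hpt.le⟩
    obtain ⟨c, hc, e⟩ := this
    exact hno c hc e
  have hm : a+4 ∈ Set.Ioo a (a+8) := ⟨by linarith, by linarith⟩
  rcases lt_or_gt_of_ne (hno _ hm) with h1 | h1
  · apply h.neg.osc_pos ha hn
    intro t ht
    by_contra hc; push Not at hc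
    have h2 : 0 < p t := lt_of_le_of_ne (by linarith) (hno t ht).symm
    linarith [hsgn t ht _ hm h2]
  · exact h.osc_pos ha hn (fun t ht => hsgn _ hm t ht h1)

theorem Sys.fin {n : ℝ} {y p : ℝ → ℝ} (h : Sys n y p) (R : ℝ) :
    {t | 0 < t ∧ t ≤ R ∧ p t = 0}.Finite := by
  by_contra hinf
  obtain ⟨c, hc, hacc⟩ := Set.Infinite.exists_accPt_of_subset_isCompact hinf
    (isCompact_Icc (a := (0:ℝ)) (b := R)) (fun t ht => ⟨ht.1.le, ht.2.1⟩)
  have hfr := accPt_iff_frequently_nhdsNE.1 hacc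
  have hnc : n ≤ c := by
    by_contra hlt; push Not at hlt
    apply hfr
    have : ∀ᶠ t in nhdsWithin c {c}ᶜ, t < n := nhdsWithin_le_nhds (Iio_mem_nhds hlt)
    filter_upwards [this] with t ht hS
    exact h.ne_of_le (by linarith [hS.1]) hS.1 ht.le hS.2.2
  have hpc : p c = 0 := by
    by_contra hne
    apply hfr
    have : ∀ᶠ t in nhdsWithin c {c}ᶜ, p t ≠ 0 := nhdsWithin_le_nhds (h.cp.continuousAt.eventually_ne hne)
    filter_upwards [this] with t ht hS
    exact ht hS.2.2
  rcases eq_or_lt_of_le hc.1 with h0 | h0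
  · subst h0
    have hn0 : n = 0 := le_antisymm hnc h.hn
    have hy0 := h.y00 hn0
    have hev : ∀ᶠ t in nhds (0:ℝ), y t ≠ 0 := h.cy.continuousAt.eventually_ne hy0
    obtain ⟨ε, hε, hb⟩ := Metric.eventually_nhds_iff.1 hev
    apply hfr
    have : ∀ᶠ t in nhdsWithin (0:ℝ) {0}ᶜ, t < ε := nhdsWithin_le_nhds (Iio_mem_nhds hε)
    filter_upwards [this] with t ht hS
    obtain ⟨τ, hτ, e⟩ := exists_hasDerivAt_eq_zero hS.1 h.cp.continuousOn (by rw [h.p0, hS.2.2])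
      (fun x hx => h.dp x hx.1)
    have hyτ : y τ ≠ 0 := hb (by rw [Real.dist_eq, sub_zero, abs_of_pos hτ.1]; linarith [hτ.2])
    rw [hn0] at e
    have := hτ.1
    have h3 : (0^2 - τ^2)/τ ≠ 0 := by
      apply div_ne_zero _ this.ne'
      nlinarith
    exact (mul_ne_zero h3 hyτ) e
  · have hnc' : n < c := by
      rcases eq_or_lt_of_le hnc with h1 | h1
      · exact absurd hpc (h.ne_of_le (by linarith) h0 (by linarith))
      · exact h1
    have hy : y c ≠ 0 := fun hy => h.nd c h0 hy hpc
    have hne : (n^2 - c^2)/c * y c ≠ 0 := by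
      apply mul_ne_zero _ hy
      apply div_ne_zero _ h0.ne'
      nlinarith [h.hn]
    apply hfr
    filter_upwards [(h.dp c h0).eventually_ne (c := 0) hne] with t ht hS
    exact ht (by rw [hS.2.2])


def NSle (R : ℝ) : Set (ℤ × ℝ) :=
  {q | 0 ≤ q.2 ∧ q.2 ≤ R ∧ pp q.1.natAbs q.2 = 0 ∧ besselJ q.1.natAbs q.2 ≠ 0}

def RSle (σ R : ℝ) : Set (ℤ × ℝ) :=
  {q | 0 < q.2 ∧ q.2 ≤ R ∧ phiRobin σ q.1.natAbs q.2 = 0}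

def Lk (σ : ℝ) (n : ℕ) (t s : ℝ) : Prop :=
  0 ≤ t ∧ t < s ∧ pp n t = 0 ∧ pp n s = -σ * besselJ n s ∧ ∀ τ ∈ Set.Icc t s, besselJ n τ ≠ 0

theorem phi_iff (σ : ℝ) (n : ℕ) (x : ℝ) : phiRobin σ n x = 0 ↔ pp n x = -σ * besselJ n x := by
  unfold phiRobin pp
  constructor <;> intro h <;> linarith

theorem nle_of {n : ℕ} {t : ℝ} (ht : 0 ≤ t) (hp : pp n t = 0) (hy : besselJ n t ≠ 0) : (n:ℝ) ≤ t := by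
  by_contra hlt; push Not at hlt
  have hn : (0:ℝ) < n := lt_of_le_of_lt ht hlt
  rcases eq_or_lt_of_le ht with h0 | h0
  · subst h0; exact hy ((bj_sys n).y0 hn)
  · exact (bj_sys n).ne_of_le hn h0 hlt.le hp

theorem lk_left {σ : ℝ} {n : ℕ} {t1 t2 s : ℝ} (h1 : Lk σ n t1 s) (h2 : Lk σ n t2 s) : t1 = t2 := by
  wlog hlt : t1 < t2 generalizing t1 t2
  · rcases lt_trichotomy t1 t2 with h | h | h
    · exact this h1 h2 h
    · exact h
    · exact (this h2 h1 h).symm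
  exfalso
  obtain ⟨a1, a2, a3, a4, a5⟩ := h1
  obtain ⟨b1, b2, b3, b4, b5⟩ := h2
  have := (bj_sys n).u_anti a1 (nle_of a1 a3 (a5 t1 ⟨le_rfl, a2.le⟩)) a5
    ⟨le_rfl, a2.le⟩ ⟨hlt.le, b2.le⟩ hlt
  simp [a3, b3] at this

theorem lk_right {σ : ℝ} {n : ℕ} {t s1 s2 : ℝ} (h1 : Lk σ n t s1) (h2 : Lk σ n t s2) : s1 = s2 := by
  wlog hlt : s1 < s2 generalizing s1 s2
  · rcases lt_trichotomy s1 s2 with h | h | h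
    · exact this h1 h2 h
    · exact h
    · exact (this h2 h1 h).symm
  exfalso
  obtain ⟨a1, a2, a3, a4, a5⟩ := h1
  obtain ⟨b1, b2, b3, b4, b5⟩ := h2
  have := (bj_sys n).u_anti a1 (nle_of a1 a3 (a5 t ⟨le_rfl, a2.le⟩)) b5
    ⟨a2.le, hlt.le⟩ ⟨b2.le, le_rfl⟩ hlt
  have e1 : pp n s1 / besselJ n s1 = -σ := by
    rw [a4]; field_simp [a5 s1 ⟨a2.le, le_rfl⟩]
  have e2 : pp n s2 / besselJ n s2 = -σ := by
    rw [b4]; field_simp [b5 s2 ⟨b2.le, le_rfl⟩]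
  simp only [e1, e2] at this
  linarith

theorem NSle_fin (R : ℝ) : (NSle R).Finite := by
  have := (Set.finite_Icc (-⌈R⌉) ⌈R⌉).biUnion (t := fun m : ℤ =>
    (insert (0:ℝ) {t | 0 < t ∧ t ≤ R ∧ pp m.natAbs t = 0}).image (fun t => (m, t)))
    (fun m _ => ((((bj_sys m.natAbs).fin R).insert 0)).image _)
  refine this.subset ?_
  rintro ⟨m, t⟩ ⟨h1, h2, h3, h4⟩
  simp only at h1 h2 h3 h4
  have h5 := nle_of h1 h3 h4
  have h6 : (m.natAbs : ℝ) ≤ ⌈R⌉ := by linarith [Int.le_ceil R]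
  have h7 : (m.natAbs : ℤ) ≤ ⌈R⌉ := by
    rw [← Int.cast_natCast] at h6
    exact Int.cast_le.1 h6
  simp only [Set.mem_iUnion]
  refine ⟨m, ⟨by omega, by omega⟩, t, ?_, rfl⟩
  rcases eq_or_lt_of_le h1 with h | h
  · left; exact h.symm
  · right; exact ⟨h, h2, h3⟩

theorem neumann_count (x : ℝ) : diskNeumannCount x = (NSle (Real.sqrt x)).ncard := by
  have e : NSle (Real.sqrt x) = insert ((0:ℤ), (0:ℝ))
      {q : ℤ × ℝ | 0 < q.2 ∧ q.2 ≤ Real.sqrt x ∧ besselJ' q.1.natAbs q.2 = 0} := by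
    ext ⟨m, t⟩
    simp only [NSle, Set.mem_ofPred_eq, Set.mem_insert_iff, Prod.mk.injEq]
    constructor
    · rintro ⟨h1, h2, h3, h4⟩
      rcases eq_or_lt_of_le h1 with h | h
      · left
        subst h
        refine ⟨?_, rfl⟩
        have := nle_of h1 h3 h4
        have h6 : m.natAbs ≤ 0 := by exact_mod_cast this
        omega
      · right
        refine ⟨h, h2, ?_⟩
        unfold pp at h3
        rcases mul_eq_zero.1 h3 with h5 | h5
        · linarith
        · exact h5
    · rintro (⟨rfl, rfl⟩ | ⟨h1, h2, h3⟩)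
      · exact ⟨le_rfl, Real.sqrt_nonneg _, (bj_sys _).p0, by simp [bj_zero_zero]⟩
      · have : pp m.natAbs t = 0 := by simp [pp, h3]
        exact ⟨h1.le, h2, this, fun h => bj_nd _ _ h1 h this⟩
  have hf := NSle_fin (Real.sqrt x)
  rw [e] at hf ⊢
  rw [Set.ncard_insert_of_notMem (by simp) (hf.subset (Set.subset_insert _ _))]
  unfold diskNeumannCount
  ring

theorem robin_count (σ x : ℝ) : diskRobinCount σ x = (RSle σ (Real.sqrt x)).ncard := rfl

theorem exists_prev {σ : ℝ} (hσ : 0 < σ) {R : ℝ} {q : ℤ × ℝ} (hq : q ∈ RSle σ R) :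
    ∃ t, Lk σ q.1.natAbs t q.2 := by
  obtain ⟨h1, h2, h3⟩ := hq
  rw [phi_iff] at h3
  obtain ⟨t, a1, a2, a3, a4⟩ := (bj_sys q.1.natAbs).prev' h1 hσ h3
  exact ⟨t, a1, a2, a3, h3, a4⟩

open Classical in
theorem robin_inj {σ : ℝ} (hσ : 0 < σ) (R : ℝ) : ∃ f : ℤ × ℝ → ℤ × ℝ,
    Set.MapsTo f (RSle σ R) (NSle R) ∧ Set.InjOn f (RSle σ R) := by
  have hex : ∀ q : ℤ × ℝ, ∃ t, q ∈ RSle σ R → Lk σ q.1.natAbs t q.2 := by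
    intro q
    by_cases hq : q ∈ RSle σ R
    · obtain ⟨t, ht⟩ := exists_prev hσ hq
      exact ⟨t, fun _ => ht⟩
    · exact ⟨0, fun h => absurd h hq⟩
  choose f hf using hex
  refine ⟨fun q => (q.1, f q), ?_, ?_⟩
  · intro q hq
    obtain ⟨a1, a2, a3, a4, a5⟩ := hf q hq
    exact ⟨a1, a2.le.trans hq.2.1, a3, a5 _ ⟨le_rfl, a2.le⟩⟩
  · rintro ⟨m, s⟩ hq ⟨m', s'⟩ hq' e
    simp only [Prod.mk.injEq] at e
    obtain ⟨rfl, e⟩ := e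
    have h1 := hf _ hq
    have h2 := hf _ hq'
    rw [e] at h1
    simp only at h1 h2
    rw [lk_right h1 h2]

theorem RSle_fin {σ : ℝ} (hσ : 0 < σ) (R : ℝ) : (RSle σ R).Finite := by
  obtain ⟨f, h1, h2⟩ := robin_inj hσ R
  exact Set.Finite.of_injOn h1 h2 (NSle_fin R)

theorem robin_le_neumann {σ : ℝ} (hσ : 0 < σ) (x : ℝ) : diskRobinCount σ x ≤ diskNeumannCount x := by
  rw [neumann_count, robin_count]
  obtain ⟨f, h1, h2⟩ := robin_inj hσ (Real.sqrt x)
  exact Set.ncard_le_ncard_of_injOn f h1 h2 (NSle_fin _)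

def Bad (σ R R' : ℝ) : Set (ℤ × ℝ) := {q ∈ NSle R | ¬ ∃ s ≤ R', Lk σ q.1.natAbs q.2 s}

theorem count_le {σ R R' : ℝ} (hσ : 0 < σ) (H : Set (ℤ × ℝ))
    (hH : ∀ q ∈ H, q ∈ NSle R' ∧ R < q.2 ∧ ∃ s ≤ R', Lk σ q.1.natAbs q.2 s)
    (hB : (Bad σ R R').ncard ≤ H.ncard) : (NSle R).ncard ≤ (RSle σ R').ncard := by
  have hHf : H.Finite := (NSle_fin R').subset (fun q hq => (hH q hq).1)
  have hBf : (Bad σ R R').Finite := (NSle_fin R).subset (fun q hq => hq.1)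
  let G := (NSle R \ Bad σ R R') ∪ H
  have hG : ∀ q : ℤ × ℝ, ∃ s, q ∈ G → s ≤ R' ∧ Lk σ q.1.natAbs q.2 s := by
    intro q
    by_cases hq : q ∈ G
    · rcases hq with hq | hq
      · have : ∃ s ≤ R', Lk σ q.1.natAbs q.2 s := by
          by_contra hno
          exact hq.2 ⟨hq.1, hno⟩
        obtain ⟨s, h1, h2⟩ := this
        exact ⟨s, fun _ => ⟨h1, h2⟩⟩
      · obtain ⟨s, h1, h2⟩ := (hH q hq).2.2
        exact ⟨s, fun _ => ⟨h1, h2⟩⟩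
    · exact ⟨0, fun h => absurd h hq⟩
  choose f hf using hG
  have h1 : G.ncard ≤ (RSle σ R').ncard := by
    apply Set.ncard_le_ncard_of_injOn (fun q : ℤ × ℝ => (q.1, f q)) _ _ (RSle_fin hσ R')
    · intro q hq
      obtain ⟨a0, a1, a2, a3, a4, a5⟩ := hf q hq
      exact ⟨lt_of_le_of_lt a1 a2, a0, (phi_iff _ _ _).2 a4⟩
    · rintro ⟨m, s⟩ hq ⟨m', s'⟩ hq' e
      simp only [Prod.mk.injEq] at e
      obtain ⟨rfl, e⟩ := e
      have h1 := (hf _ hq).2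
      have h2 := (hf _ hq').2
      rw [e] at h1
      simp only at h1 h2
      rw [lk_left h1 h2]
  have h2 : G.ncard = (NSle R \ Bad σ R R').ncard + H.ncard := by
    apply Set.ncard_union_eq _ ((NSle_fin R).subset Set.sdiff_subset) hHf
    rw [Set.disjoint_left]
    intro q hq hq'
    have := (hH q hq').2.1
    have := hq.1.2.1
    linarith
  have h3 := Set.ncard_sdiff_add_ncard_of_subset (s := Bad σ R R') (t := NSle R) (fun q hq => hq.1) (NSle_fin R)
  omega


theorem bad_u {σ R R' : ℝ} (hR : R < R') {q : ℤ × ℝ} (hσ : 0 < σ)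
    (hq : q ∈ Bad σ R R') :
    (q.1.natAbs : ℝ) ≤ q.2 ∧ (∀ τ ∈ Set.Icc q.2 R', besselJ q.1.natAbs τ ≠ 0) ∧
     -σ < pp q.1.natAbs R' / besselJ q.1.natAbs R' := by
  obtain ⟨⟨h1, h2, h3, h4⟩, h5⟩ := hq
  have hn := nle_of h1 h3 h4
  refine ⟨hn, ?_⟩
  by_contra hc
  apply h5
  obtain ⟨s, a1, a2, a3, a4⟩ := (bj_sys q.1.natAbs).next (α := 0) (β := -σ) h1 hn (by linarith : q.2 < R') h4 (by rw [h3]; ring) (by linarith)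
    (fun hz => by
      by_contra hcc; push Not at hcc
      exact hc ⟨hz, hcc⟩)
  exact ⟨s, a2, h1, a1, h3, a3, a4⟩

theorem bad_props {σ R R' : ℝ} (hR0 : 0 < R) (hR : R < R') {q : ℤ × ℝ} (hσ : 0 < σ)
    (hq : q ∈ Bad σ R R') : (q.1.natAbs : ℝ) ≤ R ∧ besselJ q.1.natAbs R ≠ 0 ∧
      -σ < pp q.1.natAbs R / besselJ q.1.natAbs R ∧ pp q.1.natAbs R / besselJ q.1.natAbs R ≤ 0 ∧
      (R^2 - (q.1.natAbs:ℝ)^2)/R * (R' - R) < σ := by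
  obtain ⟨hn, hz, hu⟩ := bad_u hR hσ hq
  obtain ⟨⟨h1, h2, h3, h4⟩, h5⟩ := hq
  have anti := ((bj_sys q.1.natAbs).u_anti h1 hn hz).antitoneOn
  have e1 := anti ⟨h2, hR.le⟩ ⟨by linarith, le_rfl⟩ hR.le
  have e2 := anti ⟨le_rfl, by linarith⟩ ⟨h2, hR.le⟩ h2
  have e3 := (bj_sys q.1.natAbs).u_quant hR0 hR.le (fun τ hτ => hz τ ⟨by linarith [hτ.1], hτ.2⟩)
  simp only [h3, zero_div] at e1 e2
  exact ⟨by linarith, hz R ⟨h2, hR.le⟩, by linarith, e2, by linarith⟩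

theorem bad_inj {σ R R' : ℝ} (hR : R < R') (hσ : 0 < σ) :
    Set.InjOn (fun q : ℤ × ℝ => q.1) (Bad σ R R') := by
  have key : ∀ (m : ℤ) (t t' : ℝ), (m, t) ∈ Bad σ R R' → (m, t') ∈ Bad σ R R' → ¬ t < t' := by
    intro m t t' h h' hlt
    obtain ⟨hn, hz, hu⟩ := bad_u hR hσ h
    have := (bj_sys _).u_anti h.1.1 hn hz ⟨le_rfl, by have := h.1.2.1; linarith⟩
      ⟨hlt.le, by have := h'.1.2.1; simp only at *; linarith⟩ hlt
    have e1 := h.1.2.2.1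
    have e2 := h'.1.2.2.1
    simp only at e1 e2 this
    rw [e1, e2] at this
    simp at this
  rintro ⟨m, t⟩ h ⟨m', t'⟩ h' e
  simp only at e
  subst e
  rcases lt_trichotomy t t' with hl | hl | hl
  · exact absurd hl (key _ _ _ h h')
  · rw [hl]
  · exact absurd hl (key _ _ _ h' h)

theorem u_step {R : ℝ} (hR : 0 < R) (m : ℕ) (hy : besselJ (m+1) R ≠ 0)
    (hpos : 0 < ((m+1 : ℕ) : ℝ) + pp (m+1) R / besselJ (m+1) R) :
    besselJ m R ≠ 0 ∧ pp m R / besselJ m R = m - R^2 / (((m+1 : ℕ) : ℝ) + pp (m+1) R / besselJ (m+1) R) := by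
  set u := pp (m+1) R / besselJ (m+1) R with hu
  have e1 : pp (m+1) R = u * besselJ (m+1) R := by rw [hu]; field_simp
  have e2 : pp (m+1) R = R * besselJ m R - (m+1) * besselJ (m+1) R := bj_R2 m R
  have e3 : R * besselJ m R = (((m+1:ℕ):ℝ) + u) * besselJ (m+1) R := by push_cast; linarith
  have hne : besselJ m R ≠ 0 := by
    intro h0
    rw [h0, mul_zero] at e3
    exact (mul_ne_zero hpos.ne' hy) e3.symm
  refine ⟨hne, ?_⟩
  have e4 : pp m R = m * besselJ m R - R * besselJ (m+1) R := bj_R1 m R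
  rw [e4]
  have h5 := hpos.ne'
  rw [div_eq_iff hne, sub_mul]
  congr 1
  rw [div_mul_eq_mul_div, eq_div_iff h5]
  linear_combination (-R) * e3

theorem step_alg {R D M u : ℝ} (hD : 1 ≤ D) (hR0 : 0 < R) (hMR : M ≤ R) (hMD : R - 2 * D ≤ M)
    (hw : R/2 ≤ M + u) (husq : u^2 ≤ R * D) : R^2 ≤ (M - 1 - u + 11 * D) * (M + u) := by
  have k0 : D * (R/2) ≤ D * (M + u) := mul_le_mul_of_nonneg_left hw (by linarith)
  have k1 : (R - M) * (R + M) ≤ (2 * D) * (2 * R) := by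
    rcases le_total 0 (R + M) with h | h
    · exact mul_le_mul (by linarith) (by linarith) h (by linarith)
    · have : (R - M) * (R + M) ≤ 0 := mul_nonpos_of_nonneg_of_nonpos (by linarith) h
      have : 0 ≤ (2 * D) * (2 * R) := by positivity
      linarith
  have k2 : 1 * (M + u) ≤ D * (M + u) := mul_le_mul_of_nonneg_right hD (by linarith)
  linarith

theorem spacing {σ R D : ℝ} {J n : ℕ} (hσ : 0 < σ) (hD : 1 ≤ D) (hDR : 16 * D ≤ R) (hJD : (J:ℝ) ≤ D)
    (hJ : (σ + 11 * D * J)^2 ≤ R * D) (hn : (n:ℝ) ≤ R) (hnD : R - D ≤ n)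
    (hy : besselJ n R ≠ 0) (h1 : -σ < pp n R / besselJ n R) (h2 : pp n R / besselJ n R ≤ 0) :
    ∀ j : ℕ, j ≤ J → j ≤ n ∧ besselJ (n - j) R ≠ 0 ∧ pp (n-j) R / besselJ (n-j) R ≤ -j ∧
      -σ - 11 * D * j ≤ pp (n-j) R / besselJ (n-j) R := by
  intro j
  induction j with
  | zero => intro _; simp; exact ⟨hy, h2, h1.le⟩
  | succ j ih =>
    intro hj
    obtain ⟨a1, a2, a3, a4⟩ := ih (by omega)
    have hjJ : (j:ℝ) + 1 ≤ J := by exact_mod_cast hj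
    have hlt : j < n := by
      have : (j:ℝ) < n := by linarith
      exact_mod_cast this
    obtain ⟨m, hm⟩ : ∃ m, n - j = m + 1 := ⟨n - j - 1, by omega⟩
    have hm' : n - (j+1) = m := by omega
    have hmn : ((m+1:ℕ):ℝ) = n - j := by
      rw [← hm]; push_cast [a1]; ring
    rw [hm] at a2 a3 a4
    rw [hm']
    set u := pp (m+1) R / besselJ (m+1) R with hu
    have hR0 : 0 < R := by linarith
    have husq : u^2 ≤ R * D := by
      refine le_trans ?_ hJ
      apply sq_le_sq'
      · have : 11 * D * j ≤ 11 * D * J := by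
          apply mul_le_mul_of_nonneg_left _ (by linarith); linarith
        linarith
      · have : 0 ≤ 11 * D * J := by positivity
        have : (0:ℝ) ≤ j := by positivity
        linarith
    have hu4 : -(R/4) ≤ u := by
      by_contra hc; push Not at hc
      nlinarith
    have hj0 : (0:ℝ) ≤ j := by positivity
    have hw : R/2 ≤ ((m+1:ℕ):ℝ) + u := by rw [hmn]; linarith
    have hpos : 0 < ((m+1:ℕ):ℝ) + u := by linarith
    obtain ⟨b1, b2⟩ := u_step hR0 m a2 hpos
    rw [← hu] at b2
    set M := ((m+1:ℕ):ℝ) with hM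
    have hmM : (m:ℝ) = M - 1 := by rw [hM]; push_cast; ring
    have hMR : M ≤ R := by linarith
    have hMD : R - 2 * D ≤ M := by linarith
    refine ⟨by omega, b1, ?_, ?_⟩
    · rw [b2]
      have : M - u ≤ R^2 / (M + u) := by
        rw [le_div_iff₀ hpos]
        nlinarith [sq_nonneg u]
      push_cast
      linarith
    · rw [b2]
      have : R^2 / (M + u) ≤ M - 1 - u + 11 * D := by
        rw [div_le_iff₀ hpos]
        exact step_alg hD hR0 hMR hMD hw husq
      push_cast
      linarith

theorem sep_card {σ : ℝ} (B : Finset ℕ) (d J : ℕ) (hJ : 0 < J)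
    (hd : ∀ n ∈ B, ∀ n' ∈ B, n ≤ n' + d)
    (hs : ∀ n ∈ B, ∀ n' ∈ B, n' < n → n ≤ n' + J → ((n:ℝ) - n') < σ) :
    B.card ≤ (⌈σ⌉₊ + 1) * (d / J + 2) := by
  rcases B.eq_empty_or_nonempty with hB | hB
  · subst hB; simp
  have h1 : B.card ≤ (⌈σ⌉₊ + 1) * (B.image (fun n => n / J)).card := by
    apply Finset.card_le_mul_card_image
    intro b _
    rcases (B.filter (fun n => n / J = b)).eq_empty_or_nonempty with hF | hF
    · rw [hF]; simp
    set a := (B.filter (fun n => n / J = b)).min' hF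
    have ha := Finset.min'_mem _ hF
    have : B.filter (fun n => n / J = b) ⊆ Finset.Icc a (a + ⌈σ⌉₊) := by
      intro n hn
      have hle : a ≤ n := Finset.min'_le _ _ hn
      rw [Finset.mem_filter] at hn ha
      rw [Finset.mem_Icc]
      refine ⟨hle, ?_⟩
      rcases eq_or_lt_of_le hle with h | h
      · omega
      · have e : n ≤ a + J := by
          have e1 := Nat.div_add_mod n J
          have e2 := Nat.div_add_mod a J
          have e3 := Nat.mod_lt n hJ
          have ha2 : a / J = b := ha.2
          rw [hn.2] at e1
          rw [ha2] at e2
          omega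
        have := hs n hn.1 a ha.1 h e
        have h3 := Nat.le_ceil σ
        have h4 : (n:ℝ) ≤ ((a + ⌈σ⌉₊ : ℕ):ℝ) := by push_cast; linarith
        exact_mod_cast h4
    refine (Finset.card_le_card this).trans ?_
    simp
    omega
  have h2 : (B.image (fun n => n / J)).card ≤ d / J + 2 := by
    set a := B.min' hB
    have ha := Finset.min'_mem _ hB
    have : B.image (fun n => n / J) ⊆ Finset.Icc (a / J) ((a+d)/J) := by
      intro k hk
      rw [Finset.mem_image] at hk
      obtain ⟨n, hn, rfl⟩ := hk
      rw [Finset.mem_Icc]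
      exact ⟨Nat.div_le_div_right (Finset.min'_le _ _ hn), Nat.div_le_div_right (hd n hn a ha)⟩
    refine (Finset.card_le_card this).trans ?_
    rw [Nat.card_Icc, Nat.add_div hJ]
    generalize a / J = α
    generalize d / J = β
    split_ifs <;> omega
  exact h1.trans (Nat.mul_le_mul_left _ h2)

theorem bad_card {σ R R' D : ℝ} {J : ℕ} (hσ : 0 < σ) (hRR : R < R') (hJ0 : 0 < J)
    (hD : 1 ≤ D) (hDR : 16 * D ≤ R) (hJD : (J:ℝ) ≤ D)
    (hJ : (σ + 11 * D * J)^2 ≤ R * D) (hgap : σ ≤ D * (R' - R)) :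
    (Bad σ R R').ncard ≤ 2 * ((⌈σ⌉₊ + 1) * (⌊D⌋₊ / J + 2)) := by
  classical
  have hR0 : 0 < R := by linarith
  have hfin : (Bad σ R R').Finite := (NSle_fin R).subset (fun q hq => hq.1)
  set B : Finset ℕ := hfin.toFinset.image (fun q => q.1.natAbs) with hB
  have hBp : ∀ n ∈ B, (n:ℝ) ≤ R ∧ R - D ≤ n ∧ besselJ n R ≠ 0 ∧ -σ < pp n R / besselJ n R ∧
      pp n R / besselJ n R ≤ 0 := by
    intro n hn
    rw [hB, Finset.mem_image] at hn
    obtain ⟨q, hq, rfl⟩ := hn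
    rw [Set.Finite.mem_toFinset] at hq
    obtain ⟨c1, c2, c3, c4, c5⟩ := bad_props hR0 hRR hσ hq
    refine ⟨c1, ?_, c2, c3, c4⟩
    by_contra hc; push Not at hc
    have : D ≤ (R^2 - (q.1.natAbs:ℝ)^2)/R := by
      rw [le_div_iff₀ hR0]
      have : (0:ℝ) ≤ (q.1.natAbs:ℝ) := by positivity
      nlinarith
    nlinarith
  have hcard : B.card ≤ (⌈σ⌉₊ + 1) * (⌊D⌋₊ / J + 2) := by
    apply sep_card B ⌊D⌋₊ J hJ0
    · intro n hn n' hn'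
      have h1 := (hBp n hn).1
      have h2 := (hBp n' hn').2.1
      rcases le_total n n' with h | h
      · omega
      · have : n - n' ≤ ⌊D⌋₊ := by
          apply Nat.le_floor
          rw [Nat.cast_sub h]
          linarith
        omega
    · intro n hn n' hn' hlt hle
      obtain ⟨c1, c2, c3, c4, c5⟩ := hBp n hn
      obtain ⟨d1, d2, d3, d4⟩ := spacing hσ hD hDR hJD hJ c1 c2 c3 c4 c5 (n - n') (by omega)
      rw [show n - (n - n') = n' by omega] at *
      have := (hBp n' hn').2.2.2.1
      rw [Nat.cast_sub hlt.le] at *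
      linarith
  have h1 : (Bad σ R R').ncard ≤ ((B.image (fun n : ℕ => (n:ℤ))) ∪ (B.image (fun n : ℕ => -(n:ℤ)))).card := by
    rw [← Set.ncard_coe_finset]
    apply Set.ncard_le_ncard_of_injOn (fun q : ℤ × ℝ => q.1) _ (bad_inj hRR hσ) (Finset.finite_toSet _)
    intro q hq
    have hm : q.1.natAbs ∈ B := by
      rw [hB, Finset.mem_image]
      exact ⟨q, by rwa [Set.Finite.mem_toFinset], rfl⟩
    simp only [Finset.coe_union, Finset.coe_image, Set.mem_union, Set.mem_image, Finset.mem_coe]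
    rcases Int.natAbs_eq q.1 with h | h
    · left; exact ⟨_, hm, h.symm⟩
    · right; exact ⟨_, hm, h.symm⟩
  have h2 := Finset.card_union_le (B.image (fun n : ℕ => (n:ℤ))) (B.image (fun n : ℕ => -(n:ℤ)))
  have h3 : (B.image (fun n : ℕ => (n:ℤ))).card ≤ B.card := Finset.card_image_le
  have h4 : (B.image (fun n : ℕ => -(n:ℤ))).card ≤ B.card := Finset.card_image_le
  omega


structure Rot (A B a b : ℕ → ℝ) : Prop where
  hA : ∀ k, A (k+1) = A k - a k * B k
  hB : ∀ k, B (k+1) = B k + b k * A (k+1)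
  nd : ∀ k, A k = 0 → B k ≠ 0

theorem Rot.neg {A B a b : ℕ → ℝ} (h : Rot A B a b) : Rot (fun k => - A k) (fun k => - B k) a b where
  hA := fun k => by rw [h.hA k]; ring
  hB := fun k => by rw [h.hB k]; ring
  nd := fun k hk => by
    have := h.nd k (by simpa using hk)
    simpa using this

theorem Rot.pos_false {A B a b : ℕ → ℝ} (h : Rot A B a b) {k0 L : ℕ} {ε : ℝ} (hε : 0 < ε)
    (ha : ∀ k, k0 ≤ k → ε ≤ a k) (hb : ∀ k, k0 ≤ k → ε ≤ b k) (hL : 1 ≤ L * ε)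
    (hpos : ∀ k, k0 ≤ k → k ≤ k0 + 4 * L → 0 < B k) : False := by
  have stepA : ∀ k, k0 ≤ k → k ≤ k0 + 4 * L → A (k+1) ≤ A k - ε * B k := by
    intro k h1 h2
    rw [h.hA k]
    have := mul_le_mul_of_nonneg_right (ha k h1) (hpos k h1 h2).le
    linarith
  have antiA : ∀ i k, k0 ≤ k → k + i ≤ k0 + 4 * L → A (k+i) ≤ A k := by
    intro i
    induction i with
    | zero => intro k _ _; simp
    | succ i ih =>
      intro k h1 h2
      have e1 := ih k h1 (by omega)
      have e2 := stepA (k+i) (by omega) (by omega)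
      have e3 := mul_pos hε (hpos (k+i) (by omega) (by omega))
      rw [← add_assoc]; linarith
  by_cases hm : 0 ≤ A (k0 + 2 * L)
  · have Apos : ∀ k, k0 ≤ k → k ≤ k0 + 2 * L → 0 ≤ A k := by
      intro k h1 h2
      have := antiA (k0 + 2 * L - k) k h1 (by omega)
      rw [show k + (k0 + 2 * L - k) = k0 + 2 * L by omega] at this
      linarith
    have stepB : ∀ k, k0 ≤ k → k + 1 ≤ k0 + 2 * L → B k + ε * A (k+1) ≤ B (k+1) := by
      intro k h1 h2
      rw [h.hB k]
      have := mul_le_mul_of_nonneg_right (hb k h1) (Apos (k+1) (by omega) h2)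
      linarith
    have monoB : ∀ i k, k0 ≤ k → k + i ≤ k0 + 2 * L → B k ≤ B (k+i) := by
      intro i
      induction i with
      | zero => intro k _ _; simp
      | succ i ih =>
        intro k h1 h2
        have e1 := ih k h1 (by omega)
        have e2 := stepB (k+i) (by omega) (by omega)
        have e3 := mul_nonneg hε.le (Apos (k+i+1) (by omega) (by omega))
        rw [← add_assoc]; linarith
    have s1 : ∀ j, j ≤ L → A (k0 + L + j) ≤ A (k0 + L) - j * (ε * B (k0+L)) := by
      intro j
      induction j with
      | zero => intro _; simp
      | succ j ih =>
        intro hj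
        have e1 := ih (by omega)
        have e2 := stepA (k0 + L + j) (by omega) (by omega)
        have e3 := mul_le_mul_of_nonneg_left (monoB j (k0+L) (by omega) (by omega)) hε.le
        rw [← add_assoc]; push_cast; linarith
    have s2 : ∀ j, j ≤ L → B k0 + j * (ε * A (k0+L)) ≤ B (k0 + j) := by
      intro j
      induction j with
      | zero => intro _; simp
      | succ j ih =>
        intro hj
        have e1 := ih (by omega)
        have e2 := stepB (k0 + j) (by omega) (by omega)
        have e4 := antiA (L - (j+1)) (k0 + j + 1) (by omega) (by omega)
        rw [show k0 + j + 1 + (L - (j+1)) = k0 + L by omega] at e4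
        have e3 := mul_le_mul_of_nonneg_left e4 hε.le
        rw [← add_assoc]; push_cast; linarith
    have t1 := s1 L le_rfl
    have t2 := s2 L le_rfl
    rw [show k0 + L + L = k0 + 2 * L by ring] at t1
    have p1 := hpos k0 le_rfl (by omega)
    have p2 := hpos (k0+L) (by omega) (by omega)
    have q1 : 1 * B (k0+L) ≤ (L * ε) * B (k0 + L) := mul_le_mul_of_nonneg_right hL p2.le
    have q2 : B (k0+L) ≤ A (k0+L) := by linarith
    have q3 : 1 * A (k0+L) ≤ (L * ε) * A (k0 + L) := mul_le_mul_of_nonneg_right hL (by linarith)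
    linarith
  · push Not at hm
    have Aneg : ∀ k, k0 + 2 * L ≤ k → k ≤ k0 + 4 * L → A k ≤ 0 := by
      intro k h1 h2
      have := antiA (k - (k0 + 2 * L)) (k0 + 2 * L) (by omega) (by omega)
      rw [show (k0 + 2 * L) + (k - (k0 + 2 * L)) = k by omega] at this
      linarith
    have stepB : ∀ k, k0 + 2 * L ≤ k → k + 1 ≤ k0 + 4 * L → B (k+1) ≤ B k + ε * A (k+1) := by
      intro k h1 h2
      rw [h.hB k]
      have := mul_le_mul_of_nonpos_right (hb k (by omega)) (Aneg (k+1) (by omega) h2)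
      linarith
    have antiB : ∀ i k, k0 + 2 * L ≤ k → k + i ≤ k0 + 4 * L → B (k+i) ≤ B k := by
      intro i
      induction i with
      | zero => intro k _ _; simp
      | succ i ih =>
        intro k h1 h2
        have e1 := ih k h1 (by omega)
        have e2 := stepB (k+i) (by omega) (by omega)
        have e3 := mul_nonneg hε.le (neg_nonneg.2 (Aneg (k+i+1) (by omega) (by omega)))
        rw [← add_assoc]; linarith
    have s1 : ∀ j, j ≤ L → A (k0 + 2 * L + j) ≤ A (k0 + 2 * L) - j * (ε * B (k0+3 * L)) := by
      intro j
      induction j with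
      | zero => intro _; simp
      | succ j ih =>
        intro hj
        have e1 := ih (by omega)
        have e2 := stepA (k0 + 2 * L + j) (by omega) (by omega)
        have e4 := antiB (L - j) (k0 + 2 * L + j) (by omega) (by omega)
        rw [show k0 + 2 * L + j + (L - j) = k0 + 3 * L by omega] at e4
        have e3 := mul_le_mul_of_nonneg_left e4 hε.le
        rw [← add_assoc]; push_cast; linarith
    have s2 : ∀ j, j ≤ L → B (k0 + 3 * L + j) ≤ B (k0 + 3 * L) + j * (ε * A (k0+3 * L)) := by
      intro j
      induction j with
      | zero => intro _; simp
      | succ j ih =>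
        intro hj
        have e1 := ih (by omega)
        have e2 := stepB (k0 + 3 * L + j) (by omega) (by omega)
        have e4 := antiA (j+1) (k0 + 3 * L) (by omega) (by omega)
        have e3 := mul_le_mul_of_nonneg_left e4 hε.le
        rw [← add_assoc] at e3
        rw [← add_assoc]; push_cast; linarith
    have t1 := s1 L le_rfl
    have t2 := s2 L le_rfl
    rw [show k0 + 2 * L + L = k0 + 3 * L by ring] at t1
    have p1 := hpos (k0 + 3 * L + L) (by omega) (by omega)
    have p2 := hpos (k0+3 * L) (by omega) (by omega)
    have q1 : 1 * B (k0+3 * L) ≤ (L * ε) * B (k0 + 3 * L) := mul_le_mul_of_nonneg_right hL p2.le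
    have q2 : B (k0+3 * L) ≤ - A (k0+3 * L) := by linarith
    have q3 : 1 * (-A (k0+3 * L)) ≤ (L * ε) * (-A (k0 + 3 * L)) := mul_le_mul_of_nonneg_right hL (by linarith)
    linarith

theorem Rot.cross {A B a b : ℕ → ℝ} (h : Rot A B a b) {k0 L : ℕ} {ε : ℝ} (hε : 0 < ε)
    (ha : ∀ k, k0 ≤ k → ε ≤ a k) (hb : ∀ k, k0 ≤ k → ε ≤ b k) (hL : 1 ≤ L * ε) :
    ∃ k, k0 ≤ k ∧ k < k0 + 4 * L ∧ B k * B (k+1) ≤ 0 := by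
  by_contra hno
  push Not at hno
  have hL0 : 0 < L := by
    rcases Nat.eq_zero_or_pos L with h0 | h0
    · subst h0; simp at hL; linarith
    · exact h0
  have key : ∀ B' : ℕ → ℝ, (∀ k, k0 ≤ k → k < k0 + 4 * L → 0 < B' k * B' (k+1)) → 0 < B' k0 →
      ∀ i, i ≤ 4 * L → 0 < B' (k0 + i) := by
    intro B' h1 h2 i
    induction i with
    | zero => intro _; simpa using h2
    | succ i ih =>
      intro hi
      have e1 := ih (by omega)
      have e2 := h1 (k0 + i) (by omega) (by omega)
      exact (pos_iff_pos_of_mul_pos e2).1 e1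
  have h00 : B k0 ≠ 0 := by
    intro h0
    have := hno k0 le_rfl (by omega)
    rw [h0] at this; simp at this
  rcases lt_or_gt_of_ne h00 with h0 | h0
  · apply h.neg.pos_false hε ha hb hL
    intro k h1 h2
    have := key (fun k => - B k) (fun k h1 h2 => by have := hno k h1 h2; simpa using this) (by simpa using h0) (k - k0) (by omega)
    rwa [show k0 + (k - k0) = k by omega] at this
  · apply h.pos_false hε ha hb hL
    intro k h1 h2
    have := key B hno h0 (k - k0) (by omega)
    rwa [show k0 + (k - k0) = k by omega] at this

theorem Rot.back_pos {A B a b : ℕ → ℝ} (h : Rot A B a b) {k H : ℕ} {ε : ℝ} (hε : 0 < ε)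
    (ha : ∀ i, i ≤ k → 0 ≤ a i ∧ a i ≤ ε) (hb : ∀ i, i ≤ k → 0 ≤ b i ∧ b i ≤ ε)
    (hH : H * ε ≤ 1/2) (hHk : H ≤ k) (h1 : B k ≤ 0) (h2 : 0 ≤ B (k+1)) (h3 : 0 < A (k+1)) :
    ∀ j, j < H → A (k-j) ≠ 0 ∧ 0 ≤ -(B (k-j) / A (k-j)) ∧ -(B (k-j) / A (k-j)) ≤ 2 * H * ε := by
  set W := A (k+1) with hW
  have main : ∀ j, j < H → B (k-j) ≤ 0 ∧ - B (k-j) ≤ (j+1) * ε * W ∧ A (k-j) ≤ W ∧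
      W - ((j+1) * ε)^2 * W ≤ A (k-j) := by
    intro j
    induction j with
    | zero =>
      intro _
      have e1 := h.hA k
      have e2 := h.hB k
      rw [← hW] at e1 e2
      have e3 : b k * W ≤ ε * W := mul_le_mul_of_nonneg_right (hb k le_rfl).2 h3.le
      have e4 : 0 ≤ a k * (-B k) := mul_nonneg (ha k le_rfl).1 (by linarith)
      have e5 : -B k ≤ ε * W := by linarith
      have e6 : a k * (-B k) ≤ ε * (ε * W) := mul_le_mul (ha k le_rfl).2 e5 (by linarith) hε.le
      simp only [Nat.sub_zero, Nat.cast_zero, zero_add, one_mul]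
      refine ⟨h1, e5, by linarith, by linarith⟩
    | succ j ih =>
      intro hj
      obtain ⟨i1, i2, i3, i4⟩ := ih (by omega)
      obtain ⟨m, hm⟩ : ∃ m, k - j = m + 1 := ⟨k - j - 1, by omega⟩
      rw [show k - (j+1) = m by omega]
      rw [hm] at i1 i2 i3 i4
      have hmk : m ≤ k := by omega
      have e1 := h.hA m
      have e2 := h.hB m
      have hjH : ((j:ℝ)+1+1) ≤ H := by exact_mod_cast hj
      have hj0 : (0:ℝ) ≤ j := by positivity
      have hjε : ((j:ℝ)+1+1) * ε ≤ 1/2 := le_trans (mul_le_mul_of_nonneg_right hjH hε.le) hH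
      have hjε1 : ((j:ℝ)+1) * ε ≤ 1/2 := by linarith
      have hsq : (((j:ℝ)+1) * ε)^2 ≤ 1/4 := by
        have : 0 ≤ ((j:ℝ)+1) * ε := by positivity
        nlinarith
      have hA0 : 0 ≤ A (m+1) := by
        have := mul_le_mul_of_nonneg_right hsq h3.le
        linarith
      have f1 : 0 ≤ b m * A (m+1) := mul_nonneg (hb m hmk).1 hA0
      have f2 : b m * A (m+1) ≤ ε * W := mul_le_mul (hb m hmk).2 i3 hA0 hε.le
      have g1 : B m ≤ 0 := by linarith
      have g2 : -B m ≤ ((j:ℝ)+1+1) * ε * W := by linarith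
      have f3 : 0 ≤ a m * (-B m) := mul_nonneg (ha m hmk).1 (by linarith)
      have f4 : a m * (-B m) ≤ ε * (((j:ℝ)+1+1) * ε * W) := mul_le_mul (ha m hmk).2 g2 (by linarith) hε.le
      push_cast
      refine ⟨g1, g2, by linarith, ?_⟩
      have f5 : 0 ≤ (j+1) * (ε^2 * W) := by positivity
      nlinarith
  intro j hj
  obtain ⟨i1, i2, i3, i4⟩ := main j hj
  have hjH : ((j:ℝ)+1) ≤ H := by exact_mod_cast hj
  have hjε : ((j:ℝ)+1) * ε ≤ 1/2 := le_trans (mul_le_mul_of_nonneg_right hjH hε.le) hH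
  have hj0 : (0:ℝ) ≤ j := by positivity
  have hsq : (((j:ℝ)+1) * ε)^2 ≤ 1/4 := by
    have : 0 ≤ ((j:ℝ)+1) * ε := by positivity
    nlinarith
  have hAW : W / 2 ≤ A (k-j) := by
    have := mul_le_mul_of_nonneg_right hsq h3.le
    linarith
  have hA0 : 0 < A (k-j) := by linarith
  refine ⟨hA0.ne', ?_, ?_⟩
  · rw [← neg_div]; exact div_nonneg (by linarith) hA0.le
  · rw [← neg_div, div_le_iff₀ hA0]
    have c1 : ((j:ℝ)+1) * (ε * W) ≤ H * (ε * W) := mul_le_mul_of_nonneg_right hjH (by positivity)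
    have c2 : (2 * H * ε) * (W/2) ≤ (2 * H * ε) * A (k-j) := mul_le_mul_of_nonneg_left hAW (by positivity)
    linarith

theorem Rot.back {A B a b : ℕ → ℝ} (h : Rot A B a b) {k H : ℕ} {ε : ℝ} (hε : 0 < ε)
    (ha : ∀ i, i ≤ k → 0 ≤ a i ∧ a i ≤ ε) (hb : ∀ i, i ≤ k → 0 ≤ b i ∧ b i ≤ ε) (hbk : 0 < b k)
    (hH : H * ε ≤ 1/2) (hHk : H ≤ k) (h1 : B k * B (k+1) ≤ 0) :
    ∀ j, j < H → A (k-j) ≠ 0 ∧ 0 ≤ -(B (k-j) / A (k-j)) ∧ -(B (k-j) / A (k-j)) ≤ 2 * H * ε := by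
  have aux : ∀ {A B : ℕ → ℝ}, Rot A B a b → B k ≤ 0 → 0 ≤ B (k+1) → 0 < A (k+1) := by
    intro A B h h1 h2
    have e1 := h.hB k
    have e2 := h.hA k
    by_contra hc; push Not at hc
    have e3 : b k * A (k+1) ≤ 0 := mul_nonpos_of_nonneg_of_nonpos hbk.le hc
    have e4 : b k * A (k+1) = 0 := by linarith
    have e5 : A (k+1) = 0 := by
      rcases mul_eq_zero.1 e4 with h | h
      · linarith
      · exact h
    exact h.nd (k+1) e5 (by linarith)
  by_cases hs : B k ≤ 0 ∧ 0 ≤ B (k+1)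
  · exact h.back_pos hε ha hb hH hHk hs.1 hs.2 (aux h hs.1 hs.2)
  · have hs' : 0 ≤ B k ∧ B (k+1) ≤ 0 := by
      rcases mul_nonpos_iff.1 h1 with h | h
      · exact h
      · exact absurd h hs
    have := h.neg.back_pos hε ha hb hH hHk (by linarith [hs'.1]) (by linarith [hs'.2])
      (aux h.neg (by linarith [hs'.1]) (by linarith [hs'.2]))
    intro j hj
    obtain ⟨c1, c2, c3⟩ := this j hj
    rw [neg_div_neg_eq] at c2 c3
    exact ⟨by simpa using c1, c2, c3⟩

theorem bj_rot {R : ℝ} (hR : 0 < R) : Rot (fun k => (-1)^k * besselJ (2*k) R)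
    (fun k => (-1)^k * besselJ (2*k+1) R) (fun k => 2 * (2*k+1) / R) (fun k => 2 * (2*k+2)/R) where
  hA := fun k => by
    have := bj_rec (2*k) R
    have e : besselJ (2*k+2) R = 2 * (2*k+1) / R * besselJ (2*k+1) R - besselJ (2*k) R := by
      push_cast at this
      field_simp
      linarith
    rw [show 2 * (k+1) = 2*k+2 by ring, e, pow_succ]
    ring
  hB := fun k => by
    have := bj_rec (2*k+1) R
    have e : besselJ (2*k+3) R = 2 * (2*k+2) / R * besselJ (2*k+2) R - besselJ (2*k+1) R := by
      push_cast at this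
      rw [show 2*k+1+1 = 2*k+2 by ring, show 2*k+1+2 = 2*k+3 by ring] at this
      field_simp
      linarith
    rw [show 2 * (k+1) + 1 = 2*k+3 by ring, show 2 * (k+1) = 2*k+2 by ring, e, pow_succ]
    ring
  nd := fun k h1 h2 => by
    have hne : ((-1:ℝ))^k ≠ 0 := by positivity
    exact bj_ndn (2*k) R hR ((mul_eq_zero.1 h1).resolve_left hne) ((mul_eq_zero.1 h2).resolve_left hne)

theorem hit_one {σ R R' α : ℝ} {n : ℕ} (hσ : 0 < σ) (hR : 0 < R) (hn : (n:ℝ) ≤ R/2)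
    (hy : besselJ n R ≠ 0) (hp : pp n R = α * besselJ n R) (hα : 0 < α)
    (hR' : R + 2 * (α + σ)/R ≤ R') :
    ∃ t, ((n:ℤ), t) ∈ NSle R' ∧ R < t ∧ ∃ s ≤ R', Lk σ n t s := by
  have hn0 : (0:ℝ) ≤ n := by positivity
  have hq : ∀ t, R ≤ t → R/2 ≤ (t^2 - (n:ℝ)^2)/t := by
    intro t ht
    rw [le_div_iff₀ (by linarith)]
    nlinarith
  have key : ∀ t c, R ≤ t → 0 < c → c ≤ (t^2 - (n:ℝ)^2)/t * (t + 2 * c / R - t) := by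
    intro t c ht hc
    have h1 : 0 < 2 * c / R := by positivity
    have h2 := mul_le_mul_of_nonneg_right (hq t ht) h1.le
    have h3 : R/2 * (2 * c / R) = c := by field_simp
    rw [add_sub_cancel_left]; linarith
  obtain ⟨t, a1, a2, a3, a4⟩ := (bj_sys n).next_q (β := 0) (s := R + 2 * α / R) hR (by linarith)
    (by have : 0 < 2 * α / R := by positivity
        linarith) hy hp hα (by rw [sub_zero]; exact key R α le_rfl hα)
  have hyt := a4 t ⟨a1.le, le_rfl⟩
  rw [zero_mul] at a3
  obtain ⟨s, b1, b2, b3, b4⟩ := (bj_sys n).next_q (α := 0) (β := -σ) (t0 := t) (s := t + 2 * σ / R) (by linarith) (by linarith)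
    (by have : 0 < 2 * σ / R := by positivity
        linarith) hyt (by rw [a3]; ring) (by linarith) (by rw [zero_sub, neg_neg]; exact key t σ a1.le hσ)
  have e : 2 * (α + σ)/R = 2 * α / R + 2 * σ / R := by ring
  have hs : s ≤ R' := by linarith
  exact ⟨t, ⟨by simp only; linarith, by simp only; linarith, by simpa using a3, by simpa using hyt⟩, a1, s, hs,
    by linarith, b1, a3, b3, b4⟩

theorem hits_exist {σ w R' : ℝ} (hσ : 0 < σ) (hw : 40 ≤ w) (H : ℕ) (hH : 100 * (H:ℝ) ≤ w)
    (hR' : w^2 + 2 * ((20 * w + 100 * H * w) + σ)/w^2 ≤ R') :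
    ∃ Hs : Set (ℤ × ℝ), (∀ q ∈ Hs, q ∈ NSle R' ∧ w^2 < q.2 ∧ ∃ s ≤ R', Lk σ q.1.natAbs q.2 s) ∧
      Hs.ncard = H := by
  have hw0 : 0 < w := by linarith
  have hR : 0 < w^2 := by positivity
  set L := ⌈w⌉₊ with hL
  have hL1 : w ≤ L := Nat.le_ceil w
  have hL2 : (L:ℝ) < w + 1 := Nat.ceil_lt_add_one hw0.le
  have lowr : ∀ k : ℕ, L ≤ k → 4 / w ≤ 2 * (2*(k:ℝ)+1) / w^2 := by
    intro k hk
    have : (L:ℝ) ≤ k := by exact_mod_cast hk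
    rw [div_le_div_iff₀ hw0 hR]
    nlinarith
  have lowr2 : ∀ k : ℕ, L ≤ k → 4 / w ≤ 2 * (2*(k:ℝ)+2) / w^2 := by
    intro k hk
    refine (lowr k hk).trans ?_
    apply div_le_div_of_nonneg_right _ hR.le
    linarith
  obtain ⟨k, k1, k2, k3⟩ := (bj_rot hR).cross (k0 := L) (L := L) (ε := 4 / w) (by positivity) lowr lowr2
    (by rw [mul_div_assoc', le_div_iff₀ hw0]; linarith)
  have kr : (k:ℝ) ≤ 10 * w := by
    have : (k:ℝ) < L + 4 * L := by exact_mod_cast k2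
    linarith
  have kl : w ≤ k := hL1.trans (by exact_mod_cast k1)
  have hHk : H < k := by
    have : (H:ℝ) < k := by
      have : (0:ℝ) ≤ H := by positivity
      linarith
    exact_mod_cast this
  have up : ∀ i : ℕ, i ≤ k → 2 * (2*(i:ℝ)+2) / w^2 ≤ 50 / w := by
    intro i hi
    have : (i:ℝ) ≤ k := by exact_mod_cast hi
    rw [div_le_div_iff₀ hR hw0]
    nlinarith
  have back := (bj_rot hR).back (k := k) (H := H) (ε := 50 / w) (by positivity)
    (fun i hi => ⟨by positivity, le_trans (div_le_div_of_nonneg_right (by linarith) hR.le) (up i hi)⟩)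
    (fun i hi => ⟨by positivity, up i hi⟩) (by positivity)
    (by rw [mul_div_assoc', div_le_iff₀ hw0]; linarith) hHk.le k3
  have ex : ∀ j : ℕ, ∃ t, j < H → (((2*(k-j) : ℕ):ℤ), t) ∈ NSle R' ∧ w^2 < t ∧ ∃ s ≤ R', Lk σ (2*(k-j)) t s := by
    intro j
    by_cases hj : j < H
    · obtain ⟨c1, c2, c3⟩ := back j hj
      set m := k - j with hm
      have hne : ((-1:ℝ))^m ≠ 0 := by positivity
      rw [mul_div_mul_left _ _ hne] at c2 c3
      have hy : besselJ (2*m) (w^2) ≠ 0 := fun h0 => c1 (by rw [h0, mul_zero])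
      have hm1 : (1:ℝ) ≤ m := by
        have : 1 ≤ m := by omega
        exact_mod_cast this
      have hm2 : (m:ℝ) ≤ 10 * w := by
        have : m ≤ k := by omega
        have : (m:ℝ) ≤ k := by exact_mod_cast this
        linarith
      set z := besselJ (2*m+1) (w^2) / besselJ (2*m) (w^2) with hz
      have hα0 : 0 < ((2*m:ℕ):ℝ) - w^2 * z := by
        push_cast
        nlinarith [mul_nonneg hR.le c2]
      have hα1 : ((2*m:ℕ):ℝ) - w^2 * z ≤ 20 * w + 100 * H * w := by
        push_cast
        have e1 := mul_le_mul_of_nonneg_left c3 hR.le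
        have e2 : w^2 * (2 * H * (50/w)) = 100 * H * w := by field_simp; ring
        linarith
      obtain ⟨t, ht⟩ := hit_one (n := 2*m) (α := ((2*m:ℕ):ℝ) - w^2 * z) (R := w^2) (R' := R') hσ hR
        (by push_cast; nlinarith) hy
        (by rw [pp_eq]; simp only; rw [hz]; field_simp) hα0
        (by refine le_trans ?_ hR'
            have : 2 * ((((2*m:ℕ):ℝ) - w^2 * z) + σ)/w^2 ≤ 2 * ((20 * w + 100 * H * w) + σ)/w^2 :=
              div_le_div_of_nonneg_right (by linarith) hR.le
            linarith)
      exact ⟨t, fun _ => ht⟩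
    · exact ⟨0, fun h => absurd h hj⟩
  choose f hf using ex
  refine ⟨(fun j : ℕ => (((2*(k-j) : ℕ):ℤ), f j)) '' (Finset.range H : Set ℕ), ?_, ?_⟩
  · rintro q ⟨j, hj, rfl⟩
    have hj' : j < H := by simpa using hj
    exact hf j hj'
  · rw [Set.InjOn.ncard_image]
    · rw [Set.ncard_coe_finset, Finset.card_range]
    · intro i hi j hj e
      have hi' : i < H := by simpa using hi
      have hj' : j < H := by simpa using hj
      simp only [Prod.mk.injEq] at e
      have := e.1
      have h2 : 2 * (k - i) = 2 * (k - j) := by exact_mod_cast this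
      omega


set_option maxHeartbeats 800000 in
theorem count_r {σ : ℝ} (hσ : 0 < σ) : ∃ r0 : ℝ, 1 ≤ r0 ∧ ∀ r : ℝ, r0 ≤ r →
    (NSle (r^14)).ncard ≤ (RSle σ (√(r^28 + r^9))).ncard := by
  set K := 3*σ+1 with hK
  have hK1 : 1 ≤ K := by linarith
  refine ⟨12000*K*(σ+2), by nlinarith [mul_nonneg (by linarith : (0:ℝ) ≤ K) hσ.le], ?_⟩
  intro r hr
  have hKσ := mul_nonneg (by linarith : (0:ℝ) ≤ K) hσ.le
  have hrK : 24000*K ≤ r := by nlinarith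
  have hrσ : 12000*σ ≤ r := by nlinarith
  have hr1 : 24000 ≤ r := by nlinarith
  have hr0 : 0 < r := by linarith
  have r1 : 1 ≤ r := by linarith
  have p2 : 1 ≤ r^2 := one_le_pow₀ r1
  have p4 : 1 ≤ r^4 := one_le_pow₀ r1
  have p9 : 1 ≤ r^9 := one_le_pow₀ r1
  have hRpos : 0 < r^14 := by positivity
  set R' := √(r^28 + r^9) with hR'
  have hsq : R'^2 = r^28 + r^9 := Real.sq_sqrt (by positivity)
  have hR'0 : 0 ≤ R' := Real.sqrt_nonneg _
  have h928 : r^9 ≤ r^28 := pow_le_pow_right₀ r1 (by norm_num)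
  have hR'2 : R' ≤ 2*r^14 := by
    apply Real.sqrt_le_iff.2
    refine ⟨by positivity, ?_⟩
    have : (2*r^14)^2 = 4*r^28 := by ring
    rw [this]; nlinarith [pow_pos hr0 28]
  have hRR : r^14 < R' := by
    apply Real.lt_sqrt_of_sq_lt
    have : (r^14)^2 = r^28 := by ring
    rw [this]; linarith
  have hgap3 : r^9 ≤ 3*r^14*(R' - r^14) := by
    have : (R' - r^14)*(R'+r^14) = r^9 := by ring_nf; rw [hsq]; ring
    nlinarith [mul_nonneg (sub_nonneg.2 hRR.le) (sub_nonneg.2 hR'2)]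
  have hgap5 : 1 ≤ 3*r^5*(R' - r^14) := by
    have e : r^9*(3*r^5*(R'-r^14)) = 3*r^14*(R'-r^14) := by ring
    by_contra hc
    push Not at hc
    nlinarith [mul_lt_mul_of_pos_left hc (by positivity : 0 < r^9)]
  set J := ⌊r^4⌋₊ with hJdef
  have hJle : (J:ℝ) ≤ r^4 := Nat.floor_le (by positivity)
  have hJge : r^4/2 ≤ J := by
    have := Nat.lt_floor_add_one (r^4)
    have h4 : r ≤ r^4 := le_self_pow₀ r1 (by norm_num)
    rw [← hJdef] at this
    linarith
  have hJ0 : 0 < J := Nat.floor_pos.2 p4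
  have hJR : (0:ℝ) < J := by exact_mod_cast hJ0
  have hK0 : 0 < K := by linarith
  have h45 : r^4 ≤ r^5 := pow_le_pow_right₀ r1 (by norm_num)
  have p5 : 1 ≤ r^5 := one_le_pow₀ r1
  have hKr5 : r^5 ≤ K*r^5 := by nlinarith
  have rr9 : r ≤ r^9 := le_self_pow₀ r1 (by norm_num)
  have hb := bad_card (σ := σ) (R := r^14) (R' := R') (D := K*r^5) (J := J) hσ hRR hJ0
    (by linarith)
    (by
      have : r^14 = r^9*r^5 := by ring
      rw [this, ← mul_assoc]
      exact mul_le_mul_of_nonneg_right (by linarith) (by linarith))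
    (by linarith)
    (by
      have a1 : 11*(K*r^5)*J ≤ 11*K*r^9 := by
        have := mul_le_mul_of_nonneg_left hJle (by positivity : 0 ≤ 11*(K*r^5))
        calc _ ≤ _ := this
          _ = _ := by ring
      have a2 : σ ≤ K*r^9 := by nlinarith
      have a3 : (σ+11*(K*r^5)*J)^2 ≤ (12*K*r^9)^2 := by
        apply pow_le_pow_left₀ (by positivity); linarith
      refine a3.trans ?_
      have : (12*K*r^9)^2 = (144*K)*(K*r^18) := by ring
      rw [this]
      have : r^14*(K*r^5) = r*(K*r^18) := by ring
      rw [this]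
      exact mul_le_mul_of_nonneg_right (by linarith) (by positivity))
    (by
      have : K*r^5*(R'-r^14) = K/3*(3*r^5*(R'-r^14)) := by ring
      rw [this]
      nlinarith)
  set H := (Bad σ (r^14) R').ncard with hHdef
  have hHr : (H:ℝ) ≤ r^2/1500 := by
    have h1 : (H:ℝ) ≤ 2*(((⌈σ⌉₊:ℕ)+1)*(((⌊K*r^5⌋₊/J : ℕ):ℝ)+2)) := by exact_mod_cast hb
    have h2 : ((⌊K*r^5⌋₊/J : ℕ):ℝ) ≤ 2*K*r := by
      refine Nat.cast_div_le.trans ?_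
      rw [div_le_iff₀ hJR]
      refine (Nat.floor_le (by positivity)).trans ?_
      have := mul_le_mul_of_nonneg_left hJge (by positivity : 0 ≤ 2*K*r)
      calc _ = 2*K*r*(r^4/2) := by ring
        _ ≤ _ := this
    have h3 : ((⌈σ⌉₊:ℕ):ℝ) ≤ σ+1 := (Nat.ceil_lt_add_one hσ.le).le
    have h4 : 2*(((⌈σ⌉₊:ℕ)+1)*(((⌊K*r^5⌋₊/J : ℕ):ℝ)+2)) ≤ 2*((σ+2)*(2*K*r+2)) := by
      have g1 : ((⌈σ⌉₊:ℕ):ℝ)+1 ≤ σ+2 := by linarith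
      have g2 : ((⌊K*r^5⌋₊/J : ℕ):ℝ)+2 ≤ 2*K*r+2 := by linarith
      have := mul_le_mul g1 g2 (by positivity) (by linarith)
      linarith
    have h5 : 2*((σ+2)*(2*K*r+2)) ≤ 8*K*(σ+2)*r := by
      have : 2 ≤ 2*K*r := by nlinarith
      nlinarith
    have h6 : 8*K*(σ+2)*r ≤ r^2/1500 := by nlinarith
    linarith
  have hr27 : r^2 ≤ r^7 := pow_le_pow_right₀ r1 (by norm_num)
  have hr17 : r ≤ r^7 := le_self_pow₀ r1 (by norm_num)
  obtain ⟨Hs, q1, q2⟩ := hits_exist (σ := σ) (w := r^7) (R' := R') hσ (by linarith) H (by linarith)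
    (by
      have e : (r^7)^2 = r^14 := by ring
      rw [e]
      have : 2*((20*r^7+100*H*r^7)+σ)/r^14 ≤ R' - r^14 := by
        rw [div_le_iff₀ hRpos]
        have b1 : 100*H*r^7 ≤ r^9/15 := by
          have := mul_le_mul_of_nonneg_right hHr (by positivity : 0 ≤ 100*r^7)
          calc _ = (H:ℝ)*(100*r^7) := by ring
            _ ≤ _ := this
            _ = _ := by ring
        have b2 : 24000*r^7 ≤ r^9 := by
          have : r^9 = r^2*r^7 := by ring
          rw [this]
          exact mul_le_mul_of_nonneg_right (hr1.trans (le_self_pow₀ r1 (by norm_num))) (by positivity)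
        have b3 : (R' - r^14)*r^14*3 = 3*r^14*(R'-r^14) := by ring
        linarith
      linarith)
  have e : (r^7)^2 = r^14 := by ring
  rw [e] at q1
  exact count_le hσ Hs q1 (by rw [q2])

theorem count_x {σ : ℝ} (hσ : 0 < σ) : ∃ x0 : ℝ, 1 ≤ x0 ∧ ∀ x : ℝ, x0 ≤ x →
    diskNeumannCount x ≤ diskRobinCount σ (x + x^((9:ℝ)/28)) := by
  obtain ⟨r0, h1, h⟩ := count_r hσ
  refine ⟨r0^28, one_le_pow₀ h1, fun x hx => ?_⟩
  have hx0 : 0 ≤ x := le_trans (by positivity) hx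
  set r := x^((1:ℝ)/28) with hr
  have hrn : 0 ≤ r := Real.rpow_nonneg hx0 _
  have e28 : r^28 = x := by
    rw [hr, ← Real.rpow_natCast, ← Real.rpow_mul hx0]; norm_num
  have e9 : x^((9:ℝ)/28) = r^9 := by
    rw [hr, ← Real.rpow_natCast, ← Real.rpow_mul hx0]; norm_num
  have e14 : √x = r^14 := by
    rw [← e28, show r^28 = (r^14)^2 by ring, Real.sqrt_sq (by positivity)]
  have hr0 : r0 ≤ r := by
    rw [← e28] at hx
    exact le_of_pow_le_pow_left₀ (by norm_num) hrn hx
  rw [neumann_count, robin_count, e14, e9, ← e28]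
  exact h r hr0


theorem weyl_low (M : ℕ) (hM : 1 ≤ M) : M*M ≤ (NSle (32*(M:ℝ))).ncard := by
  have hMR : (1:ℝ) ≤ M := by exact_mod_cast hM
  have ex : ∀ p : ℕ × ℕ, ∃ t, p ∈ Finset.range M ×ˢ Finset.range M →
      t ∈ Set.Ioo (16*(M:ℝ)+8*p.2) (16*(M:ℝ)+8*p.2+8) ∧ pp p.1 t = 0 := by
    intro p
    by_cases hp : p ∈ Finset.range M ×ˢ Finset.range M
    · rw [Finset.mem_product, Finset.mem_range, Finset.mem_range] at hp
      have h1 : (p.1:ℝ) ≤ M := by exact_mod_cast hp.1.le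
      have h2 : (0:ℝ) ≤ p.2 := by positivity
      obtain ⟨t, a, b⟩ := (bj_sys p.1).osc (a := 16*(M:ℝ)+8*p.2) (by linarith) (by linarith)
      exact ⟨t, fun _ => ⟨a, b⟩⟩
    · exact ⟨0, fun h => absurd h hp⟩
  choose f hf using ex
  have hinj : Set.InjOn (fun p : ℕ × ℕ => ((p.1:ℤ), f p)) (Finset.range M ×ˢ Finset.range M : Finset (ℕ × ℕ)) := by
    rintro ⟨i, j⟩ hp ⟨i', j'⟩ hq e
    obtain ⟨⟨a1, a2⟩, -⟩ := hf _ (Finset.mem_coe.1 hp)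
    obtain ⟨⟨b1, b2⟩, -⟩ := hf _ (Finset.mem_coe.1 hq)
    simp only [Prod.mk.injEq] at e a1 a2 b1 b2
    obtain ⟨e1, e2⟩ := e
    have e1' : i = i' := by exact_mod_cast e1
    rw [e2] at a1 a2
    have c1 : (j:ℝ) < j'+1 := by linarith
    have c2 : (j':ℝ) < j+1 := by linarith
    have c1' : j < j'+1 := by exact_mod_cast c1
    have c2' : j' < j+1 := by exact_mod_cast c2
    rw [e1', show j = j' by omega]
  have hc : ((fun p : ℕ × ℕ => ((p.1:ℤ), f p)) '' (Finset.range M ×ˢ Finset.range M : Finset (ℕ × ℕ))).ncard = M*M := by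
    rw [hinj.ncard_image, Set.ncard_coe_finset, Finset.card_product, Finset.card_range]
  rw [← hc]
  refine Set.ncard_le_ncard ?_ (NSle_fin _)
  rintro q ⟨p, hp, rfl⟩
  have hp' := Finset.mem_coe.1 hp
  obtain ⟨⟨a1, a2⟩, a3⟩ := hf p hp'
  rw [Finset.mem_product, Finset.mem_range, Finset.mem_range] at hp'
  have h2 : (0:ℝ) ≤ p.2 := by positivity
  have h3 : (p.2:ℝ) + 1 ≤ M := by exact_mod_cast hp'.2
  have ht : 0 < f p := by linarith
  exact ⟨ht.le, by show f p ≤ _; linarith, a3, fun h0 => bj_nd p.1 (f p) ht h0 a3⟩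

theorem neumann_mono {x y : ℝ} (h : x ≤ y) : diskNeumannCount x ≤ diskNeumannCount y := by
  rw [neumann_count, neumann_count]
  refine Set.ncard_le_ncard ?_ (NSle_fin _)
  rintro q ⟨a, b, c⟩
  exact ⟨a, b.trans (Real.sqrt_le_sqrt h), c⟩

theorem neumann_low (n : ℕ) (hn : 1 ≤ n) : n + 1 ≤ diskNeumannCount (4096*(n:ℝ)) := by
  have hs : 1 ≤ Nat.sqrt n := Nat.sqrt_pos.2 hn
  have h1 : Nat.sqrt n * Nat.sqrt n ≤ n := Nat.sqrt_le n
  have h2 := Nat.lt_succ_sqrt n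
  set M := Nat.sqrt n + 1 with hM
  have h3 : n + 1 ≤ M*M := h2
  have h4 : M*M ≤ 4*n := by nlinarith
  have h4R : (M:ℝ)*M ≤ 4*n := by exact_mod_cast h4
  refine h3.trans ((weyl_low M (by omega)).trans ?_)
  have e : (32*(M:ℝ)) = √((32*(M:ℝ))^2) := (Real.sqrt_sq (by positivity)).symm
  rw [e, ← neumann_count]
  apply neumann_mono
  nlinarith

/-- Fix `σ > 0` and `δ = 1/990`. The Robin–Neumann gaps of the unit disk satisfy
`|λ_n^σ − λ_n^0| ≤ C n^{1/3−δ}` for all `n ≥ 1`. -/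
theorem disk_RN_gap_upper_bound (σ : ℝ) (hσ : 0 < σ) :
    ∃ C : ℝ, 0 < C ∧ ∀ n : ℕ, 1 ≤ n →
      |diskRobinEig σ n - diskNeumannEig n| ≤ C * (n : ℝ) ^ ((1:ℝ)/3 - 1/990) := by
  obtain ⟨x0, hx0, hx⟩ := count_x hσ
  refine ⟨(1+x0) + (4097+x0), by linarith, fun n hn => ?_⟩
  have hnR : (1:ℝ) ≤ n := by exact_mod_cast hn
  set SN := {x : ℝ | 0 ≤ x ∧ n + 1 ≤ diskNeumannCount x} with hSN
  set SR := {x : ℝ | 0 ≤ x ∧ n + 1 ≤ diskRobinCount σ x} with hSR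
  have eN : diskNeumannEig n = sInf SN := rfl
  have eR : diskRobinEig σ n = sInf SR := rfl
  have bN : BddBelow SN := ⟨0, fun x h => h.1⟩
  have bR : BddBelow SR := ⟨0, fun x h => h.1⟩
  have mem0 : 4096*(n:ℝ) ∈ SN := ⟨by positivity, neumann_low n hn⟩
  have hle0 : diskNeumannEig n ≤ 4096*n := by rw [eN]; exact csInf_le bN mem0
  obtain ⟨x, hxS, hxlt⟩ := exists_lt_of_csInf_lt ⟨_, mem0⟩ (lt_add_one (sInf SN))
  rw [← eN] at hxlt
  have hx00 : 0 ≤ x := hxS.1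
  have memR : (x+x0) + (x+x0)^((9:ℝ)/28) ∈ SR := by
    refine ⟨by positivity, ?_⟩
    exact hxS.2.trans ((neumann_mono (by linarith)).trans (hx (x+x0) (by linarith)))
  have hR : diskRobinEig σ n ≤ (x+x0) + (x+x0)^((9:ℝ)/28) := by rw [eR]; exact csInf_le bR memR
  have hNR : diskNeumannEig n ≤ diskRobinEig σ n := by
    rw [eN, eR]
    exact csInf_le_csInf bN ⟨_, memR⟩ (fun y hy => ⟨hy.1, hy.2.trans (robin_le_neumann hσ y)⟩)
  rw [abs_of_nonneg (by linarith)]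
  have hA : x + x0 ≤ (4097+x0)*n := by nlinarith
  have h1 : (x+x0)^((9:ℝ)/28) ≤ (4097+x0) * (n:ℝ)^((1:ℝ)/3-1/990) := by
    calc (x+x0)^((9:ℝ)/28) ≤ ((4097+x0)*n)^((9:ℝ)/28) :=
          Real.rpow_le_rpow (by linarith) hA (by norm_num)
      _ = (4097+x0)^((9:ℝ)/28) * (n:ℝ)^((9:ℝ)/28) := Real.mul_rpow (by linarith) (by linarith)
      _ ≤ (4097+x0) * (n:ℝ)^((1:ℝ)/3-1/990) := by
          apply mul_le_mul _ _ (by positivity) (by linarith)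
          · calc (4097+x0)^((9:ℝ)/28) ≤ (4097+x0)^(1:ℝ) :=
                  Real.rpow_le_rpow_of_exponent_le (by linarith) (by norm_num)
              _ = _ := Real.rpow_one _
          · exact Real.rpow_le_rpow_of_exponent_le hnR (by norm_num)
  have h2 : 1 ≤ (n:ℝ)^((1:ℝ)/3-1/990) := Real.one_le_rpow hnR (by norm_num)
  nlinarith
end

section
/- Let σ > 0. For every integer n ≥ 0 there exists exactly one k in the open interval (nπ, (n+1)π) satisfying the secular equation (k² − σ²)·sin k = 2σ·k·cos k. -/
open Real

lemma secular_key (σ : ℝ) (hσ : 0 < σ) (k : ℝ) :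
    (k ^ 2 - σ ^ 2) * Real.sin k = 2 * σ * k * Real.cos k ↔
      Real.sin (k + 2 * arctan (k / σ)) = 0 := by
  have hc : 0 < cos (arctan (k / σ)) := cos_arctan_pos _
  have ht : σ * sin (arctan (k / σ)) = k * cos (arctan (k / σ)) := by
    have h := tan_arctan (k / σ)
    rw [tan_eq_sin_div_cos, div_eq_div_iff hc.ne' hσ.ne'] at h
    linarith
  have h1 := sin_sq_add_cos_sq (arctan (k / σ))
  rw [sin_add, sin_two_mul, cos_two_mul']
  generalize sin (arctan (k / σ)) = s at *
  generalize cos (arctan (k / σ)) = c at *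
  have hs : s = k * c / σ := by field_simp; linarith
  have e : σ ^ 2 * (sin k * (c ^ 2 - s ^ 2) + cos k * (2 * s * c)) =
      c ^ 2 * (2 * σ * k * cos k - (k ^ 2 - σ ^ 2) * sin k) := by
    rw [hs]; field_simp; ring
  constructor
  · intro h
    rw [h, sub_self, mul_zero] at e
    exact (mul_eq_zero.mp e).resolve_left (by positivity)
  · intro h
    rw [h, mul_zero] at e
    have := (mul_eq_zero.mp e.symm).resolve_left (by positivity)
    linarith

/-- For every `σ > 0` and integer `n ≥ 0` there is exactly one solution `k` in the open
interval `(nπ, (n+1)π)` of the secular equation `(k² − σ²)·sin k = 2σ·k·cos k`. -/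
theorem robin_secular_unique_root (σ : ℝ) (hσ : 0 < σ) (n : ℕ) :
    ∃! k : ℝ, k ∈ Set.Ioo ((n : ℝ) * π) (((n : ℝ) + 1) * π) ∧
      (k ^ 2 - σ ^ 2) * Real.sin k = 2 * σ * k * Real.cos k := by
  have hpi := pi_pos
  have hn : (0 : ℝ) ≤ n := Nat.cast_nonneg n
  have hmono : StrictMono (fun k : ℝ => k + 2 * arctan (k / σ)) := by
    intro a b hab
    have : arctan (a / σ) < arctan (b / σ) := arctan_strictMono (by gcongr)
    simp only
    linarith
  have hcont : Continuous (fun k : ℝ => k + 2 * arctan (k / σ)) := by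
    have : Continuous (fun k : ℝ => arctan (k / σ)) :=
      continuous_arctan.comp (continuous_id.div_const σ)
    fun_prop
  have hpos : ∀ k : ℝ, 0 < k → 0 < arctan (k / σ) := fun k hk => by
    rw [← arctan_zero]; exact arctan_strictMono (by positivity)
  have hmem : ((n : ℝ) + 1) * π ∈ Set.Ioo ((fun k : ℝ => k + 2 * arctan (k / σ)) (n * π))
      ((fun k : ℝ => k + 2 * arctan (k / σ)) (((n : ℝ) + 1) * π)) := by
    constructor
    · have := arctan_lt_pi_div_two (n * π / σ)
      simp only; linarith
    · have := hpos (((n : ℝ) + 1) * π) (by positivity)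
      simp only; linarith
  obtain ⟨k, hk, hk2⟩ := intermediate_value_Ioo (by linarith) hcont.continuousOn hmem
  refine ⟨k, ⟨hk, (secular_key σ hσ k).2 ?_⟩, ?_⟩
  · simp only at hk2
    rw [hk2]
    exact_mod_cast sin_nat_mul_pi (n + 1)
  · rintro y ⟨⟨hy1, hy2⟩, hy⟩
    obtain ⟨m, hm⟩ := sin_eq_zero_iff.mp ((secular_key σ hσ y).1 hy)
    have h0 := hpos y (lt_of_le_of_lt (by positivity) hy1)
    have h3 := arctan_lt_pi_div_two (y / σ)
    have a1 : (n : ℝ) < m := by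
      refine lt_of_mul_lt_mul_right ?_ hpi.le
      linarith
    have a2 : (m : ℝ) < n + 2 := by
      refine lt_of_mul_lt_mul_right ?_ hpi.le
      linarith
    have b1 : (n : ℤ) < m := by exact_mod_cast a1
    have b2 : m < (n : ℤ) + 2 := by exact_mod_cast a2
    have hmn : m = (n : ℤ) + 1 := by omega
    apply hmono.injective
    rw [hk2]
    simp only
    rw [← hm, hmn]
    push_cast
    ring
end

section
/- Fix σ > 0. Then k_n(σ)² − n²π² → 4σ as n → ∞. Equivalently, if for each integer n ≥ 0 the number k_n ∈ (nπ, (n+1)π) satisfies (k_n² − σ²)·sin k_n = 2σ·k_n·cos k_n, then the sequence k_n² − n²π² converges to 4σ. -/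
open Real

lemma robin_aux (σ : ℝ) (hσ : 0 < σ) (k : ℝ) (n : ℕ)
    (h1 : (n : ℝ) * π < k) (h2 : k < ((n : ℝ) + 1) * π)
    (h : (k ^ 2 - σ ^ 2) * Real.sin k = 2 * σ * k * Real.cos k) :
    k - n * π = 2 * Real.arctan (σ * k⁻¹) := by
  have hpi := Real.pi_pos
  have hk0 : 0 < k := lt_of_le_of_lt (by positivity) h1
  obtain ⟨e, he⟩ : ∃ e, e = (k - n * π) / 2 := ⟨_, rfl⟩
  have hke : k = 2 * e + n * π := by rw [he]; ring
  have he0 : 0 < e := by rw [he]; linarith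
  have he1 : e < π / 2 := by rw [he]; linarith
  have hs : 0 < Real.sin e := Real.sin_pos_of_pos_of_lt_pi he0 (by linarith)
  have hc : 0 < Real.cos e := Real.cos_pos_of_mem_Ioo ⟨by linarith, he1⟩
  have hsin : Real.sin k = (-1) ^ n * (2 * Real.sin e * Real.cos e) := by
    rw [hke, Real.sin_add_nat_mul_pi, Real.sin_two_mul]
  have hcos : Real.cos k = (-1) ^ n * (Real.cos e ^ 2 - Real.sin e ^ 2) := by
    rw [hke, Real.cos_add_nat_mul_pi, Real.cos_two_mul']
  rw [hsin, hcos] at h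
  have hn : ((-1 : ℝ)) ^ n ≠ 0 := pow_ne_zero _ (by norm_num)
  have h3 : (k * Real.sin e - σ * Real.cos e) * (k * Real.cos e + σ * Real.sin e) = 0 := by
    apply mul_left_cancel₀ hn
    linear_combination h / 2
  have h4 : k * Real.sin e - σ * Real.cos e = 0 := by
    rcases mul_eq_zero.mp h3 with h | h
    · exact h
    · have : 0 < k * Real.cos e + σ * Real.sin e := by positivity
      linarith
  have h5 : Real.tan e = σ * k⁻¹ := by
    rw [Real.tan_eq_sin_div_cos]
    field_simp
    linarith
  rw [← h5, Real.arctan_tan (by linarith) he1, he]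
  ring

/-- Fix `σ > 0`. If for each integer `n ≥ 0` the number `k n ∈ (nπ, (n+1)π)` satisfies the
secular equation `(k² − σ²)·sin k = 2σ·k·cos k`, then `k n ² − n²π² → 4σ` as `n → ∞`. -/
theorem robin_interval_gap_tendsto (σ : ℝ) (hσ : 0 < σ) (k : ℕ → ℝ)
    (hk : ∀ n : ℕ, k n ∈ Set.Ioo ((n : ℝ) * π) (((n : ℝ) + 1) * π) ∧
      ((k n) ^ 2 - σ ^ 2) * Real.sin (k n) = 2 * σ * (k n) * Real.cos (k n)) :
    Filter.Tendsto (fun n : ℕ => (k n) ^ 2 - ((n : ℝ) * π) ^ 2)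
      Filter.atTop (nhds (4 * σ)) := by
  have hd : ∀ n : ℕ, k n - n * π = 2 * Real.arctan (σ * (k n)⁻¹) := fun n =>
    robin_aux σ hσ (k n) n (hk n).1.1 (hk n).1.2 (hk n).2
  have hpos : ∀ n : ℕ, 0 < k n := fun n =>
    lt_of_le_of_lt (by positivity) (hk n).1.1
  have htop : Filter.Tendsto k Filter.atTop Filter.atTop :=
    Filter.tendsto_atTop_mono (fun n => (hk n).1.1.le)
      (tendsto_natCast_atTop_atTop.atTop_mul_const Real.pi_pos)
  have hinv : Filter.Tendsto (fun n => (k n)⁻¹) Filter.atTop (nhds 0) :=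
    tendsto_inv_atTop_zero.comp htop
  have hinv' : Filter.Tendsto (fun n => (k n)⁻¹) Filter.atTop (nhdsWithin 0 {0}ᶜ) :=
    tendsto_nhdsWithin_iff.mpr ⟨hinv, Filter.Eventually.of_forall fun n =>
      inv_ne_zero (hpos n).ne'⟩
  have hder : HasDerivAt (fun y : ℝ => Real.arctan (σ * y)) σ 0 := by
    have h := ((hasDerivAt_id (0 : ℝ)).const_mul σ).arctan
    simpa using h
  have hlim : Filter.Tendsto (fun n => k n * Real.arctan (σ * (k n)⁻¹))
      Filter.atTop (nhds σ) := by
    have h := hder.tendsto_slope_zero.comp hinv'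
    simpa [Function.comp_def] using h
  have hlim0 : Filter.Tendsto (fun n => Real.arctan (σ * (k n)⁻¹))
      Filter.atTop (nhds 0) := by
    have h := hder.continuousAt.tendsto.comp hinv
    simpa [Function.comp_def] using h
  have hfin := (hlim.const_mul 4).sub ((hlim0.pow 2).const_mul 4)
  have e : 4 * σ - 4 * (0 : ℝ) ^ 2 = 4 * σ := by ring
  rw [e] at hfin
  refine hfin.congr fun n => ?_
  have h := hd n
  have h' : (n : ℝ) * π = k n - 2 * Real.arctan (σ * (k n)⁻¹) := by linarith
  rw [h']
  ring
end

section
/- For every σ > 0 there exists a constant C(σ) > 0 such that for all integers n ≥ 0, 0 < k_n(σ)² − n²π² ≤ C(σ). -/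
open Real

/-- For every `σ > 0` there is a constant `C(σ) > 0` such that for all integers `n ≥ 0`,
`0 < k_n(σ)² − n²π² ≤ C(σ)`, where `k_n(σ) ∈ (nπ, (n+1)π)` solves the secular equation. -/
theorem robin_interval_gap_bounded (σ : ℝ) (hσ : 0 < σ) (k : ℕ → ℝ)
    (hk : ∀ n : ℕ, k n ∈ Set.Ioo ((n : ℝ) * π) (((n : ℝ) + 1) * π) ∧
      ((k n) ^ 2 - σ ^ 2) * Real.sin (k n) = 2 * σ * (k n) * Real.cos (k n)) :
    ∃ C : ℝ, 0 < C ∧ ∀ n : ℕ,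
      0 < (k n) ^ 2 - ((n : ℝ) * π) ^ 2 ∧ (k n) ^ 2 - ((n : ℝ) * π) ^ 2 ≤ C := by
  have hpi := Real.pi_pos
  refine ⟨4 * σ ^ 2 + 4 * π * σ, by positivity, fun n => ?_⟩
  obtain ⟨⟨h1, h2⟩, h3⟩ := hk n
  generalize k n = x at h1 h2 h3 ⊢
  have hn : (0 : ℝ) ≤ (n : ℝ) * π := by positivity
  have hx : 0 < x := lt_of_le_of_lt hn h1
  refine ⟨by nlinarith, ?_⟩
  have hpσ : 0 < π * σ := by positivity
  by_cases hc : x ≤ 2 * σ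
  · nlinarith [sq_nonneg ((n : ℝ) * π)]
  push Not at hc
  obtain ⟨d, hd⟩ : ∃ d, d = x - n * π := ⟨_, rfl⟩
  have hxd : x = d + n * π := by linarith
  have hd0 : 0 < d := by linarith
  have hdpi : d < π := by linarith
  have heq : (x ^ 2 - σ ^ 2) * Real.sin d = 2 * σ * x * Real.cos d := by
    have hs : Real.sin x = (-1) ^ n * Real.sin d := by rw [hxd, Real.sin_add_nat_mul_pi]
    have hcs : Real.cos x = (-1) ^ n * Real.cos d := by rw [hxd, Real.cos_add_nat_mul_pi]
    rw [hs, hcs] at h3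
    have hne : ((-1 : ℝ)) ^ n ≠ 0 := pow_ne_zero _ (by norm_num)
    apply mul_left_cancel₀ hne
    linarith
  have hsin : 0 < Real.sin d := Real.sin_pos_of_pos_of_lt_pi hd0 hdpi
  have hq : 3 / 4 * x ^ 2 ≤ x ^ 2 - σ ^ 2 := by nlinarith
  have hcos : 0 < Real.cos d := by
    have h4 : 0 < 2 * σ * x * Real.cos d := by
      rw [← heq]
      exact mul_pos (by nlinarith [pow_pos hx 2]) hsin
    exact (pos_iff_pos_of_mul_pos h4).1 (by positivity)
  have hd2 : d ≤ π / 2 := by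
    by_contra h
    push Not at h
    have := Real.cos_nonpos_of_pi_div_two_le_of_le h.le (by linarith)
    linarith
  have hj : 2 / π * d ≤ Real.sin d := Real.mul_le_sin hd0.le hd2
  have h5 : 3 / 4 * x ^ 2 * (2 / π * d) ≤ 2 * σ * x := by
    calc 3 / 4 * x ^ 2 * (2 / π * d) ≤ (x ^ 2 - σ ^ 2) * Real.sin d := by
          apply mul_le_mul hq hj (by positivity)
          nlinarith [pow_pos hx 2]
      _ = 2 * σ * x * Real.cos d := heq
      _ ≤ 2 * σ * x * 1 := mul_le_mul_of_nonneg_left (Real.cos_le_one d) (by positivity)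
      _ = _ := mul_one _
  have h6 : 3 * (x * d) ≤ 4 * (π * σ) := by
    have h7 : 3 / 4 * x ^ 2 * (2 / π * d) = x * (3 * (x * d) / (2 * π)) := by
      field_simp
      ring
    rw [h7, mul_comm (2 * σ) x] at h5
    have h8 := le_of_mul_le_mul_left h5 hx
    rw [div_le_iff₀ (by positivity)] at h8
    linarith
  have h9 : x ^ 2 - (n * π) ^ 2 ≤ 2 * (x * d) := by
    rw [hd]
    nlinarith [sq_nonneg (x - n * π)]
  nlinarith [sq_nonneg σ]
end

section
/- Let 0 < L ≤ 1 and σ > 0. Then there exists a constant C_L(σ) > 0 such that for all integers n,m ≥ 0, 0 < Λ_{n,m}(σ) − Λ_{n,m}(0) ≤ C_L(σ). -/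
open Real

theorem RN_aux (τ x : ℝ) (n : ℕ) (hτ : 0 < τ)
    (hx : x ∈ Set.Ioo ((n : ℝ) * π) (((n : ℝ) + 1) * π))
    (h : (x ^ 2 - τ ^ 2) * Real.sin x = 2 * τ * x * Real.cos x) :
    0 < x ^ 2 - ((n : ℝ) * π) ^ 2 ∧
      x ^ 2 - ((n : ℝ) * π) ^ 2 ≤ 4 * τ ^ 2 + 4 * π * τ := by
  have hpi := Real.pi_pos
  obtain ⟨h1, h2⟩ := hx
  have hn : 0 ≤ (n : ℝ) * π := by positivity
  have hx0 : 0 < x := by linarith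
  refine ⟨by nlinarith, ?_⟩
  obtain ⟨d, hd⟩ : ∃ d, x = d + (n : ℝ) * π := ⟨x - n * π, by ring⟩
  have hd0 : 0 < d := by linarith
  have hdpi : d < π := by linarith
  have h' : (x ^ 2 - τ ^ 2) * Real.sin d = 2 * τ * x * Real.cos d := by
    have hs : Real.sin x = (-1) ^ n * Real.sin d := by rw [hd, Real.sin_add_nat_mul_pi]
    have hc : Real.cos x = (-1) ^ n * Real.cos d := by rw [hd, Real.cos_add_nat_mul_pi]
    rw [hs, hc] at h
    have hne : ((-1 : ℝ)) ^ n ≠ 0 := by simp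
    apply mul_left_cancel₀ hne
    linarith
  have hsin : 0 < Real.sin d := Real.sin_pos_of_pos_of_lt_pi hd0 hdpi
  rcases le_or_gt x (2 * τ) with hc | hc
  · have : 0 < π * τ := by positivity
    nlinarith [sq_nonneg ((n : ℝ) * π)]
  · have hq : 3 * x ^ 2 ≤ 4 * (x ^ 2 - τ ^ 2) := by nlinarith
    have hpos : 0 < x ^ 2 - τ ^ 2 := by nlinarith
    have hcos : 0 < Real.cos d := by
      have h3 : 0 < 2 * τ * x * Real.cos d := by rw [← h']; positivity
      exact (pos_iff_pos_of_mul_pos h3).1 (by positivity)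
    have hd2 : d ≤ π / 2 := by
      by_contra hcon
      push Not at hcon
      have := Real.cos_nonpos_of_pi_div_two_le_of_le hcon.le (by linarith)
      linarith
    have hj := Real.mul_le_sin hd0.le hd2
    have hj' : 2 * d ≤ π * Real.sin d := by
      have := mul_le_mul_of_nonneg_left hj hpi.le
      have e : π * (2 / π * d) = 2 * d := by field_simp
      linarith
    have hs : 3 * x ^ 2 * Real.sin d ≤ 8 * τ * x := by
      have a := mul_le_mul_of_nonneg_right hq hsin.le
      have b : 2 * τ * x * Real.cos d ≤ 2 * τ * x * 1 :=
        mul_le_mul_of_nonneg_left (Real.cos_le_one d) (by positivity)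
      linarith
    have hs2 : 3 * x * Real.sin d ≤ 8 * τ := by
      apply le_of_mul_le_mul_right _ hx0
      linarith
    have hxd : 6 * (x * d) ≤ 8 * τ * π := by
      have a := mul_le_mul_of_nonneg_left hj' (by positivity : 0 ≤ 3 * x)
      have b := mul_le_mul_of_nonneg_right hs2 hpi.le
      linarith
    have e : x ^ 2 - ((n : ℝ) * π) ^ 2 = 2 * (x * d) - d ^ 2 := by rw [hd]; ring
    have : 0 < π * τ := by positivity
    nlinarith [sq_nonneg d, sq_nonneg τ]

/-- Let `0 < L ≤ 1`, `σ > 0`. For each Robin parameter `τ ≥ 0`, `k τ n` denotes the unique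
solution in `(nπ, (n+1)π)` of the secular equation with parameter `τ` (and `k 0 n = nπ`),
and `Λ_{n,m}(τ) = k_n(τ)² + L⁻²·k_m(τL)²` are the Robin eigenvalues of the rectangle
`[0,1]×[0,L]`. Then there is `C_L(σ) > 0` with `0 < Λ_{n,m}(σ) − Λ_{n,m}(0) ≤ C_L(σ)`
for all `n, m ≥ 0`. -/
theorem rectangle_RN_gap_bounded (L σ : ℝ) (hL : 0 < L) (hL1 : L ≤ 1) (hσ : 0 < σ)
    (k : ℝ → ℕ → ℝ)
    (hk : ∀ τ : ℝ, 0 < τ → ∀ n : ℕ,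
      k τ n ∈ Set.Ioo ((n : ℝ) * π) (((n : ℝ) + 1) * π) ∧
      ((k τ n) ^ 2 - τ ^ 2) * Real.sin (k τ n) = 2 * τ * (k τ n) * Real.cos (k τ n))
    (hk0 : ∀ n : ℕ, k 0 n = (n : ℝ) * π)
    (Λ : ℝ → ℕ → ℕ → ℝ)
    (hΛ : ∀ τ : ℝ, ∀ n m : ℕ, Λ τ n m = (k τ n) ^ 2 + L⁻¹ ^ 2 * (k (τ * L) m) ^ 2) :
    ∃ C : ℝ, 0 < C ∧ ∀ n m : ℕ,
      0 < Λ σ n m - Λ 0 n m ∧ Λ σ n m - Λ 0 n m ≤ C := by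
  have hσL : 0 < σ * L := by positivity
  refine ⟨(4 * σ ^ 2 + 4 * π * σ) + L⁻¹ ^ 2 * (4 * (σ * L) ^ 2 + 4 * π * (σ * L)),
    by positivity, fun n m => ?_⟩
  obtain ⟨a1, a2⟩ := RN_aux σ _ n hσ (hk σ hσ n).1 (hk σ hσ n).2
  obtain ⟨b1, b2⟩ := RN_aux (σ * L) _ m hσL (hk _ hσL m).1 (hk _ hσL m).2
  have hLL : 0 < L⁻¹ ^ 2 := by positivity
  have c1 := mul_pos hLL b1
  have c2 := mul_le_mul_of_nonneg_left b2 hLL.le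
  rw [hΛ, hΛ, zero_mul, hk0, hk0]
  constructor <;> linarith
end

section
/- Let C > 0 and let (x_n)_{n≥0} be a nondecreasing sequence of real numbers. Suppose there is a nondecreasing function c : ℕ → ℕ (assigning to each index its cluster) such that whenever c(m) = c(n) one has |x_m − x_n| ≤ C, and such that (1/N)·#{c(n) : n ≤ N} → 0 as N → ∞. Then for every y > 0, (1/N)·#{n ≤ N : x_{n+1} − x_n > y} → 0 as N → ∞; consequently the level spacing distribution of (x_n) is a delta function at the origin. -/
/-- Let `C > 0` and let `x` be a nondecreasing sequence of reals admitting a cluster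
structure: a nondecreasing `c : ℕ → ℕ` such that indices in the same cluster have levels
within `C` of each other, and such that the number of clusters among the first `N` indices
is `o(N)`. Then for every `y > 0` the proportion of gaps `x (n+1) − x n > y` among
`n ≤ N` tends to `0`: the level spacing distribution is a delta function at the origin. -/
theorem clustered_sequence_level_spacing_delta (C : ℝ) (hC : 0 < C)
    (x : ℕ → ℝ) (hx : Monotone x)
    (c : ℕ → ℕ) (hc : Monotone c)
    (hcluster : ∀ m n : ℕ, c m = c n → |x m - x n| ≤ C)
    (hfewclusters : Filter.Tendsto
      (fun N : ℕ => (((Finset.range (N + 1)).image c).card : ℝ) / N)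
      Filter.atTop (nhds 0)) :
    ∀ y : ℝ, 0 < y → Filter.Tendsto
      (fun N : ℕ =>
        (((Finset.range (N + 1)).filter (fun n => y < x (n + 1) - x n)).card : ℝ) / N)
      Filter.atTop (nhds 0) := by
  intro y hy
  have key : ∀ N : ℕ,
      ((Finset.range (N + 1)).filter (fun n => y < x (n + 1) - x n)).card
        ≤ (⌊C / y⌋₊ + 1) * ((Finset.range (N + 1)).image c).card := by
    intro N
    refine (Finset.card_le_mul_card_image (f := c) _ (⌊C / y⌋₊ + 1) ?_).trans
      (Nat.mul_le_mul_left _ (Finset.card_le_card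
        (Finset.image_subset_image (Finset.filter_subset _ _))))
    intro k _
    set S := ((Finset.range (N + 1)).filter (fun n => y < x (n + 1) - x n)).filter
      (fun n => c n = k) with hS
    rcases S.eq_empty_or_nonempty with h | hne
    · rw [h]; simp
    have hmem : ∀ n ∈ S, y < x (n + 1) - x n ∧ c n = k := by
      intro n hn
      rw [hS] at hn
      simp only [Finset.mem_filter] at hn
      exact ⟨hn.1.2, hn.2⟩
    set a := S.min' hne with ha
    have haS : a ∈ S := S.min'_mem hne
    have hlow : ∀ n ∈ S, 0 ≤ (x n - x a) / y := fun n hn =>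
      div_nonneg (sub_nonneg.2 (hx (S.min'_le n hn))) hy.le
    have hlt : ∀ m ∈ S, ∀ n ∈ S, m < n →
        ⌊(x m - x a) / y⌋₊ < ⌊(x n - x a) / y⌋₊ := by
      intro m hm n hn hmn
      have h1 : x (m + 1) ≤ x n := hx hmn
      have h2 := (hmem m hm).1
      have h3 : (x m - x a) / y + 1 ≤ (x n - x a) / y := by
        rw [div_add_one hy.ne']
        exact div_le_div_of_nonneg_right (by linarith) hy.le
      have h4 := Nat.floor_le_floor h3
      rw [Nat.floor_add_one (hlow m hm)] at h4
      omega
    rw [← Finset.card_range (⌊C / y⌋₊ + 1)]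
    refine Finset.card_le_card_of_injOn (fun n => ⌊(x n - x a) / y⌋₊) ?_ ?_
    · intro n hn
      have h1 := hcluster n a ((hmem n hn).2.trans (hmem a haS).2.symm)
      have h2 : ⌊(x n - x a) / y⌋₊ ≤ ⌊C / y⌋₊ :=
        Nat.floor_le_floor (div_le_div_of_nonneg_right ((le_abs_self _).trans h1) hy.le)
      simp only [Finset.coe_range, Set.mem_Iio]
      omega
    · intro m hm n hn hmn
      simp only at hmn
      rcases lt_trichotomy m n with h | h | h
      · exact absurd hmn (hlt m hm n hn h).ne
      · exact h
      · exact absurd hmn (hlt n hn m hm h).ne'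
  have hlim := hfewclusters.const_mul ((⌊C / y⌋₊ : ℝ) + 1)
  rw [mul_zero] at hlim
  refine squeeze_zero (fun N => by positivity) (fun N => ?_) hlim
  rw [← mul_div_assoc]
  refine div_le_div_of_nonneg_right ?_ (Nat.cast_nonneg N)
  exact_mod_cast key N
end

section
/- Let A > 0, B ≥ 0 and 0 < θ < 1/2. Let (λ_n)_{n≥0} and (μ_n)_{n≥0} be nondecreasing sequences of nonnegative reals tending to infinity with λ_n ≤ μ_n for all n, whose counting functions N_λ(x) := #{n : λ_n ≤ x} and N_μ(x) := #{n : μ_n ≤ x} both satisfy, for some C₀ > 0 and all x ≥ 1, |N(x) − A·x − B·√x| ≤ C₀·x^θ. Then there exists C > 0 such that for all n ≥ 1, 0 ≤ μ_n − λ_n ≤ C·n^θ. -/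
/-- Let `A > 0`, `B ≥ 0`, `0 < θ < 1/2`, and let `(λ_n)`, `(μ_n)` be nondecreasing
sequences of nonnegative reals tending to `∞` with `λ_n ≤ μ_n`, whose counting functions
both satisfy a Weyl law `|N(x) − A x − B √x| ≤ C₀ x^θ` for `x ≥ 1`. Then there is `C > 0`
with `0 ≤ μ_n − λ_n ≤ C n^θ` for all `n ≥ 1`. -/
theorem weyl_law_gap_bound (A B θ : ℝ) (hA : 0 < A) (hB : 0 ≤ B)
    (hθ : 0 < θ) (hθ2 : θ < 1/2)
    (lam mu : ℕ → ℝ)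
    (hlmono : Monotone lam) (hlnonneg : ∀ n, 0 ≤ lam n)
    (hltop : Filter.Tendsto lam Filter.atTop Filter.atTop)
    (hmmono : Monotone mu) (hmnonneg : ∀ n, 0 ≤ mu n)
    (hmtop : Filter.Tendsto mu Filter.atTop Filter.atTop)
    (hle : ∀ n, lam n ≤ mu n)
    (C₀ : ℝ) (hC₀ : 0 < C₀)
    (hweyl_l : ∀ x : ℝ, 1 ≤ x →
      |(({n : ℕ | lam n ≤ x}).ncard : ℝ) - A * x - B * Real.sqrt x| ≤ C₀ * x ^ θ)
    (hweyl_m : ∀ x : ℝ, 1 ≤ x →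
      |(({n : ℕ | mu n ≤ x}).ncard : ℝ) - A * x - B * Real.sqrt x| ≤ C₀ * x ^ θ) :
    ∃ C : ℝ, 0 < C ∧ ∀ n : ℕ, 1 ≤ n →
      0 ≤ mu n - lam n ∧ mu n - lam n ≤ C * (n : ℝ) ^ θ := by
  set K : ℝ := 2 / A * (1 + C₀ ^ 2 / (2 * A)) with hK
  have hKpos : 0 < K := by positivity
  set D : ℝ := 2 * C₀ / A * K ^ θ with hD
  have hDpos : 0 < D := by positivity
  refine ⟨D + 1, by positivity, fun n hn => ⟨sub_nonneg.2 (hle n), ?_⟩⟩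
  have hn1 : (1 : ℝ) ≤ n := by exact_mod_cast hn
  have hnθ : (1 : ℝ) ≤ (n : ℝ) ^ θ := Real.one_le_rpow hn1 hθ.le
  rw [sub_le_iff_le_add]
  refine le_of_forall_lt_imp_le_of_dense (fun y hy => ?_)
  have hDn : D ≤ D * (n : ℝ) ^ θ := le_mul_of_one_le_right hDpos.le hnθ
  set x := max (lam n) 1 with hx
  have hx1 : 1 ≤ x := le_max_right _ _
  have hxl : lam n ≤ x := le_max_left _ _
  have hxl1 : x ≤ lam n + 1 := max_le (by linarith) (by linarith [hlnonneg n])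
  rcases le_total y x with hyx | hxy
  · linarith
  have hy1 : 1 ≤ y := hx1.trans hxy
  have hfin : {k : ℕ | lam k ≤ x}.Finite := by
    obtain ⟨N, hN⟩ := Filter.eventually_atTop.1 (hltop.eventually_gt_atTop x)
    refine (Set.finite_lt_nat N).subset (fun k hk => ?_)
    by_contra h
    exact absurd (hN k (not_lt.1 h)) (not_lt.2 hk)
  have h1 : n + 1 ≤ {k : ℕ | lam k ≤ x}.ncard := by
    have := Set.ncard_le_ncard (s := ((Finset.range (n+1) : Finset ℕ) : Set ℕ)) (fun k hk => by
      have hk' : k < n + 1 := by simpa using hk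
      exact (hlmono (Nat.lt_succ_iff.1 hk')).trans hxl) hfin
    rwa [Set.ncard_coe_finset, Finset.card_range] at this
  have h2 : {k : ℕ | mu k ≤ y}.ncard ≤ n := by
    have := Set.ncard_le_ncard (s := {k : ℕ | mu k ≤ y})
      (t := ((Finset.range n : Finset ℕ) : Set ℕ)) (fun k hk => by
        have hk' : k < n := by
          by_contra h
          exact absurd (hy.trans_le (hmmono (not_lt.1 h))) (not_lt.2 hk)
        simpa using hk') (Finset.finite_toSet _)
    rwa [Set.ncard_coe_finset, Finset.card_range] at this
  have h1' : (n : ℝ) + 1 ≤ ({k : ℕ | lam k ≤ x}.ncard : ℝ) := by exact_mod_cast h1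
  have h2' : ({k : ℕ | mu k ≤ y}.ncard : ℝ) ≤ n := by exact_mod_cast h2
  have hl := (abs_le.1 (hweyl_l x hx1)).2
  have hm := (abs_le.1 (hweyl_m y hy1)).1
  have hs : B * Real.sqrt x ≤ B * Real.sqrt y :=
    mul_le_mul_of_nonneg_left (Real.sqrt_le_sqrt hxy) hB
  have hp : C₀ * x ^ θ ≤ C₀ * y ^ θ :=
    mul_le_mul_of_nonneg_left (Real.rpow_le_rpow (by linarith) hxy hθ.le) hC₀.le
  have hys : y ^ θ ≤ Real.sqrt y := by
    rw [Real.sqrt_eq_rpow]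
    exact Real.rpow_le_rpow_of_exponent_le hy1 hθ2.le
  have hBy : 0 ≤ B * Real.sqrt y := by positivity
  have hyK : y ≤ K * n := by
    have hsq : Real.sqrt y ^ 2 = y := Real.sq_sqrt (by linarith)
    have e1 : C₀ * y ^ θ ≤ C₀ * Real.sqrt y := mul_le_mul_of_nonneg_left hys hC₀.le
    have e2 : C₀ * Real.sqrt y ≤ A * y / 2 + C₀ ^ 2 / (2 * A) := by
      have : A * y / 2 + C₀ ^ 2 / (2 * A) - C₀ * Real.sqrt y
          = (A * Real.sqrt y - C₀) ^ 2 / (2 * A) := by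
        rw [sub_sq, mul_pow, hsq]; field_simp; ring
      have h0 : 0 ≤ (A * Real.sqrt y - C₀) ^ 2 / (2 * A) := by positivity
      linarith
    have e3 : C₀ ^ 2 / (2 * A) ≤ C₀ ^ 2 / (2 * A) * n :=
      le_mul_of_one_le_right (by positivity) hn1
    have e4 : A / 2 * y ≤ A / 2 * (K * n) := by
      have : A / 2 * (K * n) = n + C₀ ^ 2 / (2 * A) * n := by
        rw [hK]; field_simp
      rw [this]; linarith
    exact le_of_mul_le_mul_left e4 (by positivity)
  have hyθ : y ^ θ ≤ K ^ θ * (n : ℝ) ^ θ := by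
    rw [← Real.mul_rpow hKpos.le (by linarith)]
    exact Real.rpow_le_rpow (by linarith) hyK hθ.le
  have hfinal : y - x ≤ D * (n : ℝ) ^ θ := by
    have e : A * (D * (n : ℝ) ^ θ) = 2 * (C₀ * (K ^ θ * (n : ℝ) ^ θ)) := by
      rw [hD]; field_simp
    have := mul_le_mul_of_nonneg_left hyθ hC₀.le
    refine le_of_mul_le_mul_left ?_ hA
    rw [e]; linarith
  linarith
end
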